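/- Suppose c_0 ≠ 1 and the structural conditions (C1)–(C6) hold. Let u = (u_1,u_2,u_3) be a smooth solution of the Cauchy problem on (0,T*)×ℝ³ with data (f_i,g_i) ∈ C_0^∞(ℝ³)×C_0^∞(ℝ³) supported in {|x| < R}, such that for all t ∈ (0,T*): ⟨t⟩^{−δ}𝒩_4(u(t)) + 𝒩_3(u(t)) ≤ 2C*‖(f,g)‖_D and supp u_i(t,·) ⊂ {x ∈ ℝ³ : |x| < R + c*t} (i = 1,2,3), where c* = max{1, c_0} and C* is a fixed constant determined by the problem. Then there exists ε_0 > 0 (depending only on the system and C*) such that if ‖(f,g)‖_D < ε_0, one has ℳ_μ(u(t)) ≤ C 𝒩_μ(u(t)) for μ = 3,4 and all t ∈ (0,T*), with a constant C independent of u, t, and T*. -/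

import Mathlib

open MeasureTheory Real Set

noncomputable section

namespace MultiSpeedWave

/-- Physical space `ℝ³` with the Euclidean norm. -/
abbrev Sp : Type := EuclideanSpace ℝ (Fin 3)

/-- A space-time point `(t, x)`. -/
abbrev Pt : Type := ℝ × Sp

/-- A scalar field on space-time. -/
abbrev Fn : Type := Pt → ℝ

/-- Time derivative `∂_t`. -/
def pt (v : Fn) : Fn := fun p => fderiv ℝ v p (1, 0)

/-- Spatial derivative `∂_j`. -/
def px (j : Fin 3) (v : Fn) : Fn := fun p => fderiv ℝ v p (0, EuclideanSpace.single j 1)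

/-- Space-time derivative `∂_α` (`α = 0` is time). -/
def pd (α : Fin 4) : Fn → Fn := Fin.cases pt px α

/-- Rotation `Ω_{ij} = x_i ∂_j − x_j ∂_i` (0-based indices). -/
def om (i j : Fin 3) (v : Fn) : Fn := fun p => p.2 i * px j v p - p.2 j * px i v p

/-- Scaling vector field `S = t ∂_t + x·∇`. -/
def sOp (v : Fn) : Fn := fun p => p.1 * pt v p + ∑ j : Fin 3, p.2 j * px j v p

/-- The seven generators `Z_1,…,Z_7 = ∂_1,∂_2,∂_3,Ω_{12},Ω_{23},Ω_{13},S`. -/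
def Zop : Fin 7 → Fn → Fn := ![px 0, px 1, px 2, om 0 1, om 1 2, om 0 2, sOp]

/-- `Z^a` for a multi-index `a`. -/
def Zmulti (a : Fin 7 → ℕ) (v : Fn) : Fn :=
  (List.finRange 7).foldr (fun i w => (Zop i)^[a i] w) v

/-- `∂_x^a` for a spatial multi-index `a`, acting on space-time functions. -/
def pxMulti (a : Fin 3 → ℕ) (v : Fn) : Fn :=
  (List.finRange 3).foldr (fun i w => (px i)^[a i] w) v

/-- `Ω^b = Ω_{12}^{b₁} Ω_{23}^{b₂} Ω_{13}^{b₃}`. -/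
def omMulti (b : Fin 3 → ℕ) (v : Fn) : Fn :=
  (om 0 1)^[b 0] ((om 1 2)^[b 1] ((om 0 2)^[b 2] v))

/-- All multi-indices of length `n` and total degree `≤ m`. -/
def idxSet (n m : ℕ) : Finset (Fin n → ℕ) :=
  (Fintype.piFinset fun _ => Finset.range (m+1)).filter fun a => ∑ i, a i ≤ m

/-- The Japanese bracket `⟨ρ⟩ = (1+ρ²)^{1/2}`. -/
def jb (ρ : ℝ) : ℝ := Real.sqrt (1 + ρ^2)

/-- The d'Alembertian `□_c = ∂_t² − c²Δ`. -/
def boxOp (c : ℝ) (v : Fn) : Fn :=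
  fun p => pt (pt v) p - c^2 * ∑ j : Fin 3, px j (px j v) p

/-- Energy `E(v(t);c)`. -/
def energy (c : ℝ) (v : Fn) (t : ℝ) : ℝ :=
  (1/2) * ∫ x : Sp, ((pt v (t,x))^2 + c^2 * ∑ j : Fin 3, (px j v (t,x))^2)

/-- Generalized energy `N_κ(v(t);c)`. -/
def Nnorm (κ : ℕ) (c : ℝ) (v : Fn) (t : ℝ) : ℝ :=
  Real.sqrt (∑ a ∈ idxSet 7 (κ-1), energy c (Zmulti a v) t)

/-- `L²(ℝ³)` norm. -/
def L2 (f : Sp → ℝ) : ℝ := Real.sqrt (∫ x : Sp, (f x)^2)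

/-- The auxiliary norm `M₂(v(t);c)`. -/
def M2 (c : ℝ) (v : Fn) (t : ℝ) : ℝ :=
  ∑ α : Fin 4, ∑ j : Fin 3, L2 (fun x => jb (c*t - ‖x‖) * pd α (px j v) (t,x))

/-- The auxiliary norm `M_μ(v(t);c)`. -/
def Mmu (μ : ℕ) (c : ℝ) (v : Fn) (t : ℝ) : ℝ :=
  ∑ a ∈ idxSet 7 (μ-2), M2 c (Zmulti a v) t

/-- The good derivative `T_j^{(c)} = c ∂_j + (x_j/|x|) ∂_t`. -/
def Tder (c : ℝ) (j : Fin 3) (v : Fn) : Fn :=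
  fun p => c * px j v p + (p.2 j / ‖p.2‖) * pt v p

/-- `|T^{(c)} v|`. -/
def Tnorm (c : ℝ) (v : Fn) (p : Pt) : ℝ := Real.sqrt (∑ j : Fin 3, (Tder c j v p)^2)

/-- `|∂v|` (full space-time gradient). -/
def pdNorm (v : Fn) (p : Pt) : ℝ := Real.sqrt (∑ α : Fin 4, (pd α v p)^2)

/-- `|∂_x v|` (spatial gradient). -/
def pxNorm (v : Fn) (p : Pt) : ℝ := Real.sqrt (∑ j : Fin 3, (px j v p)^2)

/-- `L^∞(ℝ³)` norm. -/
def Linf (f : Sp → ℝ) : ℝ := ⨆ x : Sp, |f x|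

/-- `L⁶(ℝ³)` norm. -/
def L6 (f : Sp → ℝ) : ℝ := (∫ x : Sp, |f x|^6) ^ ((1:ℝ)/6)

/-- The unit sphere `S²`. -/
abbrev S2 := Metric.sphere (0 : Sp) 1

/-- Surface measure on the unit sphere. -/
def sphMeas : Measure S2 := (volume : Measure Sp).toSphere

/-- `‖f(r·)‖_{L⁴(S²)}`. -/
def L4sph (f : Sp → ℝ) (r : ℝ) : ℝ :=
  (∫ ω : S2, |f (r • (ω : Sp))|^4 ∂sphMeas) ^ ((1:ℝ)/4)

/-- Mixed norm `‖f‖_{L_r^∞ L_ω^4}`. -/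
def LinfrL4 (f : Sp → ℝ) : ℝ := ⨆ r : Set.Ioi (0:ℝ), L4sph f (r : ℝ)

/-- Spatial derivative for functions of `x` only. -/
def dxj (j : Fin 3) (f : Sp → ℝ) : Sp → ℝ := fun x => fderiv ℝ f x (EuclideanSpace.single j 1)

/-- `∂_x^a` for functions of `x` only. -/
def dxMulti (a : Fin 3 → ℕ) (f : Sp → ℝ) : Sp → ℝ :=
  (List.finRange 3).foldr (fun i w => (dxj i)^[a i] w) f

/-- The null condition for coefficients `{H^{αβ}}` relative to the cone `𝒩^{(c)}`. -/
def nullCond (c : ℝ) (H : Fin 4 → Fin 4 → ℝ) : Prop :=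
  ∀ X : Fin 4 → ℝ, (X 0)^2 = c^2 * ((X 1)^2 + (X 2)^2 + (X 3)^2) →
    ∑ α : Fin 4, ∑ β : Fin 4, H α β * X α * X β = 0

/-- The quadratic form `H^{αβ}(∂_α v)(∂_β w)`. -/
def nullQ (H : Fin 4 → Fin 4 → ℝ) (v w : Fn) : Fn :=
  fun p => ∑ α : Fin 4, ∑ β : Fin 4, H α β * pd α v p * pd β w p

/-- Coefficients `F_i^{jk,αβ}` of the quadratic part. -/
abbrev Coef := Fin 3 → Fin 3 → Fin 3 → Fin 4 → Fin 4 → ℝ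

/-- The speeds `c₁ = c₂ = 1`, `c₃ = c₀`. -/
def cspeed (c0 : ℝ) : Fin 3 → ℝ := ![1, 1, c0]

/-- Evaluation of a cubic remainder at the gradients of `u`. -/
def cubicEval (P : MvPolynomial (Fin 3 × Fin 4) ℝ) (u : Fin 3 → Fn) : Fn :=
  fun p => MvPolynomial.eval (fun q => pd q.2 (u q.1) p) P

/-- Every monomial has degree at least 3. -/
def CubicLike (P : MvPolynomial (Fin 3 × Fin 4) ℝ) : Prop :=
  ∀ m ∈ P.support, 3 ≤ m.sum fun _ e => e

/-- The right-hand side `F_i(∂u)`. -/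
def rhs (F : Coef) (Cub : Fin 3 → MvPolynomial (Fin 3 × Fin 4) ℝ)
    (u : Fin 3 → Fn) (i : Fin 3) : Fn :=
  fun p => (∑ j : Fin 3, ∑ k : Fin 3, ∑ α : Fin 4, ∑ β : Fin 4,
      F i j k α β * pd α (u j) p * pd β (u k) p) + cubicEval (Cub i) u p

/-- `u` solves the system for times in `s`. -/
def IsSolutionOn (c0 : ℝ) (F : Coef) (Cub : Fin 3 → MvPolynomial (Fin 3 × Fin 4) ℝ)
    (u : Fin 3 → Fn) (s : Set ℝ) : Prop :=
  ∀ i : Fin 3, ∀ t ∈ s, ∀ x : Sp, boxOp (cspeed c0 i) (u i) (t,x) = rhs F Cub u i (t,x)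

/-- `F_i^{jk} = 0` for `j > k`. -/
def LowerTri (F : Coef) : Prop :=
  ∀ (i j k : Fin 3), (k : ℕ) < (j : ℕ) → ∀ (α β : Fin 4), F i j k α β = 0

/-- Structural condition (C1). -/
def CondC1 (F : Coef) : Prop := nullCond 1 (F 0 0 0)

/-- Structural condition (C2). -/
def CondC2 (F : Coef) : Prop :=
  nullCond 1 (F 1 0 0) ∧ nullCond 1 (F 1 0 1) ∧ nullCond 1 (F 1 1 1)

/-- Structural condition (C3). -/
def CondC3 (c0 : ℝ) (F : Coef) : Prop := nullCond c0 (F 2 2 2)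

/-- Structural condition (C4). -/
def CondC4 (F : Coef) : Prop := ∀ (α β : Fin 4), F 1 0 2 α β = 0

/-- Structural condition (C5). -/
def CondC5 (F : Coef) : Prop := ∀ (α β : Fin 4), F 2 0 2 α β = 0

/-- Structural condition (C6). -/
def CondC6 (F : Coef) : Prop := nullCond 1 (F 2 0 0) ∧ nullCond 1 (F 2 0 1)

/-- The data norm `‖(f,g)‖_D`. -/
def dataNorm (f g : Fin 3 → Sp → ℝ) : ℝ :=
  ∑ i : Fin 3,
    ((∑ a ∈ (idxSet 3 4).filter (fun a => 1 ≤ ∑ j, a j),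
        L2 (fun x => jb ‖x‖ ^ ((∑ j, a j) - 1) * dxMulti a (f i) x))
      + ∑ a ∈ idxSet 3 3, L2 (fun x => jb ‖x‖ ^ (∑ j, a j) * dxMulti a (g i) x))

/-- The weights `σ₁ = δ`, `σ₂ = σ₃ = 0`. -/
def sig (δ : ℝ) : Fin 3 → ℝ := ![δ, 0, 0]

/-- Weighted `L^∞` norm of a gradient. -/
def wInf (w : Sp → ℝ) (v : Fn) (t : ℝ) : ℝ := Linf fun x => w x * pdNorm v (t,x)

/-- Weighted `L_r^∞ L_ω^4` norm of a gradient. -/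
def wL4 (w : Sp → ℝ) (v : Fn) (t : ℝ) : ℝ := LinfrL4 fun x => w x * pdNorm v (t,x)

/-- Weighted `L⁶` norm of a gradient. -/
def wL6 (w : Sp → ℝ) (v : Fn) (t : ℝ) : ℝ := L6 fun x => w x * pdNorm v (t,x)

/-- The collection of weighted pointwise norms `⟨⟨u(t)⟩⟩`. -/
def bigBracket (c0 δ : ℝ) (u : Fin 3 → Fn) (t : ℝ) : ℝ :=
  (∑ i : Fin 3, jb t ^ (-(sig δ i)) *
     wInf (fun x => ‖x‖ * Real.sqrt (jb (cspeed c0 i * t - ‖x‖))) (u i) t)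
  + (∑ i : Fin 3, ∑ a ∈ idxSet 7 1, jb t ^ (-(sig δ i) - δ) *
     wInf (fun x => ‖x‖ * Real.sqrt (jb (cspeed c0 i * t - ‖x‖))) (Zmulti a (u i)) t)
  + (∑ i : Fin 3, ∑ a ∈ idxSet 7 1, jb t ^ (-(sig δ i)) *
     (wL4 (fun x => Real.sqrt ‖x‖ * jb (cspeed c0 i * t - ‖x‖)) (Zmulti a (u i)) t
      + ∑ j : Fin 7, LinfrL4 fun x => Real.sqrt ‖x‖ * Zop j (Zmulti a (u i)) (t,x)))
  + (∑ i : Fin 3, ∑ a ∈ idxSet 7 2, jb t ^ (-(sig δ i) - δ) *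
     (wL4 (fun x => Real.sqrt ‖x‖ * jb (cspeed c0 i * t - ‖x‖)) (Zmulti a (u i)) t
      + ∑ j : Fin 7, LinfrL4 fun x => Real.sqrt ‖x‖ * Zop j (Zmulti a (u i)) (t,x)))
  + (∑ i : Fin 3, ∑ a ∈ idxSet 7 1, jb t ^ (-(sig δ i)) *
     wL4 (fun x => ‖x‖) (Zmulti a (u i)) t)
  + (∑ i : Fin 3, jb t ^ (-(sig δ i)) *
     wInf (fun x => jb (cspeed c0 i * t - ‖x‖)) (u i) t)
  + (jb t ^ (-δ) * ∑ i : Fin 3, ∑ a ∈ idxSet 7 1, jb t ^ (-(sig δ i)) *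
     wInf (fun x => jb (cspeed c0 i * t - ‖x‖)) (Zmulti a (u i)) t)
  + (∑ i : Fin 3, ∑ a ∈ idxSet 7 1, jb t ^ (-(sig δ i)) *
     wL6 (fun x => jb (cspeed c0 i * t - ‖x‖)) (Zmulti a (u i)) t)

/-- `⟨⟨u⟩⟩_T = sup_{0<t<T} ⟨⟨u(t)⟩⟩`. -/
def bigBracketSup (c0 δ T : ℝ) (u : Fin 3 → Fn) : ℝ :=
  ⨆ t : Set.Ioo (0:ℝ) T, bigBracket c0 δ u t

/-- `sup_{0<t<T} f(t)`. -/
def supIoo (T : ℝ) (f : ℝ → ℝ) : ℝ := ⨆ t : Set.Ioo (0:ℝ) T, f t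

/-- `𝒩_κ(u(t))`. -/
def calN (c0 δ : ℝ) (κ : ℕ) (u : Fin 3 → Fn) (t : ℝ) : ℝ :=
  jb t ^ (-δ) * Nnorm κ 1 (u 0) t + Nnorm κ 1 (u 1) t + Nnorm κ c0 (u 2) t

/-- `ℳ_κ(u(t))`. -/
def calM (c0 δ : ℝ) (κ : ℕ) (u : Fin 3 → Fn) (t : ℝ) : ℝ :=
  jb t ^ (-δ) * Mmu κ 1 (u 0) t + Mmu κ 1 (u 1) t + Mmu κ c0 (u 2) t

/-- The ghost-weight quantity `G(v(t);c)` (with parameter `η`). -/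
def Gnorm (η c : ℝ) (v : Fn) (t : ℝ) : ℝ :=
  Real.sqrt (∑ a ∈ idxSet 7 3, ∑ j : Fin 3,
    ∫ x : Sp, jb (c*t - ‖x‖) ^ (-1 - 2*η) * (Tder c j (Zmulti a v) (t,x))^2)

/-- The Keel–Smith–Sogge type local-energy norm `L(v(t))`. -/
def Lnorm (v : Fn) (t : ℝ) : ℝ :=
  Real.sqrt (∑ a ∈ idxSet 7 3,
    ((∫ x : Sp, (‖x‖ ^ (-(5:ℝ)/4) * Zmulti a v (t,x))^2) +
     ∑ α : Fin 4, ∫ x : Sp, (‖x‖ ^ (-(1:ℝ)/4) * pd α (Zmulti a v) (t,x))^2))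

/-- A smooth local solution on `(0,T)×ℝ³`, compactly supported in `x`. -/
def LocalSolution (c0 : ℝ) (F : Coef) (Cub : Fin 3 → MvPolynomial (Fin 3 × Fin 4) ℝ)
    (T : ℝ) (u : Fin 3 → Fn) : Prop :=
  (∀ i, ContDiff ℝ (⊤ : ℕ∞) (u i)) ∧
  (∀ i t, HasCompactSupport fun x => u i (t, x)) ∧
  IsSolutionOn c0 F Cub u (Set.Ioo 0 T)

/-- A global solution of the Cauchy problem with data `(f,g)`. -/
def IsGlobalSolution (c0 : ℝ) (F : Coef) (Cub : Fin 3 → MvPolynomial (Fin 3 × Fin 4) ℝ)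
    (f g : Fin 3 → Sp → ℝ) (u : Fin 3 → Fn) : Prop :=
  (∀ i, ContDiff ℝ (⊤ : ℕ∞) (u i)) ∧
  IsSolutionOn c0 F Cub u (Set.Ioi 0) ∧
  (∀ i x, u i (0, x) = f i x ∧ pt (u i) (0, x) = g i x)

end MultiSpeedWave

namespace MultiSpeedWave

/-- Continuous functions on space with compact support. -/
def CC (f : Sp → ℝ) : Prop := Continuous f ∧ HasCompactSupport f

lemma CC.mul_left {f g : Sp → ℝ} (hf : CC f) (hg : Continuous g) : CC fun x => g x * f x :=
  ⟨hg.mul hf.1, hf.2.mul_left⟩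

lemma CC.mul_right {f g : Sp → ℝ} (hf : CC f) (hg : Continuous g) : CC fun x => f x * g x :=
  ⟨hf.1.mul hg, hf.2.mul_right⟩

lemma CC.add {f g : Sp → ℝ} (hf : CC f) (hg : CC g) : CC fun x => f x + g x :=
  ⟨hf.1.add hg.1, hf.2.add hg.2⟩

lemma CC.pow {f : Sp → ℝ} (hf : CC f) {n : ℕ} (hn : n ≠ 0) : CC fun x => f x ^ n :=
  ⟨hf.1.pow n, hf.2.comp_left (g := fun y : ℝ => y ^ n) (by simp [hn])⟩

lemma CC.abs {f : Sp → ℝ} (hf : CC f) : CC fun x => |f x| :=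
  ⟨hf.1.abs, hf.2.comp_left (g := fun y : ℝ => |y|) (by simp)⟩

lemma CC.sum {ι : Type*} (s : Finset ι) {f : ι → Sp → ℝ} (hf : ∀ i ∈ s, CC (f i)) :
    CC fun x => ∑ i ∈ s, f i x := by
  classical
  induction s using Finset.induction_on with
  | empty => simpa using ⟨continuous_const, HasCompactSupport.zero⟩
  | insert a s ha ih =>
    simp only [Finset.sum_insert ha]
    exact (hf a (by simp)).add (ih fun i hi => hf i (by simp [hi]))

lemma CC.integrable {f : Sp → ℝ} (hf : CC f) : Integrable f :=
  hf.1.integrable_of_hasCompactSupport hf.2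

lemma CC.memLp {f : Sp → ℝ} (hf : CC f) (p : ENNReal) : MemLp f p :=
  hf.1.memLp_of_hasCompactSupport hf.2

lemma L2_nonneg (f : Sp → ℝ) : 0 ≤ L2 f := Real.sqrt_nonneg _

lemma L2_sq (f : Sp → ℝ) : L2 f ^ 2 = ∫ x, f x ^ 2 :=
  Real.sq_sqrt (integral_nonneg fun _ => sq_nonneg _)

lemma L2_eq_eLpNorm {f : Sp → ℝ} (hf : CC f) : L2 f = (eLpNorm f 2 volume).toReal := by
  rw [(hf.memLp 2).eLpNorm_eq_integral_rpow_norm (by norm_num) (by norm_num),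
    ENNReal.toReal_ofReal (by positivity), L2, Real.sqrt_eq_rpow]
  norm_num

/-- Minkowski's inequality in `L²`, for a pointwise bound by a finite sum. -/
lemma L2_le_sum {ι : Type*} (s : Finset ι) {f : Sp → ℝ} {c : ι → ℝ} {g : ι → Sp → ℝ}
    (hf : CC f) (hg : ∀ i ∈ s, CC (g i)) (hc : ∀ i ∈ s, 0 ≤ c i)
    (h : ∀ x, |f x| ≤ ∑ i ∈ s, c i * |g i x|) :
    L2 f ≤ ∑ i ∈ s, c i * L2 (g i) := by
  have hcg : ∀ i ∈ s, CC fun x => c i * |g i x| := fun i hi =>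
    (hg i hi).abs.mul_left continuous_const
  have hfin : ∀ i ∈ s, eLpNorm (fun x => c i * |g i x|) 2 volume ≠ ⊤ := fun i hi =>
    ((hcg i hi).memLp 2).2.ne
  have h1 : eLpNorm f 2 volume ≤ ∑ i ∈ s, eLpNorm (fun x => c i * |g i x|) 2 volume := by
    refine (eLpNorm_mono_real (g := fun x => ∑ i ∈ s, c i * |g i x|) ?_).trans ?_
    · simpa using h
    · have := eLpNorm_sum_le (μ := (volume : Measure Sp)) (p := 2) (s := s)
        (f := fun i x => c i * |g i x|)
        (fun i hi => (hcg i hi).1.aestronglyMeasurable) (by norm_num)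
      have e : (fun x => ∑ i ∈ s, c i * |g i x|) = ∑ i ∈ s, fun x => c i * |g i x| := by
        ext x
        simp [Finset.sum_apply]
      rw [e]
      exact this
  rw [L2_eq_eLpNorm hf]
  refine (ENNReal.toReal_mono (ENNReal.sum_ne_top.2 hfin) h1).trans ?_
  rw [ENNReal.toReal_sum hfin]
  refine Finset.sum_le_sum fun i hi => ?_
  rw [← L2_eq_eLpNorm (hcg i hi), L2, L2, ← Real.sqrt_sq (hc i hi), ← Real.sqrt_mul (sq_nonneg _),
    ← integral_const_mul]
  simp [mul_pow, Real.sqrt_sq (hc i hi)]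

lemma L2_mono {f g : Sp → ℝ} (hf : CC f) (hg : CC g) (h : ∀ x, |f x| ≤ |g x|) :
    L2 f ≤ L2 g := by
  have := L2_le_sum (Finset.univ : Finset Unit) (c := fun _ => 1) (g := fun _ => g) hf
    (fun _ _ => hg) (fun _ _ => zero_le_one) (by simpa using h)
  simpa using this

/-- The Gagliardo–Nirenberg–Sobolev inequality `Ḣ¹(ℝ³) ⊂ L⁶(ℝ³)`. -/
lemma exists_integral_pow_six_le :
    ∃ C : ℝ, 0 ≤ C ∧ ∀ f : Sp → ℝ, ContDiff ℝ 1 f → HasCompactSupport f →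
      ∫ x, f x ^ 6 ≤ C * (∫ x, ‖fderiv ℝ f x‖ ^ 2) ^ 3 := by
  set K : NNReal := SNormLESNormFDerivOfEqConst ℝ (volume : Measure Sp) ((2 : NNReal) : ℝ)
  refine ⟨(K : ℝ) ^ 6, by positivity, fun f hf hs => ?_⟩
  have h : eLpNorm f 6 volume ≤ (K : ENNReal) * eLpNorm (fderiv ℝ f) 2 volume := by
    have := eLpNorm_le_eLpNorm_fderiv_of_eq (volume : Measure Sp) hf hs (p := 2) (p' := 6)
      (by norm_num) (by simp) (by simp; norm_num)
    exact this
  have hCf : CC f := ⟨hf.continuous, hs⟩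
  have hD : MemLp (fderiv ℝ f) 2 (volume : Measure Sp) :=
    (hf.continuous_fderiv (by norm_num)).memLp_of_hasCompactSupport (hs.fderiv ℝ)
  have h' := ENNReal.toReal_mono (ENNReal.mul_ne_top ENNReal.coe_ne_top hD.2.ne) h
  have e1 := (hCf.memLp 6).eLpNorm_eq_integral_rpow_norm (by norm_num) (by norm_num)
  have e2 := hD.eLpNorm_eq_integral_rpow_norm (by norm_num) (by norm_num)
  rw [ENNReal.toReal_mul, e1, e2, ENNReal.toReal_ofReal (by positivity),
    ENNReal.toReal_ofReal (by positivity)] at h'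
  have i6 : (∫ x, ‖f x‖ ^ (ENNReal.toReal 6)) = ∫ x, f x ^ 6 := by
    refine integral_congr_ae (.of_forall fun x => ?_)
    simp only [ENNReal.toReal_ofNat]
    rw [show (6 : ℝ) = ((6 : ℕ) : ℝ) by norm_num, Real.rpow_natCast, Real.norm_eq_abs,
      Even.pow_abs (by decide)]
  have i2 : (∫ x, ‖fderiv ℝ f x‖ ^ (ENNReal.toReal 2)) = ∫ x, ‖fderiv ℝ f x‖ ^ 2 := by
    refine integral_congr_ae (.of_forall fun x => ?_)
    simp only [ENNReal.toReal_ofNat]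
    rw [show (2 : ℝ) = ((2 : ℕ) : ℝ) by norm_num, Real.rpow_natCast]
  rw [i6, i2] at h'
  have p6 : 0 ≤ ∫ x, f x ^ 6 := integral_nonneg fun x => by positivity
  have p2 : 0 ≤ ∫ x, ‖fderiv ℝ f x‖ ^ 2 := integral_nonneg fun x => by positivity
  have h6 := pow_le_pow_left₀ (by positivity) h' 6
  rw [mul_pow, ← Real.rpow_natCast, ← Real.rpow_mul p6, ← Real.rpow_natCast (_ ^ _) 6,
    ← Real.rpow_mul p2] at h6
  norm_num at h6
  exact h6

/-- Integration in polar coordinates on `ℝ³`. -/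
lemma lintegral_polar {g : Sp → ENNReal} (hg : Measurable g) :
    ∫⁻ x, g x = ∫⁻ ω : S2, (∫⁻ r in Ioi (0 : ℝ), ENNReal.ofReal (r ^ 2) * g (r • (ω : Sp)))
      ∂sphMeas := by
  have hmp := (volume : Measure Sp).measurePreserving_homeomorphUnitSphereProd
  have h1 : ∫⁻ x, g x = ∫⁻ x : ({0}ᶜ : Set Sp), g x ∂((volume : Measure Sp).comap (↑)) := by
    rw [lintegral_subtype_comap (measurableSet_singleton _).compl, restrict_compl_singleton]
  have hm : Measurable fun q : S2 × Ioi (0 : ℝ) => g ((q.2 : ℝ) • (q.1 : Sp)) :=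
    hg.comp (by fun_prop)
  have h2 : ∫⁻ x : ({0}ᶜ : Set Sp), g x ∂((volume : Measure Sp).comap (↑))
      = ∫⁻ q : S2 × Ioi (0 : ℝ), g ((q.2 : ℝ) • (q.1 : Sp))
        ∂((volume : Measure Sp).toSphere.prod (Measure.volumeIoiPow (Module.finrank ℝ Sp - 1))) := by
    rw [← hmp.lintegral_comp hm]
    refine lintegral_congr fun x => ?_
    congr 1
    have hx : ‖(x : Sp)‖ ≠ 0 := norm_ne_zero_iff.2 (by exact x.2)
    simp [smul_smul, hx]
  rw [h1, h2, lintegral_prod _ hm.aemeasurable, sphMeas]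
  refine lintegral_congr fun ω => ?_
  have hm' : Measurable fun r : ℝ => g (r • (ω : Sp)) := hg.comp (by fun_prop)
  have hg' : Measurable fun y : Ioi (0 : ℝ) => g ((y : ℝ) • (ω : Sp)) :=
    hm'.comp measurable_subtype_coe
  rw [Measure.volumeIoiPow]
  refine (lintegral_withDensity_eq_lintegral_mul _ (by fun_prop) hg').trans ?_
  rw [← lintegral_subtype_comap measurableSet_Ioi
    (f := fun r : ℝ => ENNReal.ofReal (r ^ 2) * g (r • (ω : Sp)))]
  simp

/-- The logarithmic change of the radial variable, which is conformal from `ℝ³ ∖ B(0,1)` to a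
half-cylinder. -/
lemma lintegral_log_radial {g : Sp → ENNReal} (hg : Measurable g) :
    ∫⁻ y : Sp, (if 1 < ‖y‖ then ENNReal.ofReal (‖y‖⁻¹ ^ 3 * Real.log ‖y‖ ^ 2) *
      g ((Real.log ‖y‖ * ‖y‖⁻¹) • y) else 0) = ∫⁻ x, g x := by
  rw [lintegral_polar hg, lintegral_polar]
  swap
  · refine Measurable.ite (measurableSet_lt measurable_const measurable_norm) ?_ measurable_const
    refine Measurable.mul (by fun_prop) (hg.comp ?_)
    exact ((Real.measurable_log.comp measurable_norm).mul measurable_norm.inv).smul measurable_id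
  refine lintegral_congr fun ω => ?_
  have hω : ‖(ω : Sp)‖ = 1 := by simp
  have himg : Real.exp '' Ioi 0 = Ioi 1 := by
    ext y
    constructor
    · rintro ⟨x, hx, rfl⟩
      exact Real.one_lt_exp_iff.2 hx
    · intro hy
      exact ⟨Real.log y, Real.log_pos hy, Real.exp_log (zero_lt_one.trans hy)⟩
  have hsub : Ioi (1 : ℝ) ⊆ Ioi 0 := Ioi_subset_Ioi zero_le_one
  have hL : ∫⁻ r in Ioi (0 : ℝ), ENNReal.ofReal (r ^ 2) *
      (if 1 < ‖r • (ω : Sp)‖ then ENNReal.ofReal (‖r • (ω : Sp)‖⁻¹ ^ 3 *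
        Real.log ‖r • (ω : Sp)‖ ^ 2) *
        g ((Real.log ‖r • (ω : Sp)‖ * ‖r • (ω : Sp)‖⁻¹) • r • (ω : Sp)) else 0)
      = ∫⁻ r in Ioi (1 : ℝ), ENNReal.ofReal (r⁻¹ * Real.log r ^ 2) *
          g (Real.log r • (ω : Sp)) := by
    rw [← lintegral_indicator measurableSet_Ioi, ← lintegral_indicator measurableSet_Ioi]
    refine lintegral_congr fun r => ?_
    by_cases h1 : 1 < r
    · have h0 : 0 < r := zero_lt_one.trans h1
      rw [indicator_of_mem (by exact h0), indicator_of_mem (by exact h1)]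
      have hn : ‖r • (ω : Sp)‖ = r := by rw [norm_smul, hω, mul_one, Real.norm_of_nonneg h0.le]
      rw [hn, if_pos h1, smul_smul, ← mul_assoc, ← ENNReal.ofReal_mul (by positivity)]
      congr 2
      · field_simp
      · congr 1
        field_simp
    · rw [indicator_of_notMem (s := Ioi 1) (by simpa using h1)]
      by_cases h0 : 0 < r
      · have hn : ‖r • (ω : Sp)‖ = r := by rw [norm_smul, hω, mul_one, Real.norm_of_nonneg h0.le]
        rw [indicator_of_mem (by exact h0), hn, if_neg h1, mul_zero]
      · rw [indicator_of_notMem (by simpa using h0)]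
  rw [hL, ← himg, lintegral_image_eq_lintegral_abs_deriv_mul measurableSet_Ioi
    (fun x _ => (Real.hasDerivAt_exp x).hasDerivWithinAt) Real.exp_injective.injOn]
  refine lintegral_congr fun r => ?_
  rw [Real.log_exp, ← mul_assoc, ← ENNReal.ofReal_mul (by positivity), abs_of_pos (Real.exp_pos r)]
  congr 2
  field_simp

/-- The rotation vector field `x_i ∂_j - x_j ∂_i`. -/
def rotVec (i j : Fin 3) (x : Sp) : Sp :=
  x i • EuclideanSpace.single j (1 : ℝ) - x j • EuclideanSpace.single i (1 : ℝ)

/-- The sum of the squares of a function, its gradient and its rotational derivatives. -/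
def rotSq (f : Sp → ℝ) (x : Sp) : ℝ :=
  f x ^ 2 + ‖fderiv ℝ f x‖ ^ 2 + ∑ i, ∑ j, (fderiv ℝ f x (rotVec i j x)) ^ 2

lemma rotSq_nonneg (f : Sp → ℝ) (x : Sp) : 0 ≤ rotSq f x := by
  unfold rotSq; positivity

lemma continuous_rotVec (i j : Fin 3) : Continuous (rotVec i j) := by
  unfold rotVec; fun_prop

lemma CC_rotSq {f : Sp → ℝ} (hf : ContDiff ℝ 1 f) (hs : HasCompactSupport f) :
    CC (rotSq f) := by
  have hd : Continuous (fderiv ℝ f) := hf.continuous_fderiv (by norm_num)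
  have hsd : HasCompactSupport (fderiv ℝ f) := hs.fderiv ℝ
  have hc : CC fun x => ‖fderiv ℝ f x‖ := ⟨hd.norm, hsd.norm⟩
  refine ((CC.pow ⟨hf.continuous, hs⟩ two_ne_zero).add (hc.pow two_ne_zero)).add ?_
  refine CC.sum _ fun i _ => CC.sum _ fun j _ => CC.pow ⟨?_, ?_⟩ two_ne_zero
  · exact hd.clm_apply (continuous_rotVec i j)
  · refine hsd.mono fun x hx => ?_
    contrapose! hx
    simp only [Function.mem_support, not_not] at hx
    simp [hx]

lemma integral_log_radial {g : Sp → ℝ} (hg : CC g) (h0 : ∀ x, 0 ≤ g x) :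
    Integrable (fun y : Sp => if 1 < ‖y‖ then ‖y‖⁻¹ ^ 3 * Real.log ‖y‖ ^ 2 *
      g ((Real.log ‖y‖ * ‖y‖⁻¹) • y) else 0) ∧
    ∫ y : Sp, (if 1 < ‖y‖ then ‖y‖⁻¹ ^ 3 * Real.log ‖y‖ ^ 2 *
      g ((Real.log ‖y‖ * ‖y‖⁻¹) • y) else 0) = ∫ x, g x := by
  set F : Sp → ℝ := fun y => if 1 < ‖y‖ then ‖y‖⁻¹ ^ 3 * Real.log ‖y‖ ^ 2 *
      g ((Real.log ‖y‖ * ‖y‖⁻¹) • y) else 0 with hF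
  have hF0 : ∀ y, 0 ≤ F y := fun y => by
    simp only [hF]
    split_ifs
    · have := h0 ((Real.log ‖y‖ * ‖y‖⁻¹) • y)
      positivity
    · exact le_rfl
  have hm : Measurable F := by
    refine Measurable.ite (measurableSet_lt measurable_const measurable_norm) ?_ measurable_const
    refine Measurable.mul ?_ (hg.1.measurable.comp ?_)
    · exact (measurable_norm.inv.pow_const 3).mul
        ((Real.measurable_log.comp measurable_norm).pow_const 2)
    · exact ((Real.measurable_log.comp measurable_norm).mul measurable_norm.inv).smul measurable_id
  have key : ∫⁻ y, ENNReal.ofReal (F y) = ∫⁻ x, ENNReal.ofReal (g x) := by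
    rw [← lintegral_log_radial (g := fun x => ENNReal.ofReal (g x)) (by
      exact ENNReal.measurable_ofReal.comp hg.1.measurable)]
    refine lintegral_congr fun y => ?_
    simp only [hF]
    split_ifs
    · rw [ENNReal.ofReal_mul (by positivity)]
    · simp
  have hfin : ∫⁻ x, ENNReal.ofReal (g x) ≠ ⊤ := hg.integrable.lintegral_lt_top.ne
  refine ⟨⟨hm.aestronglyMeasurable, ?_⟩, ?_⟩
  · rw [hasFiniteIntegral_iff_ofReal (.of_forall hF0), key]
    exact hfin.lt_top
  · rw [integral_eq_lintegral_of_nonneg_ae (.of_forall hF0) hm.aestronglyMeasurable,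
      integral_eq_lintegral_of_nonneg_ae (.of_forall h0) hg.1.aestronglyMeasurable, key]

/-- The logarithm of the norm. -/
def logNorm (y : Sp) : ℝ := Real.log (‖y‖ ^ 2) / 2

lemma logNorm_eq (y : Sp) : logNorm y = Real.log ‖y‖ := by
  simp [logNorm, Real.log_pow]

/-- Transplantation of a function under the logarithmic radial map. -/
def logPull (g : Sp → ℝ) (y : Sp) : ℝ :=
  Real.exp (-(logNorm y / 2)) * logNorm y * g ((logNorm y * Real.exp (-logNorm y)) • y)

lemma hasFDerivAt_logNorm {y : Sp} (hy : y ≠ 0) :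
    HasFDerivAt logNorm ((‖y‖ ^ 2)⁻¹ • innerSL ℝ y) y := by
  have h := ((hasStrictFDerivAt_norm_sq y).hasFDerivAt.log (by simpa using hy)).mul_const (2⁻¹ : ℝ)
  have e : (fun y : Sp => Real.log (‖y‖ ^ 2) * 2⁻¹) = logNorm := by
    ext; simp [logNorm, div_eq_mul_inv]
  rw [e] at h
  refine h.congr_fderiv ?_
  ext v
  simp
  ring

lemma contDiffAt_logNorm {y : Sp} (hy : y ≠ 0) : ContDiffAt ℝ 1 logNorm y := by
  have h : ContDiffAt ℝ 1 (fun y : Sp => ‖y‖ ^ 2) y := (contDiff_norm_sq ℝ).contDiffAt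
  exact (h.log (by simpa using hy)).div_const 2

lemma logPull_fderiv_apply {g : Sp → ℝ} (hg : ContDiff ℝ 1 g) {y : Sp} (hy : y ≠ 0) (v : Sp) :
    fderiv ℝ (logPull g) y v =
      Real.exp (-(logNorm y / 2)) * (inner ℝ y v * (‖y‖ ^ 2)⁻¹) * (1 - logNorm y / 2) *
        g ((logNorm y * Real.exp (-logNorm y)) • y) +
      Real.exp (-(logNorm y / 2)) * logNorm y * Real.exp (-logNorm y) *
        fderiv ℝ g ((logNorm y * Real.exp (-logNorm y)) • y)
          ((inner ℝ y v * (‖y‖ ^ 2)⁻¹ * (1 - logNorm y)) • y + logNorm y • v) := by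
  have hL := hasFDerivAt_logNorm hy
  have h1 : HasFDerivAt (fun y => -(logNorm y / 2)) (-((2:ℝ)⁻¹ • ((‖y‖ ^ 2)⁻¹ • innerSL ℝ y))) y := by
    have := (hL.const_mul (2:ℝ)⁻¹).neg
    refine this.congr_of_eventuallyEq (.of_forall fun z => ?_)
    simp [div_eq_mul_inv, mul_comm]
  have h2 := h1.exp.mul hL
  have h3 : HasFDerivAt (fun z => (logNorm z * Real.exp (-logNorm z)) • z) _ y :=
    (hL.mul hL.neg.exp).smul (hasFDerivAt_id y)
  have hgd : HasFDerivAt g _ ((logNorm y * Real.exp (-logNorm y)) • y) :=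
    (hg.differentiable (by norm_num) _).hasFDerivAt
  have h4 := HasFDerivAt.comp (g := g)
    (f := fun z => (logNorm z * Real.exp (-logNorm z)) • z) y hgd h3
  have h5 := h2.mul h4
  have h6 : HasFDerivAt (logPull g) _ y := h5
  rw [h6.fderiv]
  simp
  ring

lemma inner_eq_sum3 (x y : Sp) : inner ℝ x y = x 0 * y 0 + x 1 * y 1 + x 2 * y 2 := by
  simp [PiLp.inner_apply, Fin.sum_univ_three]
  ring

lemma norm_sq_eq_sum3 (x : Sp) : ‖x‖ ^ 2 = x 0 ^ 2 + x 1 ^ 2 + x 2 ^ 2 := by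
  rw [← real_inner_self_eq_norm_sq, inner_eq_sum3]; ring

lemma rot_identity (A : Sp →L[ℝ] ℝ) (x v : Sp) :
    ‖x‖ ^ 2 * A v - inner ℝ x v * A x = ∑ i, ∑ j, x i * v j * A (rotVec i j x) := by
  have e : ∀ z : Sp, A z = ∑ i, z i * A (EuclideanSpace.single i 1) := fun z => by
    conv_lhs => rw [← (EuclideanSpace.basisFun (Fin 3) ℝ).sum_repr z]
    simp
  rw [e v, e x]
  simp only [rotVec, map_sub, map_smul, smul_eq_mul, Fin.sum_univ_three, inner_eq_sum3,
    norm_sq_eq_sum3]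
  ring

lemma logNorm_smul_norm {y : Sp} (hy : 1 < ‖y‖) :
    ‖(logNorm y * Real.exp (-logNorm y)) • y‖ = logNorm y := by
  have h0 : 0 < ‖y‖ := zero_lt_one.trans hy
  have hL : 0 < logNorm y := by rw [logNorm_eq]; exact Real.log_pos hy
  rw [norm_smul, Real.norm_of_nonneg (by positivity), logNorm_eq, Real.exp_neg, Real.exp_log h0]
  field_simp

lemma norm_fderiv_logPull_le {g : Sp → ℝ} (hg : ContDiff ℝ 1 g)
    {y : Sp} (hy : 1 < ‖y‖) (hL : 1 / 2 ≤ logNorm y) :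
    ‖fderiv ℝ (logPull g) y‖ ^ 2 ≤ 169 * (‖y‖⁻¹ ^ 3 * logNorm y ^ 2 *
      rotSq g ((logNorm y * Real.exp (-logNorm y)) • y)) := by
  have hr : 0 < ‖y‖ := zero_lt_one.trans hy
  have hy0 : y ≠ 0 := norm_pos_iff.1 hr
  set L := logNorm y with hLdef
  have hE : Real.exp (-L) = ‖y‖⁻¹ := by rw [hLdef, logNorm_eq, Real.exp_neg, Real.exp_log hr]
  set E := Real.exp (-(L / 2)) with hEdef
  have hE2 : E ^ 2 = ‖y‖⁻¹ := by
    rw [← hE, hEdef, ← Real.exp_nat_mul]; congr 1; push_cast; ring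
  have hE0 : 0 < E := Real.exp_pos _
  set x := (L * Real.exp (-L)) • y with hx
  set A := fderiv ℝ g x
  set P := ∑ i, ∑ j, (A (rotVec i j x)) ^ 2
  have hP : 0 ≤ P := by positivity
  have hQ : rotSq g x = g x ^ 2 + ‖A‖ ^ 2 + P := rfl
  have hQ0 := rotSq_nonneg g x
  have hxn : ‖x‖ = L := logNorm_smul_norm hy
  set M := E * ‖y‖⁻¹ * L * (13 * Real.sqrt (rotSq g x)) with hM
  have hM0 : 0 ≤ M := by positivity
  have hbound : ‖fderiv ℝ (logPull g) y‖ ≤ M := by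
    refine ContinuousLinearMap.opNorm_le_bound _ hM0 fun v => ?_
    rw [logPull_fderiv_apply hg hy0, ← hLdef, ← hx]
    set q := Real.sqrt (rotSq g x)
    have hq0 : 0 ≤ q := Real.sqrt_nonneg _
    have hqg : |g x| ≤ q := Real.abs_le_sqrt (by rw [hQ]; nlinarith [sq_nonneg ‖A‖])
    have hqA : ‖A‖ ≤ q := Real.le_sqrt_of_sq_le (by rw [hQ]; nlinarith [sq_nonneg (g x)])
    have hqR : ∀ i j, |A (rotVec i j x)| ≤ q := fun i j => by
      refine Real.abs_le_sqrt ?_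
      have h1 : (A (rotVec i j x)) ^ 2 ≤ ∑ j, (A (rotVec i j x)) ^ 2 :=
        Finset.single_le_sum (f := fun j => (A (rotVec i j x)) ^ 2)
          (fun _ _ => sq_nonneg _) (Finset.mem_univ j)
      have h2 : ∑ j, (A (rotVec i j x)) ^ 2 ≤ P :=
        Finset.single_le_sum (f := fun i => ∑ j, (A (rotVec i j x)) ^ 2)
          (fun _ _ => by positivity) (Finset.mem_univ i)
      rw [hQ]
      nlinarith [sq_nonneg (g x), sq_nonneg ‖A‖]
    set s := inner ℝ y v * (‖y‖ ^ 2)⁻¹ with hs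
    have hsv : |s| * ‖y‖ ≤ ‖v‖ := by
      rw [hs, abs_mul, abs_inv, abs_of_nonneg (sq_nonneg ‖y‖)]
      calc |inner ℝ y v| * (‖y‖ ^ 2)⁻¹ * ‖y‖ ≤ (‖y‖ * ‖v‖) * (‖y‖ ^ 2)⁻¹ * ‖y‖ := by
            gcongr; exact abs_real_inner_le_norm y v
        _ = ‖v‖ := by field_simp
    have hL0 : 0 < L := by linarith
    have hAy : |s * A y| ≤ ‖v‖ * q := by
      rw [abs_mul]
      calc |s| * |A y| ≤ |s| * (q * ‖y‖) := by
            gcongr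
            exact (A.le_opNorm y).trans (by gcongr)
        _ = (|s| * ‖y‖) * q := by ring
        _ ≤ _ := by gcongr
    have hrot : |L * (A v - s * A y)| ≤ 9 * (‖v‖ * q) := by
      have hid := rot_identity A x v
      have e1 : ‖x‖ ^ 2 * A v - inner ℝ x v * A x = L * (L * (A v - s * A y)) := by
        rw [hxn, hx, real_inner_smul_left, map_smul, smul_eq_mul, hE, hs]
        field_simp
      rw [e1] at hid
      have hb : |L * (L * (A v - s * A y))| ≤ ∑ i : Fin 3, ∑ j : Fin 3, L * (‖v‖ * q) := by
        rw [hid]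
        refine (Finset.abs_sum_le_sum_abs _ _).trans (Finset.sum_le_sum fun i _ => ?_)
        refine (Finset.abs_sum_le_sum_abs _ _).trans (Finset.sum_le_sum fun j _ => ?_)
        rw [abs_mul, abs_mul, mul_assoc]
        have hxi : |x i| ≤ L := hxn ▸ (by simpa using PiLp.norm_apply_le x i)
        have hvj : |v j| ≤ ‖v‖ := by simpa using PiLp.norm_apply_le v j
        have := hqR i j
        gcongr
      rw [abs_mul, abs_of_pos hL0] at hb
      simp only [Finset.sum_const, Finset.card_univ, Fintype.card_fin, nsmul_eq_mul] at hb
      push_cast at hb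
      have : L * |L * (A v - s * A y)| ≤ L * (9 * (‖v‖ * q)) := by linarith
      exact le_of_mul_le_mul_left this hL0
    have hg1 : |s * (1 - L / 2) * g x| ≤ ‖y‖⁻¹ * (5 / 2 * L) * (‖v‖ * q) := by
      have h1 : |1 - L / 2| ≤ 5 / 2 * L := by rw [abs_le]; constructor <;> linarith
      have h2 : |s| ≤ ‖y‖⁻¹ * ‖v‖ := by rw [inv_mul_eq_div, le_div_iff₀ hr]; exact hsv
      rw [abs_mul, abs_mul]
      calc |s| * |1 - L / 2| * |g x| ≤ (‖y‖⁻¹ * ‖v‖) * (5 / 2 * L) * q := by gcongr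
        _ = _ := by ring
    have hexp : E * s * (1 - L / 2) * g x + E * L * Real.exp (-L) * A ((s * (1 - L)) • y + L • v)
        = E * (s * (1 - L / 2) * g x) + E * L * ‖y‖⁻¹ * (s * A y + L * (A v - s * A y)) := by
      rw [hE]; simp only [map_add, map_smul, smul_eq_mul]; ring
    rw [hexp, Real.norm_eq_abs]
    refine (abs_add_le _ _).trans ?_
    rw [abs_mul E, abs_mul (E * L * ‖y‖⁻¹), abs_of_pos hE0,
      abs_of_pos (by positivity : 0 < E * L * ‖y‖⁻¹)]
    calc E * |s * (1 - L / 2) * g x| + E * L * ‖y‖⁻¹ * |s * A y + L * (A v - s * A y)|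
        ≤ E * (‖y‖⁻¹ * (5 / 2 * L) * (‖v‖ * q)) +
          E * L * ‖y‖⁻¹ * (‖v‖ * q + 9 * (‖v‖ * q)) := by
          gcongr
          exact (abs_add_le _ _).trans (add_le_add hAy hrot)
      _ = E * ‖y‖⁻¹ * L * (12.5 * q) * ‖v‖ := by ring
      _ ≤ M * ‖v‖ := by rw [hM]; gcongr; norm_num
  calc _ ≤ M ^ 2 := pow_le_pow_left₀ (norm_nonneg _) hbound 2
    _ = _ := by
      rw [hM, mul_pow, mul_pow, mul_pow, mul_pow, Real.sq_sqrt hQ0, hE2]; ring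

lemma exists_integral_norm_pow_four_le :
    ∃ C : ℝ, 0 ≤ C ∧ ∀ g : Sp → ℝ, ContDiff ℝ 1 g → HasCompactSupport g →
      (∀ x, ‖x‖ ≤ 1 / 2 → g x = 0) →
      ∫ x, ‖x‖ ^ 4 * g x ^ 6 ≤ C * (∫ x, rotSq g x) ^ 3 := by
  obtain ⟨K, hK, hGNS⟩ := exists_integral_pow_six_le
  refine ⟨K * 169 ^ 3, by positivity, fun g hg hs h0 => ?_⟩
  set H : Sp → ℝ := fun y => if 1 < ‖y‖ then logPull g y else 0 with hH
  have hsmall : ∀ y : Sp, ‖y‖ < Real.exp (1 / 2) → H y = 0 := fun y hy => by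
    simp only [hH]
    split_ifs with h1
    · rw [logPull, h0 _ ?_, mul_zero]
      rw [logNorm_smul_norm h1, logNorm_eq]
      exact ((Real.log_lt_iff_lt_exp (by linarith)).2 hy).le
    · rfl
  have hev : ∀ y : Sp, ‖y‖ < Real.exp (1 / 2) → H =ᶠ[nhds y] fun _ => 0 := fun y hy => by
    filter_upwards [(isOpen_lt continuous_norm continuous_const).mem_nhds hy] with z hz
    exact hsmall z hz
  have hev1 : ∀ y : Sp, 1 < ‖y‖ → H =ᶠ[nhds y] logPull g := fun y hy => by
    filter_upwards [(isOpen_lt continuous_const continuous_norm).mem_nhds hy] with z hz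
    simp only [hH]
    rw [if_pos hz]
  have hHd : ContDiff ℝ 1 H := contDiff_iff_contDiffAt.2 fun y => by
    by_cases hy : 1 < ‖y‖
    · have hy0 : y ≠ 0 := norm_pos_iff.1 (by linarith)
      have hL := contDiffAt_logNorm hy0
      refine ContDiffAt.congr_of_eventuallyEq ?_ (hev1 y hy)
      exact ((hL.div_const 2).neg.exp.mul hL).mul
        (hg.contDiffAt.comp y ((hL.mul hL.neg.exp).smul contDiffAt_id))
    · refine contDiffAt_const.congr_of_eventuallyEq (hev y ?_)
      exact (not_lt.1 hy).trans_lt (Real.one_lt_exp_iff.2 (by norm_num))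
  obtain ⟨R, hR⟩ := hs.isCompact.isBounded.subset_closedBall (0 : Sp)
  have hHs : HasCompactSupport H := by
    refine HasCompactSupport.intro (isCompact_closedBall (0 : Sp) (Real.exp R)) fun y hy => ?_
    simp only [hH]
    split_ifs with h1
    · have hz : g ((logNorm y * Real.exp (-logNorm y)) • y) = 0 := by
        refine image_eq_zero_of_notMem_tsupport fun hm => hy ?_
        have := hR hm
        rw [mem_closedBall_zero_iff, logNorm_smul_norm h1, logNorm_eq,
          Real.log_le_iff_le_exp (by linarith)] at this
        simpa using this
      rw [logPull, hz, mul_zero]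
    · rfl
  have hc1 : CC fun x => ‖x‖ ^ 4 * g x ^ 6 :=
    (CC.pow ⟨hg.continuous, hs⟩ (by norm_num)).mul_left (by fun_prop)
  have hc2 := CC_rotSq hg hs
  have i1 := integral_log_radial hc1 (fun x => by positivity)
  have i2 := integral_log_radial hc2 (rotSq_nonneg g)
  have harg : ∀ y : Sp, 1 < ‖y‖ → (Real.log ‖y‖ * ‖y‖⁻¹) • y =
      (logNorm y * Real.exp (-logNorm y)) • y := fun y hy => by
    rw [logNorm_eq, Real.exp_neg, Real.exp_log (by linarith)]
  have e6 : ∫ x, ‖x‖ ^ 4 * g x ^ 6 = ∫ y, H y ^ 6 := by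
    rw [← i1.2]
    refine integral_congr_ae (.of_forall fun y => ?_)
    simp only [hH]
    split_ifs with h1
    · rw [harg y h1, logNorm_smul_norm h1, logPull, mul_pow, mul_pow]
      have : Real.exp (-(logNorm y / 2)) ^ 6 = ‖y‖⁻¹ ^ 3 := by
        have : Real.exp (-logNorm y) = ‖y‖⁻¹ := by
          rw [logNorm_eq, Real.exp_neg, Real.exp_log (by linarith)]
        rw [← this, ← Real.exp_nat_mul, ← Real.exp_nat_mul]
        congr 1; push_cast; ring
      rw [this, ← logNorm_eq]
      ring
    · simp
  have e2 : ∫ y, ‖fderiv ℝ H y‖ ^ 2 ≤ 169 * ∫ x, rotSq g x := by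
    rw [← i2.2, ← integral_const_mul]
    refine integral_mono_of_nonneg (.of_forall fun y => by positivity) (i2.1.const_mul _)
      (.of_forall fun y => ?_)
    by_cases hy : ‖y‖ < Real.exp (1 / 2)
    · simp only
      rw [(hev y hy).fderiv_eq]
      simp only [fderiv_fun_const, Pi.zero_apply, norm_zero, ne_eq, OfNat.ofNat_ne_zero,
        not_false_eq_true, zero_pow]
      have := rotSq_nonneg g ((Real.log ‖y‖ * ‖y‖⁻¹) • y)
      split_ifs <;> positivity
    · have h1 : 1 < ‖y‖ := (Real.one_lt_exp_iff.2 (by norm_num)).trans_le (not_lt.1 hy)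
      simp only
      rw [(hev1 y h1).fderiv_eq, if_pos h1, harg y h1, ← logNorm_eq]
      refine norm_fderiv_logPull_le hg h1 ?_
      rw [logNorm_eq, Real.le_log_iff_exp_le (by linarith)]
      exact not_lt.1 hy
  rw [e6]
  refine (hGNS H hHd hHs).trans ?_
  rw [mul_assoc, ← mul_pow]
  gcongr

/-- A conformally weighted Sobolev inequality: `⟨x⟩^{2/3} f ∈ L⁶` whenever `f`, its gradient and its
rotational derivatives lie in `L²`. -/
lemma exists_integral_weight_pow_six_le :
    ∃ C : ℝ, 0 ≤ C ∧ ∀ f : Sp → ℝ, ContDiff ℝ 1 f → HasCompactSupport f →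
      ∫ x, (1 + ‖x‖ ^ 2) ^ 2 * f x ^ 6 ≤ C * (∫ x, rotSq f x) ^ 3 := by
  obtain ⟨K, hK, hGNS⟩ := exists_integral_pow_six_le
  obtain ⟨K', hK', hlog⟩ := exists_integral_norm_pow_four_le
  let b : ContDiffBump (0 : Sp) := ⟨1 / 2, 1, by norm_num, by norm_num⟩
  have hb : ContDiff ℝ 1 b := b.contDiff
  have hbs : HasCompactSupport b := b.hasCompactSupport
  obtain ⟨B, hB⟩ := (CC_rotSq hb hbs).2.exists_bound_of_continuous (CC_rotSq hb hbs).1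
  have hB0 : 0 ≤ B := (norm_nonneg _).trans (hB 0)
  refine ⟨4 * K + 2 * (K' * (2 + 2 * B) ^ 3), by positivity, fun f hf hs => ?_⟩
  set g : Sp → ℝ := fun x => (1 - b x) * f x with hg
  have hgd : ContDiff ℝ 1 g := (contDiff_const.sub hb).mul hf
  have hgs : HasCompactSupport g := hs.mul_left
  have hCf : CC f := ⟨hf.continuous, hs⟩
  have hCg : CC g := ⟨hgd.continuous, hgs⟩
  have hg0 : ∀ x, ‖x‖ ≤ 1 / 2 → g x = 0 := fun x hx => by
    have : b x = 1 := b.one_of_mem_closedBall (mem_closedBall_zero_iff.2 hx)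
    simp [hg, this]
  have hrot : ∀ x, rotSq g x ≤ (2 + 2 * B) * rotSq f x := fun x => by
    have hD : fderiv ℝ g x = (1 - b x) • fderiv ℝ f x - f x • fderiv ℝ b x := by
      have h1 : HasFDerivAt b _ x := (hb.differentiable (by norm_num) x).hasFDerivAt
      have h2 : HasFDerivAt f _ x := (hf.differentiable (by norm_num) x).hasFDerivAt
      have h3 : HasFDerivAt g _ x := (h1.const_sub 1).mul h2
      rw [h3.fderiv]
      ext v
      simp
      ring
    have hb1 : 0 ≤ 1 - b x := by linarith [b.le_one (x := x)]
    have hb2 : 1 - b x ≤ 1 := by linarith [b.nonneg (x := x)]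
    have hbq : (1 - b x) ^ 2 ≤ 1 := by nlinarith
    have hsq : ∀ p q : ℝ, ((1 - b x) * p - f x * q) ^ 2 ≤ 2 * p ^ 2 + 2 * (f x ^ 2 * q ^ 2) :=
      fun p q => by
        have h1 : (1 - b x) ^ 2 * p ^ 2 ≤ 1 * p ^ 2 := by gcongr
        nlinarith [sq_nonneg ((1 - b x) * p + f x * q)]
    have hn : ‖fderiv ℝ g x‖ ^ 2 ≤ 2 * ‖fderiv ℝ f x‖ ^ 2 + 2 * (f x ^ 2 * ‖fderiv ℝ b x‖ ^ 2) := by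
      have h1 : ‖fderiv ℝ g x‖ ≤ (1 - b x) * ‖fderiv ℝ f x‖ + |f x| * ‖fderiv ℝ b x‖ := by
        rw [hD]
        refine (norm_sub_le _ _).trans_eq ?_
        rw [norm_smul, norm_smul, Real.norm_of_nonneg hb1, Real.norm_eq_abs]
      have h2 := pow_le_pow_left₀ (norm_nonneg _) h1 2
      have h3 : (1 - b x) ^ 2 * ‖fderiv ℝ f x‖ ^ 2 ≤ 1 * ‖fderiv ℝ f x‖ ^ 2 := by gcongr
      have h4 := sq_abs (f x)
      nlinarith [sq_nonneg ((1 - b x) * ‖fderiv ℝ f x‖ - |f x| * ‖fderiv ℝ b x‖)]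
    have hS : ∑ i, ∑ j, (fderiv ℝ g x (rotVec i j x)) ^ 2 ≤
        2 * ∑ i, ∑ j, (fderiv ℝ f x (rotVec i j x)) ^ 2 +
          2 * (f x ^ 2 * ∑ i, ∑ j, (fderiv ℝ b x (rotVec i j x)) ^ 2) := by
      simp only [Finset.mul_sum, ← Finset.sum_add_distrib]
      refine Finset.sum_le_sum fun i _ => Finset.sum_le_sum fun j _ => ?_
      rw [hD]
      simpa using hsq (fderiv ℝ f x (rotVec i j x)) (fderiv ℝ b x (rotVec i j x))
    have hv : g x ^ 2 ≤ f x ^ 2 := by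
      simp only [hg, mul_pow]
      nlinarith [sq_nonneg (f x)]
    have hBx : rotSq b x ≤ B := (le_abs_self _).trans (hB x)
    have hBf : f x ^ 2 * rotSq b x ≤ f x ^ 2 * B := by gcongr
    have hfQ : f x ^ 2 ≤ rotSq f x := by
      unfold rotSq
      have : 0 ≤ ∑ i, ∑ j, (fderiv ℝ f x (rotVec i j x)) ^ 2 := by positivity
      nlinarith [sq_nonneg ‖fderiv ℝ f x‖]
    have hfQB : f x ^ 2 * B ≤ rotSq f x * B := by gcongr
    have e1 : rotSq g x ≤ 2 * rotSq f x + 2 * (f x ^ 2 * rotSq b x) := by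
      unfold rotSq
      nlinarith [sq_nonneg (f x), mul_nonneg (sq_nonneg (f x)) (sq_nonneg (b x))]
    nlinarith
  have hI : ∫ x, rotSq g x ≤ (2 + 2 * B) * ∫ x, rotSq f x := by
    rw [← integral_const_mul]
    exact integral_mono (CC_rotSq hgd hgs).integrable
      ((CC_rotSq hf hs).integrable.const_mul _) hrot
  have hpt : ∀ x, (1 + ‖x‖ ^ 2) ^ 2 * f x ^ 6 ≤ 4 * f x ^ 6 + 2 * (‖x‖ ^ 4 * g x ^ 6) := fun x => by
    have h6 : 0 ≤ f x ^ 6 := by positivity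
    by_cases hx : ‖x‖ ≤ 1
    · have h1 : (1 + ‖x‖ ^ 2) ^ 2 ≤ 2 ^ 2 := by
        gcongr; nlinarith [norm_nonneg x]
      have : 0 ≤ ‖x‖ ^ 4 * g x ^ 6 := by positivity
      nlinarith
    · have : b x = 0 := b.zero_of_le_dist (by simpa using (not_le.1 hx).le)
      have hgx : g x = f x := by simp [hg, this]
      rw [hgx]
      nlinarith [mul_nonneg (sq_nonneg (1 - ‖x‖ ^ 2)) h6]
  have hfQ : ∫ x, ‖fderiv ℝ f x‖ ^ 2 ≤ ∫ x, rotSq f x := by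
    refine integral_mono_of_nonneg (.of_forall fun y => by positivity)
      (CC_rotSq hf hs).integrable (.of_forall fun x => ?_)
    have : 0 ≤ ∑ i, ∑ j, (fderiv ℝ f x (rotVec i j x)) ^ 2 := by positivity
    simp only [rotSq]
    nlinarith [sq_nonneg (f x)]
  have hQ0 : 0 ≤ ∫ x, rotSq f x := integral_nonneg (rotSq_nonneg f)
  have c1 : CC fun x => f x ^ 6 := hCf.pow (by norm_num)
  have c2 : CC fun x => ‖x‖ ^ 4 * g x ^ 6 := (hCg.pow (by norm_num)).mul_left (by fun_prop)
  have c3 : CC fun x => (1 + ‖x‖ ^ 2) ^ 2 * f x ^ 6 := c1.mul_left (by fun_prop)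
  calc ∫ x, (1 + ‖x‖ ^ 2) ^ 2 * f x ^ 6
      ≤ ∫ x, (4 * f x ^ 6 + 2 * (‖x‖ ^ 4 * g x ^ 6)) :=
        integral_mono c3.integrable ((c1.integrable.const_mul 4).add (c2.integrable.const_mul 2)) hpt
    _ = 4 * (∫ x, f x ^ 6) + 2 * ∫ x, ‖x‖ ^ 4 * g x ^ 6 := by
        rw [integral_add (c1.integrable.const_mul 4) (c2.integrable.const_mul 2),
          integral_const_mul, integral_const_mul]
    _ ≤ 4 * (K * (∫ x, rotSq f x) ^ 3) + 2 * (K' * ((2 + 2 * B) * ∫ x, rotSq f x) ^ 3) := by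
        have h1 := hGNS f hf hs
        have h2 := hlog g hgd hgs hg0
        have h3 : 0 ≤ ∫ x, ‖fderiv ℝ f x‖ ^ 2 := integral_nonneg fun _ => by positivity
        have h4 : 0 ≤ ∫ x, rotSq g x := integral_nonneg (rotSq_nonneg g)
        have h5 : (∫ x, ‖fderiv ℝ f x‖ ^ 2) ^ 3 ≤ (∫ x, rotSq f x) ^ 3 := by gcongr
        have h6 : (∫ x, rotSq g x) ^ 3 ≤ ((2 + 2 * B) * ∫ x, rotSq f x) ^ 3 := by gcongr
        have h7 := mul_le_mul_of_nonneg_left h5 hK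
        have h8 := mul_le_mul_of_nonneg_left h6 hK'
        linarith
    _ = _ := by ring

lemma lintegral_ray_pow_six_le :
    ∃ K : ENNReal, K ≠ ⊤ ∧ ∀ h : ℝ → ENNReal, Measurable h →
      (∫⁻ r in Ioc (0 : ℝ) 1, h r) ^ 6 ≤
        K * ∫⁻ r in Ioi (0 : ℝ), ENNReal.ofReal (r ^ 2) * h r ^ 6 := by
  set K0 : ENNReal := ∫⁻ r in Ioc (0 : ℝ) 1, ENNReal.ofReal (r ^ (-(2 : ℝ) / 5)) with hK0
  have hK0f : K0 ≠ ⊤ := by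
    have h1 : IntegrableOn (fun r : ℝ => r ^ (-(2 : ℝ) / 5)) (Ioc 0 1) volume := by
      rw [← intervalIntegrable_iff_integrableOn_Ioc_of_le zero_le_one]
      exact intervalIntegral.intervalIntegrable_rpow' (by norm_num)
    exact h1.lintegral_lt_top.ne
  refine ⟨K0 ^ (5 : ℕ), ENNReal.pow_ne_top hK0f, fun h hh => ?_⟩
  have hH := ENNReal.lintegral_mul_le_Lp_mul_Lq (volume.restrict (Ioc (0 : ℝ) 1))
    (p := 6) (q := 6 / 5) (by constructor <;> norm_num)
    (f := fun r => ENNReal.ofReal (r ^ ((1 : ℝ) / 3)) * h r)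
    (g := fun r => ENNReal.ofReal (r ^ (-(1 : ℝ) / 3)))
    (by fun_prop) (by fun_prop)
  have e1 : ∫⁻ r in Ioc (0 : ℝ) 1, ((fun r => ENNReal.ofReal (r ^ ((1 : ℝ) / 3)) * h r) *
      (fun r => ENNReal.ofReal (r ^ (-(1 : ℝ) / 3)))) r = ∫⁻ r in Ioc (0 : ℝ) 1, h r := by
    refine setLIntegral_congr_fun measurableSet_Ioc fun r hr => ?_
    simp only [Pi.mul_apply]
    rw [mul_right_comm, ← ENNReal.ofReal_mul (by have := hr.1; positivity),
      ← Real.rpow_add hr.1]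
    norm_num
  have e2 : ∫⁻ r in Ioc (0 : ℝ) 1, (ENNReal.ofReal (r ^ (-(1 : ℝ) / 3))) ^ ((6 : ℝ) / 5) = K0 := by
    refine setLIntegral_congr_fun measurableSet_Ioc fun r hr => ?_
    have := hr.1
    rw [ENNReal.ofReal_rpow_of_nonneg (by positivity) (by norm_num), ← Real.rpow_mul hr.1.le]
    norm_num
  have e3 : ∫⁻ r in Ioc (0 : ℝ) 1, (ENNReal.ofReal (r ^ ((1 : ℝ) / 3)) * h r) ^ (6 : ℝ) =
      ∫⁻ r in Ioc (0 : ℝ) 1, ENNReal.ofReal (r ^ 2) * h r ^ 6 := by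
    refine setLIntegral_congr_fun measurableSet_Ioc fun r hr => ?_
    have := hr.1
    rw [show (6 : ℝ) = ((6 : ℕ) : ℝ) by norm_num, ENNReal.rpow_natCast, mul_pow,
      ← ENNReal.ofReal_pow (by positivity), ← Real.rpow_natCast (_ ^ _) 6, ← Real.rpow_mul hr.1.le]
    norm_num
  rw [e1, e2, e3] at hH
  have hH6 := pow_le_pow_left₀ zero_le hH 6
  rw [mul_pow, ← ENNReal.rpow_natCast (_ ^ (1 / 6 : ℝ)), ← ENNReal.rpow_mul, ← ENNReal.rpow_natCast (K0 ^ _),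
    ← ENNReal.rpow_mul, show (1 / (6 / 5) * ((6 : ℕ) : ℝ)) = ((5 : ℕ) : ℝ) by norm_num,
    ENNReal.rpow_natCast] at hH6
  norm_num at hH6
  refine hH6.trans ?_
  rw [mul_comm]
  gcongr
  exact Ioc_subset_Ioi_self

/-- A local form of Morrey's inequality `W^{1,6}(ℝ³) ⊂ L^∞`. -/
lemma exists_pow_six_le_integral :
    ∃ C : ℝ, 0 ≤ C ∧ ∀ f : Sp → ℝ, ContDiff ℝ 1 f → HasCompactSupport f → ∀ x,
      f x ^ 6 ≤ C * ∫ y, (f y ^ 6 + ‖fderiv ℝ f y‖ ^ 6) := by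
  obtain ⟨K, hK, hray⟩ := lintegral_ray_pow_six_le
  let b : ContDiffBump (0 : Sp) := ⟨1 / 2, 1, by norm_num, by norm_num⟩
  have hb : ContDiff ℝ 1 b := b.contDiff
  have hbs : HasCompactSupport b := b.hasCompactSupport
  obtain ⟨B, hB⟩ := (hbs.fderiv ℝ).exists_bound_of_continuous (hb.continuous_fderiv (by norm_num))
  have hB0 : 0 ≤ B := (norm_nonneg _).trans (hB 0)
  set V := (sphMeas univ).toReal with hV
  have hVf : sphMeas univ ≠ ⊤ := by unfold sphMeas; exact measure_ne_top _ _
  have hV0 : 0 < V := by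
    refine ENNReal.toReal_pos ?_ hVf
    rw [sphMeas, Measure.toSphere_apply_univ]
    simp only [ne_eq, mul_eq_zero, not_or]
    exact ⟨by simp, (Metric.measure_ball_pos _ _ one_pos).ne'⟩
  refine ⟨V⁻¹ * (K.toReal * (32 * (1 + B) ^ 6)), by positivity, fun f hf hs x => ?_⟩
  set g : Sp → ℝ := fun y => b y * f (x + y) with hg
  have hfx : ContDiff ℝ 1 fun y => f (x + y) := hf.comp (by fun_prop)
  have hgd : ContDiff ℝ 1 g := hb.mul hfx
  have hgs : HasCompactSupport g := hbs.mul_right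
  have hDc : Continuous (fderiv ℝ g) := hgd.continuous_fderiv (by norm_num)
  have hg0 : g 0 = f x := by
    have : b 0 = 1 := b.one_of_mem_closedBall (by simp [b.rIn_pos.le])
    simp [hg, this]
  have hrayω : ∀ ω : S2, ENNReal.ofReal (f x ^ 6) ≤
      K * ∫⁻ r in Ioi (0 : ℝ), ENNReal.ofReal (r ^ 2) *
        ENNReal.ofReal (‖fderiv ℝ g (r • (ω : Sp))‖ ^ 6) := fun ω => by
    have hω : ‖(ω : Sp)‖ = 1 := by simp
    have hgω : g ((1 : ℝ) • (ω : Sp)) = 0 := by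
      have : b (ω : Sp) = 0 := b.zero_of_le_dist (by simp [b])
      simp [hg, this]
    have hFTC : ∫ r in (0 : ℝ)..1, fderiv ℝ g (r • (ω : Sp)) (ω : Sp) = - f x := by
      have h1 : ∀ r ∈ uIcc (0 : ℝ) 1, HasDerivAt (fun r : ℝ => g (r • (ω : Sp)))
          (fderiv ℝ g (r • (ω : Sp)) (ω : Sp)) r := fun r _ => by
        have h2 : HasFDerivAt g _ (r • (ω : Sp)) :=
          (hgd.differentiable (by norm_num) _).hasFDerivAt
        have h3 : HasDerivAt (fun r : ℝ => r • (ω : Sp)) (ω : Sp) r := by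
          simpa using (hasDerivAt_id r).smul_const (ω : Sp)
        exact h2.comp_hasDerivAt r h3
      rw [intervalIntegral.integral_eq_sub_of_hasDerivAt h1]
      · rw [hgω, zero_smul, hg0, zero_sub]
      · refine Continuous.intervalIntegrable ?_ _ _
        exact (hDc.comp (by fun_prop)).clm_apply continuous_const
    have h4 : ENNReal.ofReal |f x| ≤
        ∫⁻ r in Ioc (0 : ℝ) 1, ENNReal.ofReal ‖fderiv ℝ g (r • (ω : Sp))‖ := by
      rw [← abs_neg, ← hFTC, intervalIntegral.integral_of_le zero_le_one, ← Real.norm_eq_abs,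
        ofReal_norm]
      refine (enorm_integral_le_lintegral_enorm _).trans (lintegral_mono fun r => ?_)
      rw [← ofReal_norm]
      refine ENNReal.ofReal_le_ofReal ?_
      simpa [hω] using (fderiv ℝ g (r • (ω : Sp))).le_opNorm (ω : Sp)
    have h5 := hray (fun r => ENNReal.ofReal ‖fderiv ℝ g (r • (ω : Sp))‖)
      (ENNReal.measurable_ofReal.comp ((hDc.comp (by fun_prop)).norm.measurable))
    have h6 := pow_le_pow_left₀ zero_le h4 6
    rw [← ENNReal.ofReal_pow (abs_nonneg _), Even.pow_abs (by decide)] at h6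
    refine (h6.trans h5).trans_eq ?_
    simp_rw [ENNReal.ofReal_pow (norm_nonneg _)]
  have hcg : CC fun y => ‖fderiv ℝ g y‖ ^ 6 :=
    CC.pow (f := fun y => ‖fderiv ℝ g y‖) ⟨hDc.norm, (hgs.fderiv ℝ).norm⟩ (by norm_num)
  have hI : V * f x ^ 6 ≤ K.toReal * ∫ y, ‖fderiv ℝ g y‖ ^ 6 := by
    have h1 := lintegral_mono hrayω (μ := sphMeas)
    rw [lintegral_const, lintegral_const_mul' _ _ hK,
      ← lintegral_polar (g := fun y => ENNReal.ofReal (‖fderiv ℝ g y‖ ^ 6))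
        (ENNReal.measurable_ofReal.comp hcg.1.measurable)] at h1
    have h2 := ENNReal.toReal_mono (ENNReal.mul_ne_top hK hcg.integrable.lintegral_lt_top.ne) h1
    rw [ENNReal.toReal_mul, ENNReal.toReal_mul, ENNReal.toReal_ofReal (by positivity),
      ← integral_eq_lintegral_of_nonneg_ae (.of_forall fun y => by positivity)
        hcg.1.aestronglyMeasurable] at h2
    linarith
  have hfD : Continuous (fderiv ℝ f) := hf.continuous_fderiv (by norm_num)
  have hcf : CC fun y => f y ^ 6 + ‖fderiv ℝ f y‖ ^ 6 :=
    (CC.pow ⟨hf.continuous, hs⟩ (by norm_num)).add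
      (CC.pow (f := fun y => ‖fderiv ℝ f y‖) ⟨hfD.norm, (hs.fderiv ℝ).norm⟩ (by norm_num))
  have hpt : ∀ y, ‖fderiv ℝ g y‖ ^ 6 ≤
      32 * (1 + B) ^ 6 * (f (x + y) ^ 6 + ‖fderiv ℝ f (x + y)‖ ^ 6) := fun y => by
    have h1 : ‖fderiv ℝ g y‖ ≤ (1 + B) * (|f (x + y)| + ‖fderiv ℝ f (x + y)‖) := by
      have hb1 : HasFDerivAt b _ y := (hb.differentiable (by norm_num) y).hasFDerivAt
      have hf1 : HasFDerivAt f _ (x + y) := (hf.differentiable (by norm_num) _).hasFDerivAt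
      have hf2 : HasFDerivAt (fun y => f (x + y)) (fderiv ℝ f (x + y)) y := by
        have := hf1.comp y ((hasFDerivAt_id (𝕜 := ℝ) y).const_add x)
        rwa [ContinuousLinearMap.comp_id] at this
      have h3 : HasFDerivAt g _ y := hb1.mul hf2
      rw [h3.fderiv]
      refine (norm_add_le _ _).trans ?_
      rw [norm_smul, norm_smul, Real.norm_of_nonneg b.nonneg, Real.norm_eq_abs]
      have := hB y
      have hb2 : b y ≤ 1 := b.le_one
      have h5 : b y * ‖fderiv ℝ f (x + y)‖ ≤ 1 * ‖fderiv ℝ f (x + y)‖ := by gcongr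
      have h6 : |f (x + y)| * ‖fderiv ℝ b y‖ ≤ |f (x + y)| * B := by gcongr
      nlinarith [abs_nonneg (f (x + y)), mul_nonneg hB0 (norm_nonneg (fderiv ℝ f (x + y)))]
    have h2 := pow_le_pow_left₀ (norm_nonneg _) h1 6
    rw [mul_pow] at h2
    have h4 : (|f (x + y)| + ‖fderiv ℝ f (x + y)‖) ^ 6 ≤
        2 ^ (6 - 1) * (|f (x + y)| ^ 6 + ‖fderiv ℝ f (x + y)‖ ^ 6) :=
      add_pow_le (abs_nonneg _) (norm_nonneg _) 6
    rw [Even.pow_abs (by decide)] at h4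
    have h5 : 0 ≤ (1 + B) ^ 6 := by positivity
    have := mul_le_mul_of_nonneg_left h4 h5
    norm_num at this
    linarith
  have hJ : ∫ y, ‖fderiv ℝ g y‖ ^ 6 ≤
      32 * (1 + B) ^ 6 * ∫ y, (f y ^ 6 + ‖fderiv ℝ f y‖ ^ 6) := by
    rw [← integral_add_left_eq_self (fun y => f y ^ 6 + ‖fderiv ℝ f y‖ ^ 6) x,
      ← integral_const_mul]
    exact integral_mono hcg.integrable ((hcf.integrable.comp_add_left x).const_mul _) hpt
  rw [mul_assoc, ← div_eq_inv_mul, le_div_iff₀ hV0, mul_comm]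
  refine hI.trans ?_
  rw [mul_assoc]
  gcongr

lemma integral_fderiv_apply_eq_zero {f : Sp → ℝ} (hf : ContDiff ℝ 1 f) (hs : HasCompactSupport f)
    (v : Sp) : ∫ x, fderiv ℝ f x v = 0 := by
  have hd : Continuous fun x => fderiv ℝ f x v :=
    (hf.continuous_fderiv (by norm_num)).clm_apply continuous_const
  have hds : HasCompactSupport fun x => fderiv ℝ f x v := by
    refine (hs.fderiv ℝ).mono fun x hx => ?_
    contrapose! hx
    simp only [Function.mem_support, not_not] at hx
    simp [hx]
  have h := integral_mul_fderiv_eq_neg_fderiv_mul_of_integrable 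
    (μ := (volume : Measure Sp))
    (f := fun _ => (1 : ℝ)) (g := f) (v := v) (by simp)
    (by simpa using hd.integrable_of_hasCompactSupport hds)
    (by simpa using hf.continuous.integrable_of_hasCompactSupport hs)
    (fun _ _ => differentiableAt_const _) (fun x _ => hf.differentiable (by norm_num) x)
  simpa using h

lemma CC.neg {f : Sp → ℝ} (hf : CC f) : CC fun x => -f x := ⟨hf.1.neg, hf.2.neg⟩

lemma CC.eq_zero {f : Sp → ℝ} (hf : CC f) (h : ∫ x, f x ^ 2 ≤ 0) : f = 0 := by
  have hc : CC fun x => f x ^ 2 := hf.pow two_ne_zero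
  have h0 : ∫ x, f x ^ 2 = 0 := le_antisymm h (integral_nonneg fun _ => sq_nonneg _)
  rw [integral_eq_zero_iff_of_nonneg (fun _ => sq_nonneg _) hc.integrable] at h0
  have := (Continuous.ae_eq_iff_eq volume hc.1 continuous_const).1 h0
  ext x
  exact pow_eq_zero_iff two_ne_zero |>.1 (congrFun this x)

lemma CC.const_mul {f : Sp → ℝ} (hf : CC f) (c : ℝ) : CC fun x => c * f x :=
  hf.mul_left continuous_const

lemma CC.integral_add {f g : Sp → ℝ} (hf : CC f) (hg : CC g) :
    ∫ x, (f x + g x) = (∫ x, f x) + ∫ x, g x :=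
  MeasureTheory.integral_add hf.integrable hg.integrable

/-- A simultaneous bound in `L²` and in `L⁶` with the gain `s²`. -/
def Bd (s A : ℝ) (f : Sp → ℝ) : Prop :=
  CC f ∧ ∫ x, f x ^ 2 ≤ A ^ 2 ∧ s ^ 12 * ∫ x, f x ^ 6 ≤ A ^ 6

/-- A bound in `L⁶`. -/
def Bd6 (A : ℝ) (f : Sp → ℝ) : Prop := CC f ∧ ∫ x, f x ^ 6 ≤ A ^ 6

lemma Bd.scale {s A : ℝ} {f : Sp → ℝ} (h : Bd s A f) (hA : 0 < A) :
    Bd s 1 fun x => A⁻¹ * f x := by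
  refine ⟨h.1.mul_left continuous_const, ?_, ?_⟩
  · simp only [mul_pow]
    rw [integral_const_mul, inv_pow, inv_mul_le_iff₀ (by positivity)]
    simpa using h.2.1
  · simp only [mul_pow]
    rw [integral_const_mul, mul_left_comm, inv_pow, inv_mul_le_iff₀ (by positivity)]
    simpa using h.2.2

lemma Bd6.scale {A : ℝ} {f : Sp → ℝ} (h : Bd6 A f) (hA : 0 < A) :
    Bd6 1 fun x => A⁻¹ * f x := by
  refine ⟨h.1.mul_left continuous_const, ?_⟩
  simp only [mul_pow]
  rw [integral_const_mul, inv_pow, inv_mul_le_iff₀ (by positivity)]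
  simpa using h.2

lemma Bd.zero {s : ℝ} {f : Sp → ℝ} (h : Bd s 0 f) : f = 0 := h.1.eq_zero (by simpa using h.2.1)

lemma Bd6.zero {f : Sp → ℝ} (h : Bd6 0 f) : f = 0 := by
  have h1 : (fun x => f x ^ 3) = 0 := by
    refine (h.1.pow (n := 3) (by norm_num)).eq_zero ?_
    simp only [← pow_mul]
    simpa using h.2
  ext x
  simpa using congrFun h1 x

lemma L2_zero : L2 0 = 0 := by simp [L2]

lemma L2_const_mul {c : ℝ} (hc : 0 ≤ c) (f : Sp → ℝ) : L2 (fun x => c * f x) = c * L2 f := by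
  simp only [L2, mul_pow]
  rw [integral_const_mul, Real.sqrt_mul (sq_nonneg c), Real.sqrt_sq hc]

lemma mul_L2_le_one {f : Sp → ℝ} {r : ℝ} (hr : 0 ≤ r) (h : ∫ x, r ^ 2 * f x ^ 2 ≤ 1) :
    r * L2 f ≤ 1 := by
  rw [← L2_const_mul hr, L2]
  simp only [mul_pow]
  exact Real.sqrt_le_one.2 h

lemma Bd.bilinear {s A B : ℝ} {f g : Sp → ℝ} (hs : 0 ≤ s) (hA : 0 ≤ A) (hB : 0 ≤ B)
    (hf : Bd s A f) (hg : Bd s B g) : s ^ 3 * L2 (fun x => f x * g x) ≤ A * B := by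
  rcases hA.eq_or_lt with rfl | hA
  · have : (fun x => f x * g x) = 0 := by ext x; simp [hf.zero]
    rw [this, L2_zero]; simp
  rcases hB.eq_or_lt with rfl | hB
  · have : (fun x => f x * g x) = 0 := by ext x; simp [hg.zero]
    rw [this, L2_zero]; simp
  obtain ⟨cf, f2, f6⟩ := hf.scale hA
  obtain ⟨cg, g2, g6⟩ := hg.scale hB
  set φ : Sp → ℝ := fun x => A⁻¹ * f x
  set ψ : Sp → ℝ := fun x => B⁻¹ * g x
  have e : (fun x => f x * g x) = fun x => (A * B) * (φ x * ψ x) := by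
    ext x; simp only [φ, ψ]; field_simp
  have i1 := cf.pow (n := 2) (by norm_num)
  have i2 := cf.pow (n := 6) (by norm_num)
  have i3 := cg.pow (n := 2) (by norm_num)
  have i4 := cg.pow (n := 6) (by norm_num)
  have key : s ^ 3 * L2 (fun x => φ x * ψ x) ≤ 1 := by
    refine mul_L2_le_one (by positivity) ?_
    have hc : CC fun x => (s ^ 3) ^ 2 * (φ x * ψ x) ^ 2 :=
      ((cf.mul_right cg.1).pow two_ne_zero).mul_left continuous_const
    calc ∫ x, (s ^ 3) ^ 2 * (φ x * ψ x) ^ 2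
        ≤ ∫ x, (1 / 4 : ℝ) * ((φ x ^ 2 + s ^ 12 * φ x ^ 6) + (ψ x ^ 2 + s ^ 12 * ψ x ^ 6)) := by
          refine integral_mono hc.integrable
            (((i1.add (i2.const_mul _)).add (i3.add (i4.const_mul _))).const_mul _).integrable fun x => ?_
          simp only
          have h1 : ∀ p : ℝ, s ^ 6 * p ^ 4 ≤ (p ^ 2 + s ^ 12 * p ^ 6) / 2 := fun p => by
            nlinarith [sq_nonneg (p * (1 - s ^ 6 * p ^ 2))]
          have h2 : s ^ 6 * (φ x ^ 2 * ψ x ^ 2) ≤ s ^ 6 * ((φ x ^ 4 + ψ x ^ 4) / 2) := by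
            gcongr; nlinarith [sq_nonneg (φ x ^ 2 - ψ x ^ 2)]
          have h3 := h1 (φ x)
          have h4 := h1 (ψ x)
          nlinarith
      _ = 1 / 4 * ((∫ x, φ x ^ 2) + s ^ 12 * (∫ x, φ x ^ 6) +
            ((∫ x, ψ x ^ 2) + s ^ 12 * ∫ x, ψ x ^ 6)) := by
          rw [integral_const_mul, CC.integral_add (i1.add (i2.const_mul _)) (i3.add (i4.const_mul _)),
            CC.integral_add i1 (i2.const_mul _), CC.integral_add i3 (i4.const_mul _),
            integral_const_mul, integral_const_mul]
      _ ≤ 1 := by linarith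
  rw [e, L2_const_mul (by positivity)]
  calc s ^ 3 * (A * B * L2 fun x => φ x * ψ x) = A * B * (s ^ 3 * L2 fun x => φ x * ψ x) := by ring
    _ ≤ A * B * 1 := by gcongr
    _ = A * B := by ring

lemma Bd.trilinear {s A B D : ℝ} {f g h : Sp → ℝ} (hs : 0 ≤ s) (hA : 0 ≤ A) (hB : 0 ≤ B)
    (hD : 0 ≤ D) (hf : Bd s A f) (hg : Bd s B g) (hh : Bd s D h) :
    s ^ 6 * L2 (fun x => f x * g x * h x) ≤ A * B * D := by
  rcases hA.eq_or_lt with rfl | hA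
  · have : (fun x => f x * g x * h x) = 0 := by ext x; simp [hf.zero]
    rw [this, L2_zero]; simp
  rcases hB.eq_or_lt with rfl | hB
  · have : (fun x => f x * g x * h x) = 0 := by ext x; simp [hg.zero]
    rw [this, L2_zero]; simp
  rcases hD.eq_or_lt with rfl | hD
  · have : (fun x => f x * g x * h x) = 0 := by ext x; simp [hh.zero]
    rw [this, L2_zero]; simp
  obtain ⟨cf, f2, f6⟩ := hf.scale hA
  obtain ⟨cg, g2, g6⟩ := hg.scale hB
  obtain ⟨ch, h2, h6⟩ := hh.scale hD
  set φ : Sp → ℝ := fun x => A⁻¹ * f x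
  set ψ : Sp → ℝ := fun x => B⁻¹ * g x
  set χ : Sp → ℝ := fun x => D⁻¹ * h x
  have e : (fun x => f x * g x * h x) = fun x => (A * B * D) * (φ x * ψ x * χ x) := by
    ext x; simp only [φ, ψ, χ]; field_simp
  have i1 := cf.pow (n := 6) (by norm_num)
  have i2 := cg.pow (n := 6) (by norm_num)
  have i3 := ch.pow (n := 6) (by norm_num)
  have key : s ^ 6 * L2 (fun x => φ x * ψ x * χ x) ≤ 1 := by
    refine mul_L2_le_one (by positivity) ?_
    have hc : CC fun x => (s ^ 6) ^ 2 * (φ x * ψ x * χ x) ^ 2 :=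
      (((cf.mul_right cg.1).mul_right ch.1).pow two_ne_zero).mul_left continuous_const
    calc ∫ x, (s ^ 6) ^ 2 * (φ x * ψ x * χ x) ^ 2
        ≤ ∫ x, (s ^ 12 / 3) * (φ x ^ 6 + ψ x ^ 6 + χ x ^ 6) := by
          refine integral_mono hc.integrable (((i1.add i2).add i3).const_mul _).integrable fun x => ?_
          simp only
          have h1 : ∀ a b c : ℝ, 0 ≤ a → 0 ≤ b → 0 ≤ c → a * b * c ≤ (a ^ 3 + b ^ 3 + c ^ 3) / 3 := by
            intro a b c ha hb hc
            nlinarith [mul_nonneg (add_nonneg (add_nonneg ha hb) hc)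
              (add_nonneg (add_nonneg (sq_nonneg (a - b)) (sq_nonneg (b - c))) (sq_nonneg (a - c)))]
          have h2 := h1 (φ x ^ 2) (ψ x ^ 2) (χ x ^ 2) (sq_nonneg _) (sq_nonneg _) (sq_nonneg _)
          have h3 : 0 ≤ s ^ 12 := by positivity
          have h4 := mul_le_mul_of_nonneg_left h2 h3
          calc (s ^ 6) ^ 2 * (φ x * ψ x * χ x) ^ 2
              = s ^ 12 * (φ x ^ 2 * ψ x ^ 2 * χ x ^ 2) := by ring
            _ ≤ _ := h4
            _ = _ := by ring
      _ = 1 / 3 * (s ^ 12 * (∫ x, φ x ^ 6) + s ^ 12 * (∫ x, ψ x ^ 6) +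
            s ^ 12 * (∫ x, χ x ^ 6)) := by
          rw [integral_const_mul, CC.integral_add (i1.add i2) i3, CC.integral_add i1 i2]
          ring
      _ ≤ 1 := by linarith
  rw [e, L2_const_mul (by positivity)]
  calc s ^ 6 * (A * B * D * L2 fun x => φ x * ψ x * χ x)
      = A * B * D * (s ^ 6 * L2 fun x => φ x * ψ x * χ x) := by ring
    _ ≤ A * B * D * 1 := by gcongr
    _ = A * B * D := by ring

lemma Bd6.mul_Bd {s A B : ℝ} {f g : Sp → ℝ} (hs : 0 ≤ s) (hA : 0 ≤ A) (hB : 0 ≤ B)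
    (hf : Bd6 A f) (hg : Bd s B g) : s * L2 (fun x => f x * g x) ≤ A * B := by
  rcases hA.eq_or_lt with rfl | hA
  · have : (fun x => f x * g x) = 0 := by ext x; simp [hf.zero]
    rw [this, L2_zero]; simp
  rcases hB.eq_or_lt with rfl | hB
  · have : (fun x => f x * g x) = 0 := by ext x; simp [hg.zero]
    rw [this, L2_zero]; simp
  obtain ⟨cf, f6⟩ := hf.scale hA
  obtain ⟨cg, g2, g6⟩ := hg.scale hB
  set φ : Sp → ℝ := fun x => A⁻¹ * f x
  set ψ : Sp → ℝ := fun x => B⁻¹ * g x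
  have e : (fun x => f x * g x) = fun x => (A * B) * (φ x * ψ x) := by
    ext x; simp only [φ, ψ]; field_simp
  have i2 := cf.pow (n := 6) (by norm_num)
  have i3 := cg.pow (n := 2) (by norm_num)
  have i4 := cg.pow (n := 6) (by norm_num)
  have key : s * L2 (fun x => φ x * ψ x) ≤ 1 := by
    refine mul_L2_le_one (by positivity) ?_
    have hc : CC fun x => s ^ 2 * (φ x * ψ x) ^ 2 :=
      ((cf.mul_right cg.1).pow two_ne_zero).mul_left continuous_const
    calc ∫ x, s ^ 2 * (φ x * ψ x) ^ 2
        ≤ ∫ x, ((1 / 3 : ℝ) * φ x ^ 6 + ((1 / 2 : ℝ) * ψ x ^ 2 + (s ^ 12 / 6) * ψ x ^ 6)) := by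
          refine integral_mono hc.integrable
            ((i2.const_mul _).add ((i3.const_mul _).add (i4.const_mul _))).integrable fun x => ?_
          simp only
          have h1 : ∀ u b : ℝ, 0 ≤ u → 0 ≤ b → u * b ^ 2 ≤ u ^ 3 / 3 + 2 / 3 * b ^ 3 := by
            intro u b hu hb
            nlinarith [mul_nonneg (sq_nonneg (u - b)) (by linarith : 0 ≤ u + 2 * b)]
          have h2 : ∀ w : ℝ, 0 ≤ w → (s * w) ^ 3 ≤ 3 / 4 * w ^ 2 + s ^ 12 / 4 * w ^ 6 := by
            intro w hw
            have : 4 * (s ^ 3 * w) ≤ 3 + (s ^ 3 * w) ^ 4 := by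
              nlinarith [sq_nonneg (s ^ 3 * w - 1), sq_nonneg ((s ^ 3 * w) ^ 2 - 1)]
            nlinarith [mul_le_mul_of_nonneg_left this (sq_nonneg w)]
          have h3 := h1 (φ x ^ 2) (s * |ψ x|) (sq_nonneg _) (by positivity)
          have h4 := h2 |ψ x| (abs_nonneg _)
          have h5 : |ψ x| ^ 6 = ψ x ^ 6 := Even.pow_abs (by decide) _
          have h6 : |ψ x| ^ 2 = ψ x ^ 2 := sq_abs _
          rw [h5, h6] at h4
          have h7 : s ^ 2 * (φ x * ψ x) ^ 2 = φ x ^ 2 * (s * |ψ x|) ^ 2 := by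
            rw [mul_pow s |ψ x|, h6]; ring
          rw [h7]
          nlinarith
      _ = 1 / 3 * (∫ x, φ x ^ 6) + (1 / 2 * (∫ x, ψ x ^ 2) + 1 / 6 * (s ^ 12 * ∫ x, ψ x ^ 6)) := by
          rw [CC.integral_add (i2.const_mul _) ((i3.const_mul _).add (i4.const_mul _)),
            CC.integral_add (i3.const_mul _) (i4.const_mul _), integral_const_mul,
            integral_const_mul, integral_const_mul]
          ring
      _ ≤ 1 := by norm_num at f6 ⊢; linarith
  rw [e, L2_const_mul (by positivity)]
  calc s * (A * B * L2 fun x => φ x * ψ x) = A * B * (s * L2 fun x => φ x * ψ x) := by ring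
    _ ≤ A * B * 1 := by gcongr
    _ = A * B := by ring

/-- The space of smooth functions on space-time. -/
def smoothSub : Submodule ℝ Fn where
  carrier := {v | ContDiff ℝ (⊤ : ℕ∞) v}
  add_mem' := fun {a b} (ha : ContDiff ℝ (⊤ : ℕ∞) a) (hb : ContDiff ℝ (⊤ : ℕ∞) b) => ha.add hb
  zero_mem' := show ContDiff ℝ (⊤ : ℕ∞) (fun _ : Pt => (0 : ℝ)) from contDiff_const
  smul_mem' := fun c a (h : ContDiff ℝ (⊤ : ℕ∞) a) =>
    show ContDiff ℝ (⊤ : ℕ∞) (fun p => c • a p) from h.const_smul c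

/-- The type of smooth functions on space-time. -/
def smoothFn : Type := smoothSub

instance : AddCommGroup smoothFn := inferInstanceAs (AddCommGroup smoothSub)

instance : Module ℝ smoothFn := inferInstanceAs (Module ℝ smoothSub)

/-- The underlying function of a smooth function. -/
def smoothFn.val (v : smoothFn) : Fn := Subtype.val (show smoothSub from v)

instance : CoeOut smoothFn Fn := ⟨smoothFn.val⟩

/-- A smooth function from its underlying function. -/
def mkSmooth (v : Fn) (h : ContDiff ℝ (⊤ : ℕ∞) v) : smoothFn := show smoothSub from ⟨v, h⟩

lemma coe_mkSmooth (v : Fn) (h : ContDiff ℝ (⊤ : ℕ∞) v) : (mkSmooth v h : Fn) = v := rfl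

lemma smooth_ext {v w : smoothFn} (h : ∀ p, (v : Fn) p = (w : Fn) p) : v = w :=
  Subtype.ext (funext h)

lemma coe_zero_smooth : ((0 : smoothFn) : Fn) = 0 := rfl

lemma coe_add_smooth (v w : smoothFn) (p : Pt) : ((v + w : smoothFn) : Fn) p = v.val p + w.val p :=
  rfl

lemma coe_sub_smooth (v w : smoothFn) (p : Pt) : ((v - w : smoothFn) : Fn) p = v.val p - w.val p :=
  rfl

lemma coe_smul_smooth (c : ℝ) (v : smoothFn) (p : Pt) :
    ((c • v : smoothFn) : Fn) p = c * v.val p := rfl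

lemma coe_sum_smooth {κ : Type*} (s : Finset κ) (f : κ → smoothFn) (p : Pt) :
    ((∑ i ∈ s, f i : smoothFn) : Fn) p = ∑ i ∈ s, (f i).val p := by
  classical
  induction s using Finset.induction_on with
  | empty => rfl
  | insert a s ha ih => rw [Finset.sum_insert ha, Finset.sum_insert ha, coe_add_smooth, ih]

lemma smooth (v : smoothFn) : ContDiff ℝ (⊤ : ℕ∞) (v : Fn) := Subtype.prop (show smoothSub from v)

/-- Affine vector fields on space-time, as a linear part and a translation. -/
abbrev AffField : Type := (Pt →L[ℝ] Pt) × Pt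

lemma contDiff_fderiv_affine {v : Fn} (hv : ContDiff ℝ (⊤ : ℕ∞) v) (a : AffField) :
    ContDiff ℝ (⊤ : ℕ∞) fun p => fderiv ℝ v p (a.1 p + a.2) :=
  (hv.fderiv_right (m := (⊤ : ℕ∞)) (by simp)).clm_apply (a.1.contDiff.add contDiff_const)

/-- The derivation attached to an affine vector field. -/
def vf : AffField →ₗ[ℝ] Module.End ℝ smoothFn where
  toFun a :=
    { toFun := fun v => mkSmooth (fun p => fderiv ℝ v.val p (a.1 p + a.2)) (contDiff_fderiv_affine (smooth v) a)
      map_add' := fun v w => by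
        refine smooth_ext fun p => ?_
        have hv : Differentiable ℝ v.val := (smooth v).differentiable (by simp)
        have hw : Differentiable ℝ w.val := (smooth w).differentiable (by simp)
        show fderiv ℝ (v.val + w.val) p _ = _ + _
        rw [fderiv_add (hv p) (hw p)]
        rfl
      map_smul' := fun c v => by
        refine smooth_ext fun p => ?_
        have hv : Differentiable ℝ v.val := (smooth v).differentiable (by simp)
        show fderiv ℝ (c • v.val) p _ = c * _
        rw [fderiv_const_smul (hv p)]
        rfl }
  map_add' a b := by
    refine LinearMap.ext fun v => smooth_ext fun p => ?_
    show fderiv ℝ v.val p _ = fderiv ℝ v.val p _ + fderiv ℝ v.val p _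
    rw [← map_add]
    congr 1
    simp
    abel
  map_smul' c a := by
    refine LinearMap.ext fun v => smooth_ext fun p => ?_
    show fderiv ℝ v.val p _ = c * fderiv ℝ v.val p _
    rw [← smul_eq_mul, ← map_smul]
    congr 1
    simp

lemma vf_apply (a : AffField) (v : smoothFn) (p : Pt) :
    (vf a v : Fn) p = fderiv ℝ v.val p (a.1 p + a.2) := rfl

/-- The Lie bracket of affine vector fields. -/
def brk (a b : AffField) : AffField := (b.1.comp a.1 - a.1.comp b.1, b.1 a.2 - a.1 b.2)

lemma vf_vf_apply (a b : AffField) (v : smoothFn) (p : Pt) :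
    (vf a (vf b v) : Fn) p = fderiv ℝ (fderiv ℝ v.val) p (a.1 p + a.2) (b.1 p + b.2) +
      fderiv ℝ v.val p (b.1 (a.1 p + a.2)) := by
  rw [vf_apply]
  have h1 : HasFDerivAt (fderiv ℝ v.val) _ p :=
    (((smooth v).fderiv_right (m := (⊤ : ℕ∞)) (by simp)).differentiable (by simp) p).hasFDerivAt
  have h2 : HasFDerivAt (fun p => b.1 p + b.2) b.1 p := b.1.hasFDerivAt.add_const _
  have h3 : HasFDerivAt (vf b v : Fn) _ p := h1.clm_apply h2
  rw [h3.fderiv]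
  simp
  ring

lemma vf_mul_sub (a b : AffField) : vf a * vf b - vf b * vf a = vf (brk a b) := by
  refine LinearMap.ext fun v => smooth_ext fun p => ?_
  show (vf a (vf b v) : Fn) p - (vf b (vf a v) : Fn) p = _
  rw [vf_vf_apply, vf_vf_apply, vf_apply]
  have hs : IsSymmSndFDerivAt ℝ v.val p :=
    (smooth v).contDiffAt.isSymmSndFDerivAt (by
      rw [minSmoothness_of_isRCLikeNormedField]
      exact WithTop.coe_le_coe.2 (le_top : (2 : ℕ∞) ≤ ⊤))
  rw [hs.eq (a.1 p + a.2)]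
  simp [brk]
  ring

/-- The coordinate basis of space-time. -/
def eb : Fin 4 → Pt := Fin.cases (1, 0) fun j => (0, EuclideanSpace.single j 1)

/-- The coordinates on space-time. -/
def xc : Fin 4 → Pt →L[ℝ] ℝ := Fin.cases (ContinuousLinearMap.fst ℝ ℝ Sp)
  fun j => (EuclideanSpace.proj j).comp (ContinuousLinearMap.snd ℝ ℝ Sp)

lemma sum_xc_smul_eb (p : Pt) : ∑ α, xc α p • eb α = p := by
  ext
  · simp [xc, eb, Fin.sum_univ_succ]
  · rename_i i
    fin_cases i <;> simp [xc, eb, Fin.sum_univ_succ]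

/-- The rotation `x_i ∂_j - x_j ∂_i` as an affine field. -/
def rotField (i j : Fin 3) : AffField :=
  ((xc i.succ).smulRight (eb j.succ) - (xc j.succ).smulRight (eb i.succ), 0)

/-- The translation field in a coordinate direction. -/
def trField (α : Fin 4) : AffField := (0, eb α)

/-- The dilation field. -/
def dilField : AffField := (ContinuousLinearMap.id ℝ Pt, 0)

/-- The affine fields of the generators `Z`. -/
def zField : Fin 7 → AffField :=
  ![trField 1, trField 2, trField 3, rotField 0 1, rotField 1 2, rotField 0 2, dilField]

/-- The generators acting on smooth functions. -/
def Zl (i : Fin 7) : Module.End ℝ smoothFn := vf (zField i)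

/-- The coordinate derivatives acting on smooth functions. -/
def Dl (α : Fin 4) : Module.End ℝ smoothFn := vf (trField α)

lemma Dl_apply (α : Fin 4) (v : smoothFn) : (Dl α v : Fn) = pd α v.val := by
  ext p
  rw [Dl, vf_apply]
  refine Fin.cases ?_ (fun j => ?_) α <;> simp [trField, eb, pd, pt, px]

lemma pd_eq (α : Fin 4) (v : Fn) (p : Pt) : pd α v p = fderiv ℝ v p (eb α) := by
  refine Fin.cases ?_ (fun j => ?_) α <;> simp [eb, pd, pt, px]

lemma Zop_eq (i : Fin 7) (v : Fn) (p : Pt) :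
    Zop i v p = fderiv ℝ v p ((zField i).1 p + (zField i).2) := by
  have hS : sOp v p = fderiv ℝ v p p := by
    have h := congrArg (fderiv ℝ v p) (sum_xc_smul_eb p)
    rw [← h, map_sum]
    simp_rw [map_smul, ← pd_eq]
    simp [sOp, Fin.sum_univ_succ, xc, pd]
  have hR : ∀ i j, om i j v p = fderiv ℝ v p ((rotField i j).1 p + (rotField i j).2) := by
    intro i j
    have h : (rotField i j).1 p + (rotField i j).2 =
        p.2 i • eb j.succ - p.2 j • eb i.succ := by
      simp [rotField, xc]
    rw [h, map_sub, map_smul, map_smul, ← pd_eq, ← pd_eq]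
    simp [om, pd]
  fin_cases i
  · simp [Zop, zField, trField, px, eb]; rfl
  · simp [Zop, zField, trField, px, eb]; rfl
  · simp [Zop, zField, trField, px, eb]; rfl
  · exact hR 0 1
  · exact hR 1 2
  · exact hR 0 2
  · have h : (zField 6).1 p + (zField 6).2 = p := by
      show p + 0 = p
      exact add_zero p
    show sOp v p = fderiv ℝ v p ((zField 6).1 p + (zField 6).2)
    rw [h, hS]

lemma Zl_apply (i : Fin 7) (v : smoothFn) : (Zl i v : Fn) = Zop i v.val := by
  ext p
  rw [Zl, vf_apply, Zop_eq]

/-- The product of a family along a word. -/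
def word {A ι : Type*} [Ring A] (Z : ι → A) (l : List ι) : A := (l.map Z).prod

lemma word_cons {A ι : Type*} [Ring A] (Z : ι → A) (i : ι) (l : List ι) :
    word Z (i :: l) = Z i * word Z l := by simp [word]

lemma word_append {A ι : Type*} [Ring A] (Z : ι → A) (l l' : List ι) :
    word Z (l ++ l') = word Z l * word Z l' := by simp [word]

/-- The span of the words of bounded length. -/
def filt {A ι : Type*} [Ring A] [Algebra ℝ A] (Z : ι → A) (n : ℕ) : Submodule ℝ A :=
  Submodule.span ℝ (word Z '' {l | l.length ≤ n})

lemma word_mem_filt {A ι : Type*} [Ring A] [Algebra ℝ A] (Z : ι → A) {n : ℕ} {l : List ι}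
    (h : l.length ≤ n) : word Z l ∈ filt Z n := Submodule.subset_span ⟨l, h, rfl⟩

lemma filt_mono {A ι : Type*} [Ring A] [Algebra ℝ A] (Z : ι → A) {m n : ℕ} (h : m ≤ n) :
    filt Z m ≤ filt Z n :=
  Submodule.span_mono (image_mono fun _ hl => le_trans hl h)

lemma mul_mem_filt {A ι : Type*} [Ring A] [Algebra ℝ A] (Z : ι → A) {m n : ℕ} {x y : A}
    (hx : x ∈ filt Z m) (hy : y ∈ filt Z n) : x * y ∈ filt Z (m + n) := by
  refine Submodule.mul_le.2 (fun a ha b hb => ?_) (Submodule.mul_mem_mul hx hy)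
  refine Submodule.span_induction ?_ ?_ ?_ ?_ ha
  · rintro _ ⟨l, hl, rfl⟩
    refine Submodule.span_induction ?_ ?_ ?_ ?_ hb
    · rintro _ ⟨l', hl', rfl⟩
      rw [← word_append]
      exact word_mem_filt Z (by simpa using add_le_add hl hl')
    · simp
    · intro a b _ _ ha hb
      rw [mul_add]
      exact add_mem ha hb
    · intro c a _ ha
      rw [mul_smul_comm]
      exact Submodule.smul_mem _ _ ha
  · simp
  · intro a b _ _ ha hb
    rw [add_mul]
    exact add_mem ha hb
  · intro c a _ ha
    rw [smul_mul_assoc]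
    exact Submodule.smul_mem _ _ ha

lemma gen_mem_filt {A ι : Type*} [Ring A] [Algebra ℝ A] (Z : ι → A) (i : ι) :
    Z i ∈ filt Z 1 := by
  have := word_mem_filt Z (n := 1) (l := [i]) (by simp)
  simpa [word] using this

lemma word_sub_word_mem_filt {A ι : Type*} [Ring A] [Algebra ℝ A] (Z : ι → A)
    (hZ : ∀ i j, Z i * Z j - Z j * Z i ∈ filt Z 1) {l l' : List ι} (h : l.Perm l') :
    ∀ n, l.length ≤ n + 1 → word Z l - word Z l' ∈ filt Z n := by
  induction h with
  | nil => intro n _; simp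
  | @cons x l l' h ih =>
    intro n hn
    rw [word_cons, word_cons, ← mul_sub]
    rcases n with _ | n
    · have h1 : l = [] := by
        rw [← List.length_eq_zero_iff]
        simpa using hn
      subst h1
      rw [List.nil_perm.1 h]
      simp
    · have := mul_mem_filt Z (gen_mem_filt Z x) (ih n (by simpa using hn))
      rwa [add_comm] at this
  | swap x y l =>
    intro n hn
    rw [word_cons, word_cons, word_cons, word_cons, ← mul_assoc, ← mul_assoc, ← sub_mul]
    have hn' : 1 + l.length ≤ n := by simp at hn; omega
    exact filt_mono Z hn' (mul_mem_filt Z (hZ y x) (word_mem_filt Z le_rfl))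
  | trans h1 h2 ih1 ih2 =>
    intro n hn
    have := add_mem (ih1 n hn) (ih2 n (by rw [← h1.length_eq]; exact hn))
    simpa using this

lemma filt_le_span_of_perm {A ι : Type*} [Ring A] [Algebra ℝ A] (Z : ι → A)
    (hZ : ∀ i j, Z i * Z j - Z j * Z i ∈ filt Z 1) (S : Set (List ι))
    (hS : ∀ l : List ι, ∃ l' ∈ S, l.Perm l') (n : ℕ) :
    filt Z n ≤ Submodule.span ℝ (word Z '' {l | l ∈ S ∧ l.length ≤ n}) := by
  induction n with
  | zero =>
    refine Submodule.span_le.2 ?_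
    rintro _ ⟨l, hl, rfl⟩
    obtain ⟨l', h1, h2⟩ := hS l
    have h0 : l = [] := by
      rw [← List.length_eq_zero_iff]
      exact Nat.le_zero.1 hl
    subst h0
    rw [List.nil_perm.1 h2] at h1
    exact Submodule.subset_span ⟨_, ⟨h1, hl⟩, rfl⟩
  | succ n ih =>
    refine Submodule.span_le.2 ?_
    rintro _ ⟨l, hl, rfl⟩
    obtain ⟨l', h1, h2⟩ := hS l
    have h3 := ih (word_sub_word_mem_filt Z hZ h2 n hl)
    have h4 : word Z l' ∈ Submodule.span ℝ (word Z '' {l | l ∈ S ∧ l.length ≤ n + 1}) :=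
      Submodule.subset_span ⟨_, ⟨h1, by rw [← h2.length_eq]; exact hl⟩, rfl⟩
    have hsub : {l | l ∈ S ∧ l.length ≤ n} ⊆ {l | l ∈ S ∧ l.length ≤ n + 1} :=
      fun l hl => ⟨hl.1, hl.2.trans (Nat.le_succ n)⟩
    have h5 := Submodule.span_mono (image_mono hsub) h3
    simpa using add_mem h5 h4

/-- The ordered word attached to a multi-index. -/
def idxWord {n : ℕ} (a : Fin n → ℕ) : List (Fin n) :=
  (List.finRange n).flatMap fun i => List.replicate (a i) i

lemma length_idxWord {n : ℕ} (a : Fin n → ℕ) : (idxWord a).length = ∑ i, a i := by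
  simp [idxWord, List.length_flatMap, Fin.sum_univ_def]

lemma perm_idxWord {n : ℕ} (l : List (Fin n)) : l.Perm (idxWord fun i => l.count i) := by
  rw [List.perm_iff_count]
  intro i
  simp [idxWord, List.count_flatMap, Function.comp_def, List.count_replicate,
    ← Fin.sum_univ_def]

lemma exists_abs_le_of_mem_span {κ : Type*} (s : κ → Module.End ℝ smoothFn) (I : Finset κ)
    {T : Module.End ℝ smoothFn} (hT : T ∈ Submodule.span ℝ (s '' I)) :
    ∃ C : ℝ, 0 ≤ C ∧ ∀ (v : smoothFn) (p : Pt),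
      |(T v : Fn) p| ≤ C * ∑ i ∈ I, |(s i v : Fn) p| := by
  refine Submodule.span_induction ?_ ?_ ?_ ?_ hT
  · rintro _ ⟨i, hi, rfl⟩
    refine ⟨1, zero_le_one, fun v p => ?_⟩
    rw [one_mul]
    exact Finset.single_le_sum (f := fun i => |(s i v : Fn) p|) (fun _ _ => abs_nonneg _) hi
  · refine ⟨0, le_rfl, fun v p => ?_⟩
    simp [coe_zero_smooth]
  · rintro a b _ _ ⟨C, hC, h⟩ ⟨D, hD, h'⟩
    refine ⟨C + D, add_nonneg hC hD, fun v p => ?_⟩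
    rw [add_mul]
    exact (abs_add_le _ _).trans (add_le_add (h v p) (h' v p))
  · rintro c a _ ⟨C, hC, h⟩
    refine ⟨|c| * C, mul_nonneg (abs_nonneg _) hC, fun v p => ?_⟩
    rw [mul_assoc]
    show |c * (a v : Fn) p| ≤ _
    rw [abs_mul]
    exact mul_le_mul_of_nonneg_left (h v p) (abs_nonneg _)

lemma affField_ext {a b : AffField} (h1 : ∀ p α, xc α (a.1 p) = xc α (b.1 p))
    (h2 : ∀ α, xc α a.2 = xc α b.2) : a = b := by
  refine Prod.ext (ContinuousLinearMap.ext fun p => ?_) ?_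
  · rw [← sum_xc_smul_eb (a.1 p), ← sum_xc_smul_eb (b.1 p)]
    simp_rw [h1]
  · rw [← sum_xc_smul_eb a.2, ← sum_xc_smul_eb b.2]
    simp_rw [h2]

lemma xc_eb (α β : Fin 4) : xc α (eb β) = if α = β then 1 else 0 := by
  refine Fin.cases ?_ (fun i => ?_) α <;> refine Fin.cases ?_ (fun j => ?_) β
  · simp [xc, eb]
  · simp [xc, eb, (Fin.succ_ne_zero j).symm]
  · simp [xc, eb]
  · simp [xc, eb]

lemma rotField_apply (i j : Fin 3) (p : Pt) :
    (rotField i j).1 p = xc i.succ p • eb j.succ - xc j.succ p • eb i.succ := rfl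

lemma trField_apply (α : Fin 4) (p : Pt) : (trField α).1 p = 0 := rfl

lemma dilField_apply (p : Pt) : dilField.1 p = p := rfl

lemma brk_apply (a b : AffField) (p : Pt) : (brk a b).1 p = b.1 (a.1 p) - a.1 (b.1 p) := rfl

lemma brk_snd (a b : AffField) : (brk a b).2 = b.1 a.2 - a.1 b.2 := rfl

lemma smul_affField_apply (c : ℝ) (a : AffField) (p : Pt) : (c • a).1 p = c • a.1 p := rfl

/-- Structure constants of the generators. -/
def zTable : Fin 7 → Fin 7 → ℝ × Fin 7 :=
  ![![(0, 0), (0, 0), (0, 0), (1, 1), (0, 0), (1, 2), (1, 0)],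
    ![(0, 0), (0, 0), (0, 0), (-1, 0), (1, 2), (0, 0), (1, 1)],
    ![(0, 0), (0, 0), (0, 0), (0, 0), (-1, 1), (-1, 0), (1, 2)],
    ![(-1, 1), (1, 0), (0, 0), (0, 0), (1, 5), (-1, 4), (0, 0)],
    ![(0, 0), (-1, 2), (1, 1), (-1, 5), (0, 0), (1, 3), (0, 0)],
    ![(-1, 2), (0, 0), (1, 0), (1, 4), (-1, 3), (0, 0), (0, 0)],
    ![(-1, 0), (-1, 1), (-1, 2), (0, 0), (0, 0), (0, 0), (0, 0)]]

set_option maxHeartbeats 2000000 in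
lemma brk_zField (i j : Fin 7) :
    brk (zField i) (zField j) = (zTable i j).1 • zField (zTable i j).2 := by
  refine affField_ext (fun p α => ?_) (fun α => ?_)
  · rw [smul_affField_apply, brk_apply]
    fin_cases i <;> fin_cases j <;>
      simp [zField, zTable, trField_apply, rotField_apply, dilField_apply, xc_eb,
        -Prod.smul_fst] <;> ring
  · rw [brk_snd, Prod.smul_snd]
    fin_cases i <;> fin_cases j <;>
      simp [zField, zTable, trField, rotField, dilField, xc_eb]

lemma Zl_mul_sub_mem_filt (i j : Fin 7) : Zl i * Zl j - Zl j * Zl i ∈ filt Zl 1 := by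
  rw [Zl, Zl, vf_mul_sub, brk_zField, map_smul]
  exact Submodule.smul_mem _ _ (gen_mem_filt Zl _)

lemma vf_mul_Dl (a : AffField) (β : Fin 4) :
    vf a * Dl β = Dl β * vf a - ∑ α, xc α (a.1 (eb β)) • Dl α := by
  have h : brk a (trField β) = - ∑ α, xc α (a.1 (eb β)) • trField α := by
    have hs : (∑ α, xc α (a.1 (eb β)) • trField α) = (0, a.1 (eb β)) := by
      refine Prod.ext ?_ ?_
      · rw [Prod.fst_sum]
        exact Finset.sum_eq_zero fun c _ => ContinuousLinearMap.ext fun p =>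
          (smul_zero (xc c (a.1 (eb β))) : _ • (0 : Pt) = 0)
      · rw [Prod.snd_sum]
        simp only [trField, Prod.smul_snd]
        exact sum_xc_smul_eb _
    rw [hs]
    simp [brk, trField]
  have h2 := vf_mul_sub a (trField β)
  rw [h, map_neg, map_sum] at h2
  simp only [map_smul] at h2
  rw [sub_eq_add_neg, ← sub_eq_iff_eq_add']
  exact h2

/-- The span of first derivatives of words of bounded length. -/
def dfilt (n : ℕ) : Submodule ℝ (Module.End ℝ smoothFn) :=
  Submodule.span ℝ ((fun q : Fin 4 × List (Fin 7) => Dl q.1 * word Zl q.2) ''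
    {q | q.2.length ≤ n})

lemma Dl_mul_mem_dfilt (β : Fin 4) {n : ℕ} {x : Module.End ℝ smoothFn} (hx : x ∈ filt Zl n) :
    Dl β * x ∈ dfilt n := by
  refine Submodule.span_induction ?_ ?_ ?_ ?_ hx
  · rintro _ ⟨l, hl, rfl⟩
    exact Submodule.subset_span ⟨(β, l), hl, rfl⟩
  · simp
  · intro a b _ _ ha hb
    rw [mul_add]
    exact add_mem ha hb
  · intro c a _ ha
    rw [mul_smul_comm]
    exact Submodule.smul_mem _ _ ha

lemma vf_mul_mem_dfilt (i : Fin 7) {n : ℕ} {x : Module.End ℝ smoothFn} (hx : x ∈ dfilt n) :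
    Zl i * x ∈ dfilt (n + 1) := by
  refine Submodule.span_induction ?_ ?_ ?_ ?_ hx
  · rintro _ ⟨⟨β, l⟩, hl, rfl⟩
    have hl' : l.length ≤ n := hl
    show Zl i * (Dl β * word Zl l) ∈ _
    rw [← mul_assoc, Zl, vf_mul_Dl, sub_mul, mul_assoc]
    refine sub_mem (Submodule.subset_span ⟨(β, i :: l), by simpa using hl, ?_⟩) ?_
    · simp [word_cons, Zl]
    · rw [Finset.sum_mul]
      refine sum_mem fun α _ => ?_
      rw [smul_mul_assoc]
      exact Submodule.smul_mem _ _ (Submodule.subset_span ⟨(α, l), hl'.trans (Nat.le_succ n), rfl⟩)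
  · simp
  · intro a b _ _ ha hb
    rw [mul_add]
    exact add_mem ha hb
  · intro c a _ ha
    rw [mul_smul_comm]
    exact Submodule.smul_mem _ _ ha

lemma word_mul_mem_dfilt (l : List (Fin 7)) {n : ℕ} {x : Module.End ℝ smoothFn}
    (hx : x ∈ dfilt n) : word Zl l * x ∈ dfilt (n + l.length) := by
  induction l with
  | nil => simpa [word] using hx
  | cons i l ih =>
    rw [word_cons, mul_assoc]
    exact vf_mul_mem_dfilt i ih

/-- The d'Alembertian acting on smooth functions. -/
def boxL (c : ℝ) : Module.End ℝ smoothFn :=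
  Dl 0 * Dl 0 - c ^ 2 • ∑ j : Fin 3, Dl j.succ * Dl j.succ

lemma boxL_apply (c : ℝ) (v : smoothFn) : (boxL c v : Fn) = boxOp c v := by
  ext p
  rw [boxL, LinearMap.sub_apply, LinearMap.smul_apply, LinearMap.sum_apply, coe_sub_smooth,
    coe_smul_smooth, coe_sum_smooth]
  simp only [Module.End.mul_apply, Dl_apply]
  rfl

/-- The scaling weights of the generators. -/
def zWeight : Fin 7 → ℝ := ![0, 0, 0, 0, 0, 0, 2]

lemma Dl_mul_comm (α β : Fin 4) : Dl α * Dl β = Dl β * Dl α := by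
  have := vf_mul_Dl (trField α) β
  simp only [trField_apply, map_zero, zero_smul, Finset.sum_const_zero, sub_zero] at this
  exact this

lemma vf_mul_Dl_Dl {a : Module.End ℝ smoothFn} {d e : Module.End ℝ smoothFn}
    (h : a * d = d * a - e) : a * (d * d) = d * d * a - (d * e + e * d) := by
  rw [← mul_assoc, h, sub_mul, mul_assoc, h, mul_sub]
  noncomm_ring

lemma Zl_mul_boxL (c : ℝ) (i : Fin 7) :
    Zl i * boxL c = boxL c * Zl i - zWeight i • boxL c := by
  have hD : ∀ β, Zl i * (Dl β * Dl β) = Dl β * Dl β * Zl i -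
      (Dl β * (∑ α, xc α ((zField i).1 (eb β)) • Dl α) +
        (∑ α, xc α ((zField i).1 (eb β)) • Dl α) * Dl β) := fun β =>
    vf_mul_Dl_Dl (vf_mul_Dl (zField i) β)
  have h01 := Dl_mul_comm 1 2
  have h12 := Dl_mul_comm 2 3
  have h02 := Dl_mul_comm 1 3
  rw [boxL, mul_sub, mul_smul_comm, Finset.mul_sum]
  simp_rw [hD]
  fin_cases i <;>
    simp [Fin.sum_univ_succ, zField, trField_apply, rotField_apply, dilField_apply, xc_eb,
      zWeight, sub_mul, add_mul, h01, h12, h02]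
  module

/-- The iterated generators along a word. -/
def Zw (l : List (Fin 7)) (v : Fn) : Fn := l.foldr Zop v

/-- The words of bounded length. -/
def W (n : ℕ) : Finset (List (Fin 7)) := (List.finite_length_le (Fin 7) n).toFinset

lemma mem_W {n : ℕ} {l : List (Fin 7)} : l ∈ W n ↔ l.length ≤ n := by simp [W]

lemma Zw_nil (v : Fn) : Zw [] v = v := rfl

lemma Zw_cons (i : Fin 7) (l : List (Fin 7)) (v : Fn) : Zw (i :: l) v = Zop i (Zw l v) := rfl

lemma Zw_append (l l' : List (Fin 7)) (v : Fn) : Zw (l ++ l') v = Zw l (Zw l' v) := by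
  simp [Zw]

lemma contDiff_Zop {v : Fn} (hv : ContDiff ℝ (⊤ : ℕ∞) v) (i : Fin 7) :
    ContDiff ℝ (⊤ : ℕ∞) (Zop i v) := by
  have := smooth (Zl i (mkSmooth v hv))
  rwa [Zl_apply] at this

lemma contDiff_Zw {v : Fn} (hv : ContDiff ℝ (⊤ : ℕ∞) v) (l : List (Fin 7)) :
    ContDiff ℝ (⊤ : ℕ∞) (Zw l v) := by
  induction l with
  | nil => exact hv
  | cons i l ih => exact contDiff_Zop ih i

lemma contDiff_pd {v : Fn} (hv : ContDiff ℝ (⊤ : ℕ∞) v) (α : Fin 4) :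
    ContDiff ℝ (⊤ : ℕ∞) (pd α v) := by
  have := smooth (Dl α (mkSmooth v hv))
  rwa [Dl_apply] at this

lemma coe_word_Zl (l : List (Fin 7)) (v : smoothFn) : (word Zl l v : Fn) = Zw l v := by
  induction l with
  | nil => rfl
  | cons i l ih => rw [word_cons, Module.End.mul_apply, Zl_apply, ih, Zw_cons]

lemma Zmulti_eq_Zw (a : Fin 7 → ℕ) (v : Fn) : Zmulti a v = Zw (idxWord a) v := by
  have h : ∀ n (i : Fin 7) (w : Fn), (List.replicate n i).foldr Zop w = (Zop i)^[n] w := by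
    intro n i w
    induction n with
    | zero => rfl
    | succ n ih => rw [List.replicate_succ, List.foldr_cons, ih, Function.iterate_succ_apply']
  simp only [Zmulti, Zw, idxWord, List.foldr_flatMap, h]

lemma pd_comm {v : Fn} (hv : ContDiff ℝ (⊤ : ℕ∞) v) (α β : Fin 4) :
    pd α (pd β v) = pd β (pd α v) := by
  have := congrArg (fun T : Module.End ℝ smoothFn => (T (mkSmooth v hv) : Fn)) (Dl_mul_comm α β)
  simpa only [Module.End.mul_apply, Dl_apply, coe_mkSmooth] using this

lemma Zop_pd {v : Fn} (hv : ContDiff ℝ (⊤ : ℕ∞) v) (i : Fin 7) (β : Fin 4) (p : Pt) :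
    Zop i (pd β v) p =
      pd β (Zop i v) p - ∑ α, xc α ((zField i).1 (eb β)) * pd α v p := by
  have h := congrArg (fun T : Module.End ℝ smoothFn => (T (mkSmooth v hv) : Fn) p)
    (vf_mul_Dl (zField i) β)
  have h2 : vf (zField i) = Zl i := rfl
  simpa only [h2, LinearMap.sub_apply, coe_sub_smooth, LinearMap.sum_apply, coe_sum_smooth,
    LinearMap.smul_apply, coe_smul_smooth, Module.End.mul_apply, Dl_apply, coe_mkSmooth,
    Zl_apply] using h

lemma exists_uniform_of_finset {κ : Type*} (s : Finset κ) {P : κ → ℝ → Prop}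
    (hP : ∀ k c d, c ≤ d → P k c → P k d) (h : ∀ k ∈ s, ∃ C : ℝ, 0 ≤ C ∧ P k C) :
    ∃ C : ℝ, 0 ≤ C ∧ ∀ k ∈ s, P k C := by
  classical
  induction s using Finset.induction_on with
  | empty => exact ⟨0, le_rfl, by simp⟩
  | insert a s ha ih =>
    obtain ⟨C, hC, h1⟩ := ih fun k hk => h k (Finset.mem_insert_of_mem hk)
    obtain ⟨D, hD, h2⟩ := h a (Finset.mem_insert_self a s)
    refine ⟨max C D, le_max_of_le_left hC, fun k hk => ?_⟩
    rcases Finset.mem_insert.1 hk with rfl | hk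
    · exact hP _ _ _ (le_max_right _ _) h2
    · exact hP _ _ _ (le_max_left _ _) (h1 k hk)

lemma exists_abs_pd_Zw_le (n : ℕ) : ∃ C : ℝ, 0 ≤ C ∧ ∀ l ∈ W n, ∀ v : Fn,
    ContDiff ℝ (⊤ : ℕ∞) v → ∀ α p, |pd α (Zw l v) p| ≤
      C * ∑ a ∈ idxSet 7 n, |pd α (Zmulti a v) p| := by
  refine exists_uniform_of_finset (W n) (P := fun l C => ∀ v : Fn,
    ContDiff ℝ (⊤ : ℕ∞) v → ∀ α p, |pd α (Zw l v) p| ≤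
      C * ∑ a ∈ idxSet 7 n, |pd α (Zmulti a v) p|) ?_ ?_
  · intro l c d hcd h v hv α p
    exact (h v hv α p).trans
      (mul_le_mul_of_nonneg_right hcd (Finset.sum_nonneg fun _ _ => abs_nonneg _))
  intro l hl
  suffices h : ∀ α, ∃ C : ℝ, 0 ≤ C ∧ ∀ v : Fn, ContDiff ℝ (⊤ : ℕ∞) v → ∀ p,
      |pd α (Zw l v) p| ≤ C * ∑ a ∈ idxSet 7 n, |pd α (Zmulti a v) p| by
    obtain ⟨C, hC, h⟩ := exists_uniform_of_finset Finset.univ (P := fun α C => ∀ v : Fn,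
      ContDiff ℝ (⊤ : ℕ∞) v → ∀ p,
      |pd α (Zw l v) p| ≤ C * ∑ a ∈ idxSet 7 n, |pd α (Zmulti a v) p|)
      (fun α c d hcd h v hv p => (h v hv p).trans
        (mul_le_mul_of_nonneg_right hcd (Finset.sum_nonneg fun _ _ => abs_nonneg _)))
      (fun α _ => h α)
    exact ⟨C, hC, fun v hv α p => h α (Finset.mem_univ _) v hv p⟩
  intro α
  have h1 := filt_le_span_of_perm Zl Zl_mul_sub_mem_filt (range idxWord)
    (fun l => ⟨_, ⟨_, rfl⟩, perm_idxWord l⟩) n (word_mem_filt Zl (mem_W.1 hl))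
  have h2 : Dl α * word Zl l ∈ Submodule.span ℝ ((fun a => Dl α * word Zl (idxWord a)) ''
      (idxSet 7 n : Set (Fin 7 → ℕ))) := by
    refine Submodule.span_induction ?_ ?_ ?_ ?_ h1
    · rintro _ ⟨_, ⟨⟨a, rfl⟩, ha⟩, rfl⟩
      refine Submodule.subset_span ⟨a, ?_, rfl⟩
      rw [length_idxWord] at ha
      simp only [idxSet, Finset.coe_filter, Fintype.mem_piFinset, Finset.mem_range, mem_ofPred_eq]
      exact ⟨fun i => Nat.lt_succ_of_le
        ((Finset.single_le_sum (fun _ _ => Nat.zero_le _) (Finset.mem_univ i)).trans ha), ha⟩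
    · simp
    · intro a b _ _ ha hb
      rw [mul_add]
      exact add_mem ha hb
    · intro c a _ ha
      rw [mul_smul_comm]
      exact Submodule.smul_mem _ _ ha
  obtain ⟨C, hC, h3⟩ := exists_abs_le_of_mem_span _ _ h2
  refine ⟨C, hC, fun v hv p => ?_⟩
  simpa only [Module.End.mul_apply, Dl_apply, coe_word_Zl, coe_mkSmooth, Zmulti_eq_Zw] using
    h3 (mkSmooth v hv) p

lemma exists_abs_Zw_pd_le (n : ℕ) : ∃ C : ℝ, 0 ≤ C ∧ ∀ l ∈ W n, ∀ v : Fn,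
    ContDiff ℝ (⊤ : ℕ∞) v → ∀ α p, |Zw l (pd α v) p| ≤
      C * ∑ q ∈ Finset.univ ×ˢ W n, |pd q.1 (Zw q.2 v) p| := by
  obtain ⟨C, hC, h⟩ := exists_uniform_of_finset (W n ×ˢ (Finset.univ : Finset (Fin 4)))
    (P := fun k C => ∀ v : Fn, ContDiff ℝ (⊤ : ℕ∞) v → ∀ p, |Zw k.1 (pd k.2 v) p| ≤
      C * ∑ q ∈ Finset.univ ×ˢ W n, |pd q.1 (Zw q.2 v) p|)
    (fun α c d hcd h v hv p => (h v hv p).trans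
        (mul_le_mul_of_nonneg_right hcd (Finset.sum_nonneg fun _ _ => abs_nonneg _))) (by
      rintro ⟨l, α⟩ hk
      have hl : l.length ≤ n := mem_W.1 (Finset.mem_product.1 hk).1
      have h1 : word Zl l * (Dl α * 1) ∈ dfilt (0 + l.length) :=
        word_mul_mem_dfilt l (Dl_mul_mem_dfilt α (by
          simpa [word] using word_mem_filt Zl (l := []) (n := 0) (by simp)))
      have h2 : word Zl l * (Dl α * 1) ∈ Submodule.span ℝ
          ((fun q : Fin 4 × List (Fin 7) => Dl q.1 * word Zl q.2) ''
            ((Finset.univ ×ˢ W n : Finset (Fin 4 × List (Fin 7))) : Set _)) := by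
        refine Submodule.span_mono (image_mono fun q hq => ?_) h1
        have hq' : q.2.length ≤ 0 + l.length := hq
        simpa [mem_W] using hq'.trans (by omega)
      obtain ⟨C, hC, h3⟩ := exists_abs_le_of_mem_span _ _ h2
      refine ⟨C, hC, fun v hv p => ?_⟩
      simpa only [mul_one, Module.End.mul_apply, Dl_apply, coe_word_Zl, coe_mkSmooth] using
        h3 (mkSmooth v hv) p)
  exact ⟨C, hC, fun l hl v hv α p =>
    h (l, α) (Finset.mem_product.2 ⟨hl, Finset.mem_univ _⟩) v hv p⟩

lemma boxL_mul_word_mem (c : ℝ) (l : List (Fin 7)) :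
    ∃ T ∈ filt Zl l.length, boxL c * word Zl l = T * boxL c := by
  induction l with
  | nil => exact ⟨1, by simpa [word] using word_mem_filt Zl (l := []) (n := 0) (by simp),
      by simp [word]⟩
  | cons i l ih =>
    obtain ⟨T, hT, h⟩ := ih
    refine ⟨Zl i * T + zWeight i • T, add_mem ?_ (Submodule.smul_mem _ _ ?_), ?_⟩
    · simpa [add_comm] using mul_mem_filt Zl (gen_mem_filt Zl i) hT
    · exact filt_mono Zl (by simp) hT
    · have h1 : boxL c * Zl i = Zl i * boxL c + zWeight i • boxL c := by
        rw [Zl_mul_boxL]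
        abel
      rw [word_cons, ← mul_assoc, h1, add_mul, mul_assoc, h, smul_mul_assoc, h, add_mul,
        smul_mul_assoc, mul_assoc]

lemma exists_abs_boxOp_Zw_le (c : ℝ) (n : ℕ) : ∃ C : ℝ, 0 ≤ C ∧ ∀ l ∈ W n, ∀ v : Fn,
    ContDiff ℝ (⊤ : ℕ∞) v → ∀ p, |boxOp c (Zw l v) p| ≤
      C * ∑ l' ∈ W n, |Zw l' (boxOp c v) p| := by
  refine exists_uniform_of_finset (W n) (P := fun l C => ∀ v : Fn,
    ContDiff ℝ (⊤ : ℕ∞) v → ∀ p, |boxOp c (Zw l v) p| ≤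
      C * ∑ l' ∈ W n, |Zw l' (boxOp c v) p|) ?_ ?_
  · intro l c d hcd h v hv p
    exact (h v hv p).trans
      (mul_le_mul_of_nonneg_right hcd (Finset.sum_nonneg fun _ _ => abs_nonneg _))
  intro l hl
  obtain ⟨T, hT, h⟩ := boxL_mul_word_mem c l
  have h2 : T ∈ Submodule.span ℝ (word Zl '' (W n : Set (List (Fin 7)))) :=
    Submodule.span_mono (image_mono fun q hq =>
      mem_W.2 (le_trans (show q.length ≤ l.length from hq) (mem_W.1 hl))) hT
  obtain ⟨C, hC, h3⟩ := exists_abs_le_of_mem_span _ _ h2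
  refine ⟨C, hC, fun v hv p => ?_⟩
  have h4 := congrArg (fun T : Module.End ℝ smoothFn => (T (mkSmooth v hv) : Fn) p) h
  simp only [Module.End.mul_apply, boxL_apply, coe_word_Zl, coe_mkSmooth] at h4
  rw [h4]
  simpa only [boxL_apply, coe_word_Zl, coe_mkSmooth] using h3 (boxL c (mkSmooth v hv)) p

lemma contDiff_boxOp {v : Fn} (hv : ContDiff ℝ (⊤ : ℕ∞) v) (c : ℝ) :
    ContDiff ℝ (⊤ : ℕ∞) (boxOp c v) := by
  have := smooth (boxL c (mkSmooth v hv))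
  rwa [boxL_apply] at this

lemma Zop_eqOn {v w : Fn} {U : Set Pt} (hU : IsOpen U) (h : EqOn v w U) (i : Fin 7) :
    EqOn (Zop i v) (Zop i w) U := by
  intro p hp
  rw [Zop_eq, Zop_eq, Filter.EventuallyEq.fderiv_eq]
  exact Filter.eventuallyEq_of_mem (hU.mem_nhds hp) h

lemma Zw_eqOn {v w : Fn} {U : Set Pt} (hU : IsOpen U) (h : EqOn v w U) (l : List (Fin 7)) :
    EqOn (Zw l v) (Zw l w) U := by
  induction l with
  | nil => exact h
  | cons i l ih => exact Zop_eqOn hU ih i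

lemma pd_eqOn {v w : Fn} {U : Set Pt} (hU : IsOpen U) (h : EqOn v w U) (α : Fin 4) :
    EqOn (pd α v) (pd α w) U := by
  intro p hp
  rw [pd_eq, pd_eq, Filter.EventuallyEq.fderiv_eq]
  exact Filter.eventuallyEq_of_mem (hU.mem_nhds hp) h

/-- The linear relations expressing the null condition for unit speed. -/
def NullRel (H : Fin 4 → Fin 4 → ℝ) : Prop :=
  (H 0 0 + H 1 1 = 0 ∧ H 0 0 + H 2 2 = 0 ∧ H 0 0 + H 3 3 = 0) ∧
  (H 0 1 + H 1 0 = 0 ∧ H 0 2 + H 2 0 = 0 ∧ H 0 3 + H 3 0 = 0) ∧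
  (H 1 2 + H 2 1 = 0 ∧ H 1 3 + H 3 1 = 0 ∧ H 2 3 + H 3 2 = 0)

lemma nullCond_one_iff (H : Fin 4 → Fin 4 → ℝ) : nullCond 1 H ↔ NullRel H := by
  constructor
  · intro h
    have e (a b c d : ℝ) (hx : a ^ 2 = b ^ 2 + c ^ 2 + d ^ 2) := h ![a, b, c, d] (by simpa using hx)
    simp only [Fin.sum_univ_four, Matrix.cons_val] at e
    have a1 := e 1 1 0 0 (by norm_num)
    have a2 := e 1 (-1) 0 0 (by norm_num)
    have b1 := e 1 0 1 0 (by norm_num)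
    have b2 := e 1 0 (-1) 0 (by norm_num)
    have c1 := e 1 0 0 1 (by norm_num)
    have c2 := e 1 0 0 (-1) (by norm_num)
    have d1 := e 5 3 4 0 (by norm_num)
    have d2 := e 5 3 0 4 (by norm_num)
    have d3 := e 5 0 3 4 (by norm_num)
    refine ⟨⟨?_, ?_, ?_⟩, ⟨?_, ?_, ?_⟩, ⟨?_, ?_, ?_⟩⟩ <;> linarith
  · rintro ⟨⟨h1, h2, h3⟩, ⟨h4, h5, h6⟩, ⟨h7, h8, h9⟩⟩ X hX
    simp only [Fin.sum_univ_four]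
    linear_combination H 0 0 * hX + X 1 ^ 2 * h1 + X 2 ^ 2 * h2 + X 3 ^ 2 * h3 +
      X 0 * X 1 * h4 + X 0 * X 2 * h5 + X 0 * X 3 * h6 + X 1 * X 2 * h7 + X 1 * X 3 * h8 +
      X 2 * X 3 * h9

/-- The commutator correction of a bilinear form with a generator. -/
def formComm (i : Fin 7) (H : Fin 4 → Fin 4 → ℝ) : Fin 4 → Fin 4 → ℝ := fun α β =>
  -∑ γ, (H γ β * xc α ((zField i).1 (eb γ)) + H α γ * xc β ((zField i).1 (eb γ)))

lemma nullCond_formComm (i : Fin 7) {H : Fin 4 → Fin 4 → ℝ} (h : nullCond 1 H) :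
    nullCond 1 (formComm i H) := by
  rw [nullCond_one_iff] at h ⊢
  obtain ⟨⟨h1, h2, h3⟩, ⟨h4, h5, h6⟩, ⟨h7, h8, h9⟩⟩ := h
  fin_cases i <;>
    simp [NullRel, formComm, zField, trField_apply, rotField_apply, dilField_apply, xc_eb,
      Fin.sum_univ_four]
  all_goals constructorm* _ ∧ _ <;> linarith

lemma Zop_mul {f g : Fn} (hf : ContDiff ℝ (⊤ : ℕ∞) f) (hg : ContDiff ℝ (⊤ : ℕ∞) g) (i : Fin 7)
    (p : Pt) : Zop i (fun q => f q * g q) p = Zop i f p * g p + f p * Zop i g p := by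
  have h1 : HasFDerivAt f _ p := (hf.differentiable (by simp) p).hasFDerivAt
  have h2 : HasFDerivAt g _ p := (hg.differentiable (by simp) p).hasFDerivAt
  rw [Zop_eq, Zop_eq, Zop_eq, (h1.fun_mul h2).fderiv]
  simp
  ring

lemma Zop_const_mul {f : Fn} (hf : ContDiff ℝ (⊤ : ℕ∞) f) (c : ℝ) (i : Fin 7)
    (p : Pt) : Zop i (fun q => c * f q) p = c * Zop i f p := by
  have h1 : HasFDerivAt f _ p := (hf.differentiable (by simp) p).hasFDerivAt
  rw [Zop_eq, Zop_eq, (h1.const_mul c).fderiv]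
  simp

lemma Zop_finset_sum {κ : Type*} (s : Finset κ) {f : κ → Fn}
    (hf : ∀ k ∈ s, ContDiff ℝ (⊤ : ℕ∞) (f k)) (i : Fin 7) (p : Pt) :
    Zop i (fun q => ∑ k ∈ s, f k q) p = ∑ k ∈ s, Zop i (f k) p := by
  have h1 : HasFDerivAt (fun q => ∑ k ∈ s, f k q) (∑ k ∈ s, fderiv ℝ (f k) p) p :=
    HasFDerivAt.fun_sum fun k hk => ((hf k hk).differentiable (by simp) p).hasFDerivAt
  rw [Zop_eq, h1.fderiv]
  simp only [sum_apply, Zop_eq]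

lemma Zop_add {f g : Fn} (hf : ContDiff ℝ (⊤ : ℕ∞) f) (hg : ContDiff ℝ (⊤ : ℕ∞) g) (i : Fin 7)
    (p : Pt) : Zop i (fun q => f q + g q) p = Zop i f p + Zop i g p := by
  have h1 : HasFDerivAt f _ p := (hf.differentiable (by simp) p).hasFDerivAt
  have h2 : HasFDerivAt g _ p := (hg.differentiable (by simp) p).hasFDerivAt
  rw [Zop_eq, Zop_eq, Zop_eq, (h1.fun_add h2).fderiv]
  simp

lemma contDiff_nullQ (H : Fin 4 → Fin 4 → ℝ) {v w : Fn} (hv : ContDiff ℝ (⊤ : ℕ∞) v)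
    (hw : ContDiff ℝ (⊤ : ℕ∞) w) : ContDiff ℝ (⊤ : ℕ∞) (nullQ H v w) :=
  ContDiff.sum fun α _ => ContDiff.sum fun β _ =>
    (contDiff_const.mul (contDiff_pd hv α)).mul (contDiff_pd hw β)

lemma Zop_nullQ (H : Fin 4 → Fin 4 → ℝ) {v w : Fn} (hv : ContDiff ℝ (⊤ : ℕ∞) v)
    (hw : ContDiff ℝ (⊤ : ℕ∞) w) (i : Fin 7) (p : Pt) :
    Zop i (nullQ H v w) p =
      nullQ H (Zop i v) w p + nullQ H v (Zop i w) p + nullQ (formComm i H) v w p := by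
  have h1 : Zop i (nullQ H v w) p = ∑ α, ∑ β, (H α β * Zop i (pd α v) p * pd β w p +
      H α β * pd α v p * Zop i (pd β w) p) := by
    unfold nullQ
    rw [Zop_finset_sum _ fun α _ => ContDiff.sum fun β _ =>
      (contDiff_const.mul (contDiff_pd hv α)).mul (contDiff_pd hw β)]
    refine Finset.sum_congr rfl fun α _ => ?_
    rw [Zop_finset_sum _ fun β _ =>
      (contDiff_const.mul (contDiff_pd hv α)).mul (contDiff_pd hw β)]
    refine Finset.sum_congr rfl fun β _ => ?_
    rw [Zop_mul (contDiff_const.mul (contDiff_pd hv α)) (contDiff_pd hw β),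
      Zop_const_mul (contDiff_pd hv α)]
  rw [h1]
  simp only [Zop_pd hv, Zop_pd hw, nullQ, formComm, Fin.sum_univ_four]
  ring

lemma exists_Zw_nullQ (H : Fin 4 → Fin 4 → ℝ) (l : List (Fin 7)) :
    ∃ L : List ((Fin 4 → Fin 4 → ℝ) × List (Fin 7) × List (Fin 7)),
      (∀ T ∈ L, (nullCond 1 H → nullCond 1 T.1) ∧ T.2.1.length + T.2.2.length ≤ l.length) ∧
      ∀ v w : Fn, ContDiff ℝ (⊤ : ℕ∞) v → ContDiff ℝ (⊤ : ℕ∞) w → ∀ p,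
        Zw l (nullQ H v w) p = (L.map fun T => nullQ T.1 (Zw T.2.1 v) (Zw T.2.2 w) p).sum := by
  induction l with
  | nil => exact ⟨[(H, [], [])], by simp, fun v w _ _ p => by simp [Zw]⟩
  | cons i l ih =>
    obtain ⟨L, h1, h2⟩ := ih
    refine ⟨L.flatMap fun T => [(T.1, i :: T.2.1, T.2.2), (T.1, T.2.1, i :: T.2.2),
      (formComm i T.1, T.2.1, T.2.2)], ?_, ?_⟩
    · intro T hT
      obtain ⟨S, hS, hT⟩ := List.mem_flatMap.1 hT
      obtain ⟨h3, h4⟩ := h1 S hS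
      simp only [List.mem_cons, List.not_mem_nil, or_false] at hT
      rcases hT with rfl | rfl | rfl
      · exact ⟨h3, by simp; omega⟩
      · exact ⟨h3, by simp; omega⟩
      · exact ⟨fun h => nullCond_formComm i (h3 h), by simp; omega⟩
    · intro v w hv hw p
      have h3 : Zw l (nullQ H v w) =
          fun p => (L.map fun T => nullQ T.1 (Zw T.2.1 v) (Zw T.2.2 w) p).sum :=
        funext fun p => h2 v w hv hw p
      rw [Zw_cons, h3]
      clear h1 h2 h3
      have h4 : ∀ L : List ((Fin 4 → Fin 4 → ℝ) × List (Fin 7) × List (Fin 7)),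
          ContDiff ℝ (⊤ : ℕ∞)
            (fun p => (L.map fun T => nullQ T.1 (Zw T.2.1 v) (Zw T.2.2 w) p).sum) := by
        intro L
        induction L with
        | nil => exact contDiff_const
        | cons T L ih =>
          simp only [List.map_cons, List.sum_cons]
          exact (contDiff_nullQ T.1 (contDiff_Zw hv _) (contDiff_Zw hw _)).add ih
      induction L with
      | nil =>
        simp [Zop_eq]
      | cons T L ih =>
        simp only [List.map_cons, List.sum_cons, List.flatMap_cons, List.map_append,
          List.sum_append, ← ih, List.map_nil, List.sum_nil]
        rw [Zop_add (contDiff_nullQ T.1 (contDiff_Zw hv _) (contDiff_Zw hw _)) (h4 L),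
          Zop_nullQ T.1 (contDiff_Zw hv _) (contDiff_Zw hw _)]
        simp only [Zw_cons]
        ring

/-- All monomials have degree at least `k`. -/
def OrdGE (k : ℕ) (P : MvPolynomial (Fin 3 × Fin 4) ℝ) : Prop :=
  ∀ m ∈ P.support, k ≤ m.sum fun _ e => e

lemma OrdGE.pderiv {k : ℕ} {P : MvPolynomial (Fin 3 × Fin 4) ℝ} (h : OrdGE (k + 1) P)
    (q : Fin 3 × Fin 4) : OrdGE k (MvPolynomial.pderiv q P) := by
  intro m hm
  rw [MvPolynomial.mem_support_iff, MvPolynomial.coeff_pderiv] at hm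
  have h1 := h (m + Finsupp.single q 1) (MvPolynomial.mem_support_iff.2 (left_ne_zero_of_mul hm))
  rw [Finsupp.sum_add_index' (fun _ => rfl) (fun _ _ _ => rfl), Finsupp.sum_single_index rfl] at h1
  omega

lemma OrdGE.abs_eval_le {k : ℕ} {P : MvPolynomial (Fin 3 × Fin 4) ℝ} (h : OrdGE k P)
    {y : Fin 3 × Fin 4 → ℝ} {Y : ℝ} (hy : ∀ q, |y q| ≤ Y) (hY0 : 0 ≤ Y) (hY : Y ≤ 1) :
    |MvPolynomial.eval y P| ≤ (∑ m ∈ P.support, |P.coeff m|) * Y ^ k := by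
  rw [MvPolynomial.eval_eq, Finset.sum_mul]
  refine (Finset.abs_sum_le_sum_abs _ _).trans (Finset.sum_le_sum fun m hm => ?_)
  rw [abs_mul, Finset.abs_prod]
  refine mul_le_mul_of_nonneg_left ?_ (abs_nonneg _)
  calc ∏ q ∈ m.support, |y q ^ m q| ≤ ∏ q ∈ m.support, Y ^ m q := by
        refine Finset.prod_le_prod (fun _ _ => abs_nonneg _) fun q _ => ?_
        rw [abs_pow]
        exact pow_le_pow_left₀ (abs_nonneg _) (hy q) _
    _ = Y ^ (m.sum fun _ e => e) := by rw [Finset.prod_pow_eq_pow_sum]; rfl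
    _ ≤ Y ^ k := pow_le_pow_of_le_one hY0 hY (h m hm)

lemma contDiff_cubicEval (P : MvPolynomial (Fin 3 × Fin 4) ℝ) {u : Fin 3 → Fn}
    (hu : ∀ i, ContDiff ℝ (⊤ : ℕ∞) (u i)) : ContDiff ℝ (⊤ : ℕ∞) (cubicEval P u) := by
  unfold cubicEval
  induction P using MvPolynomial.induction_on with
  | C a => simpa using contDiff_const
  | add p q hp hq => simpa using hp.add hq
  | mul_X p q hp => simpa using hp.mul (contDiff_pd (hu q.1) q.2)

lemma Zop_cubicEval (P : MvPolynomial (Fin 3 × Fin 4) ℝ) {u : Fin 3 → Fn}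
    (hu : ∀ i, ContDiff ℝ (⊤ : ℕ∞) (u i)) (i : Fin 7) (p : Pt) :
    Zop i (cubicEval P u) p =
      ∑ q, cubicEval (MvPolynomial.pderiv q P) u p * Zop i (pd q.2 (u q.1)) p := by
  induction P using MvPolynomial.induction_on with
  | C a =>
    have h : cubicEval (MvPolynomial.C a) u = fun _ => a := by
      funext p
      simp [cubicEval]
    rw [h, Zop_eq]
    simp [cubicEval]
  | add P Q hP hQ =>
    have h : cubicEval (P + Q) u = fun p => cubicEval P u p + cubicEval Q u p := by
      funext p
      simp [cubicEval]
    rw [h, Zop_add (contDiff_cubicEval P hu) (contDiff_cubicEval Q hu), hP, hQ,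
      ← Finset.sum_add_distrib]
    refine Finset.sum_congr rfl fun q _ => ?_
    simp [cubicEval, add_mul]
  | mul_X P r hP =>
    have h : cubicEval (P * MvPolynomial.X r) u =
        fun p => cubicEval P u p * pd r.2 (u r.1) p := by
      funext p
      simp [cubicEval]
    rw [h, Zop_mul (contDiff_cubicEval P hu) (contDiff_pd (hu r.1) r.2), hP, Finset.sum_mul]
    have h2 : ∀ q, cubicEval (MvPolynomial.pderiv q (P * MvPolynomial.X r)) u p =
        cubicEval (MvPolynomial.pderiv q P) u p * pd r.2 (u r.1) p +
          if r = q then cubicEval P u p else 0 := by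
      intro q
      by_cases hq : r = q
      · subst hq
        simp [cubicEval]
        ring
      · simp [cubicEval, MvPolynomial.pderiv_X, hq]
        ring
    simp only [h2, add_mul, Finset.sum_add_distrib, ite_mul, zero_mul, Finset.sum_ite_eq,
      Finset.mem_univ, if_true]
    congr 1
    refine Finset.sum_congr rfl fun q _ => ?_
    ring

/-- The pointwise size of the derivatives of words of bounded length. -/
def gradSize (k : ℕ) (u : Fin 3 → Fn) (p : Pt) : ℝ :=
  ∑ j, ∑ q ∈ Finset.univ ×ˢ W k, |pd q.1 (Zw q.2 (u j)) p|

lemma gradSize_nonneg (k : ℕ) (u : Fin 3 → Fn) (p : Pt) : 0 ≤ gradSize k u p :=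
  Finset.sum_nonneg fun _ _ => Finset.sum_nonneg fun _ _ => abs_nonneg _

lemma gradSize_mono {k m : ℕ} (h : k ≤ m) (u : Fin 3 → Fn) (p : Pt) :
    gradSize k u p ≤ gradSize m u p := by
  refine Finset.sum_le_sum fun j _ => Finset.sum_le_sum_of_subset_of_nonneg ?_
    fun _ _ _ => abs_nonneg _
  exact Finset.product_subset_product_right fun l hl => mem_W.2 ((mem_W.1 hl).trans h)

lemma abs_pd_le_gradSize (u : Fin 3 → Fn) (p : Pt) (j : Fin 3) (α : Fin 4) :
    |pd α (u j) p| ≤ gradSize 0 u p := by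
  refine le_trans ?_ (Finset.single_le_sum (f := fun j => ∑ q ∈ Finset.univ ×ˢ W 0,
    |pd q.1 (Zw q.2 (u j)) p|) (fun _ _ => Finset.sum_nonneg fun _ _ => abs_nonneg _)
    (Finset.mem_univ j))
  have h0 : ([] : List (Fin 7)) ∈ W 0 := mem_W.2 le_rfl
  have h : (α, []) ∈ (Finset.univ : Finset (Fin 4)) ×ˢ W 0 :=
    Finset.mem_product.2 ⟨Finset.mem_univ α, h0⟩
  exact Finset.single_le_sum (f := fun q : Fin 4 × List (Fin 7) => |pd q.1 (Zw q.2 (u j)) p|)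
    (fun _ _ => abs_nonneg _) h

lemma exists_abs_Zw_pd_le_gradSize (n : ℕ) : ∃ C : ℝ, 0 ≤ C ∧ ∀ l ∈ W n, ∀ u : Fin 3 → Fn,
    (∀ i, ContDiff ℝ (⊤ : ℕ∞) (u i)) → ∀ j α p, |Zw l (pd α (u j)) p| ≤ C * gradSize n u p := by
  obtain ⟨C, hC, h⟩ := exists_abs_Zw_pd_le n
  refine ⟨C, hC, fun l hl u hu j α p => (h l hl (u j) (hu j) α p).trans
    (mul_le_mul_of_nonneg_left ?_ hC)⟩
  exact Finset.single_le_sum (f := fun j => ∑ q ∈ Finset.univ ×ˢ W n,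
    |pd q.1 (Zw q.2 (u j)) p|) (fun _ _ => Finset.sum_nonneg fun _ _ => abs_nonneg _)
    (Finset.mem_univ j)

lemma OrdGE.exists_abs_cubicEval_le {k : ℕ} {P : MvPolynomial (Fin 3 × Fin 4) ℝ} (h : OrdGE k P) :
    ∃ C : ℝ, 0 ≤ C ∧ ∀ (u : Fin 3 → Fn) (p : Pt), gradSize 0 u p ≤ 1 →
      |cubicEval P u p| ≤ C * gradSize 0 u p ^ k :=
  ⟨_, Finset.sum_nonneg fun _ _ => abs_nonneg _, fun u p hp =>
    h.abs_eval_le (fun q => abs_pd_le_gradSize u p q.1 q.2) (gradSize_nonneg 0 u p) hp⟩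

lemma CubicLike.exists_abs_Zw_le {P : MvPolynomial (Fin 3 × Fin 4) ℝ} (hP : CubicLike P)
    {m : ℕ} (hm : m = 1 ∨ m = 2) {l : List (Fin 7)} (hl : l.length ≤ m) :
    ∃ C : ℝ, 0 ≤ C ∧ ∀ u : Fin 3 → Fn, (∀ i, ContDiff ℝ (⊤ : ℕ∞) (u i)) → ∀ p,
      gradSize 0 u p ≤ 1 → |Zw l (cubicEval P u) p| ≤
        C * (gradSize m u p * gradSize 1 u p * gradSize 1 u p) := by
  have hP3 : OrdGE 3 P := hP
  obtain ⟨A, hA, hA'⟩ := exists_abs_Zw_pd_le_gradSize 1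
  obtain ⟨B, hB, hB'⟩ := exists_abs_Zw_pd_le_gradSize 2
  obtain ⟨C0, hC0, h0⟩ := hP3.exists_abs_cubicEval_le
  obtain ⟨C1, hC1, h1⟩ := exists_uniform_of_finset Finset.univ (P := fun q C =>
    ∀ (u : Fin 3 → Fn) (p : Pt), gradSize 0 u p ≤ 1 →
      |cubicEval (MvPolynomial.pderiv q P) u p| ≤ C * gradSize 0 u p ^ 2)
    (fun q c d hcd h u p hp => (h u p hp).trans
      (mul_le_mul_of_nonneg_right hcd (pow_nonneg (gradSize_nonneg 0 u p) _)))
    (fun q _ => (hP3.pderiv q).exists_abs_cubicEval_le)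
  obtain ⟨C2, hC2, h2⟩ := exists_uniform_of_finset Finset.univ
    (P := fun (q : (Fin 3 × Fin 4) × (Fin 3 × Fin 4)) C =>
    ∀ (u : Fin 3 → Fn) (p : Pt), gradSize 0 u p ≤ 1 →
      |cubicEval (MvPolynomial.pderiv q.2 (MvPolynomial.pderiv q.1 P)) u p| ≤
        C * gradSize 0 u p ^ 1)
    (fun q c d hcd h u p hp => (h u p hp).trans
      (mul_le_mul_of_nonneg_right hcd (pow_nonneg (gradSize_nonneg 0 u p) _)))
    (fun q _ => ((hP3.pderiv q.1).pderiv q.2).exists_abs_cubicEval_le)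
  rcases l with _ | ⟨i, _ | ⟨j, _ | ⟨k, l⟩⟩⟩
  · refine ⟨C0, hC0, fun u hu p hp => (h0 u p hp).trans (mul_le_mul_of_nonneg_left ?_ hC0)⟩
    have e0 := gradSize_nonneg 0 u p
    have e1 := gradSize_mono (Nat.zero_le 1) u p
    have em := gradSize_mono (Nat.zero_le m) u p
    have e1' := gradSize_nonneg 1 u p
    have em' := gradSize_nonneg m u p
    calc gradSize 0 u p ^ 3 = gradSize 0 u p * gradSize 0 u p * gradSize 0 u p := by ring
      _ ≤ _ := by gcongr
  · refine ⟨∑ q : Fin 3 × Fin 4, C1 * A, Finset.sum_nonneg fun _ _ => mul_nonneg hC1 hA,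
      fun u hu p hp => ?_⟩
    have e0 := gradSize_nonneg 0 u p
    have e1' := gradSize_nonneg 1 u p
    have e1 := gradSize_mono (Nat.zero_le 1) u p
    have em := gradSize_mono (show 1 ≤ m by omega) u p
    have em' := gradSize_nonneg m u p
    show |Zop i (cubicEval P u) p| ≤ _
    rw [Zop_cubicEval P hu, Finset.sum_mul]
    refine (Finset.abs_sum_le_sum_abs _ _).trans (Finset.sum_le_sum fun q _ => ?_)
    rw [abs_mul]
    calc _ ≤ (C1 * gradSize 0 u p ^ 2) * (A * gradSize 1 u p) :=
          mul_le_mul (h1 q (Finset.mem_univ _) u p hp)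
            (hA' [i] (mem_W.2 le_rfl) u hu q.1 q.2 p) (abs_nonneg _) (by positivity)
      _ = C1 * A * (gradSize 1 u p * gradSize 0 u p * gradSize 0 u p) := by ring
      _ ≤ _ := by gcongr
  · have hm2 : m = 2 := by simp at hl; omega
    subst hm2
    refine ⟨∑ q : Fin 3 × Fin 4, (∑ r : Fin 3 × Fin 4, C2 * A * A + C1 * B),
      Finset.sum_nonneg fun _ _ => add_nonneg (Finset.sum_nonneg fun _ _ => by positivity)
        (by positivity), fun u hu p hp => ?_⟩
    have e0 := gradSize_nonneg 0 u p
    have e1' := gradSize_nonneg 1 u p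
    have e2' := gradSize_nonneg 2 u p
    have e1 := gradSize_mono (Nat.zero_le 1) u p
    have e2 := gradSize_mono (show 0 ≤ 2 by omega) u p
    have hj : Zop j (cubicEval P u) = fun p => ∑ q, cubicEval (MvPolynomial.pderiv q P) u p *
        Zop j (pd q.2 (u q.1)) p := funext fun p => Zop_cubicEval P hu j p
    have hs : ∀ q : Fin 3 × Fin 4, ContDiff ℝ (⊤ : ℕ∞) (Zop j (pd q.2 (u q.1))) :=
      fun q => contDiff_Zop (contDiff_pd (hu _) _) j
    show |Zop i (Zop j (cubicEval P u)) p| ≤ _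
    rw [hj, Zop_finset_sum _ fun q _ => (contDiff_cubicEval _ hu).mul (hs q), Finset.sum_mul]
    refine (Finset.abs_sum_le_sum_abs _ _).trans (Finset.sum_le_sum fun q _ => ?_)
    rw [Zop_mul (contDiff_cubicEval _ hu) (hs q), add_mul]
    refine (abs_add_le _ _).trans (add_le_add ?_ ?_)
    · rw [Zop_cubicEval _ hu, Finset.sum_mul, Finset.sum_mul]
      refine (Finset.abs_sum_le_sum_abs _ _).trans (Finset.sum_le_sum fun r _ => ?_)
      rw [abs_mul, abs_mul]
      calc _ ≤ (C2 * gradSize 0 u p ^ 1) * (A * gradSize 1 u p) * (A * gradSize 1 u p) := by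
            gcongr
            · exact h2 (q, r) (Finset.mem_univ _) u p hp
            · exact hA' [i] (mem_W.2 le_rfl) u hu r.1 r.2 p
            · exact hA' [j] (mem_W.2 le_rfl) u hu q.1 q.2 p
        _ = C2 * A * A * (gradSize 0 u p * gradSize 1 u p * gradSize 1 u p) := by ring
        _ ≤ _ := by gcongr
    · rw [abs_mul]
      calc _ ≤ (C1 * gradSize 0 u p ^ 2) * (B * gradSize 2 u p) :=
            mul_le_mul (h1 q (Finset.mem_univ _) u p hp)
              (hB' [i, j] (mem_W.2 le_rfl) u hu q.1 q.2 p) (abs_nonneg _) (by positivity)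
        _ = C1 * B * (gradSize 2 u p * gradSize 0 u p * gradSize 0 u p) := by ring
        _ ≤ _ := by gcongr
  · simp at hl
    omega

/-- Smooth fields vanishing for times in `(0, T)` outside the ball of radius `ρ`. -/
def Adm (ρ T : ℝ) (v : Fn) : Prop :=
  ContDiff ℝ (⊤ : ℕ∞) v ∧ EqOn v 0 (Ioo 0 T ×ˢ {x | ρ < ‖x‖})

lemma isOpen_exterior (ρ T : ℝ) : IsOpen (Ioo (0 : ℝ) T ×ˢ {x : Sp | ρ < ‖x‖}) :=
  isOpen_Ioo.prod (isOpen_lt continuous_const continuous_norm)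

lemma Zop_zero (i : Fin 7) : Zop i 0 = 0 := by
  ext p
  rw [Zop_eq]
  simp

lemma pd_zero (α : Fin 4) : pd α 0 = 0 := by
  ext p
  rw [pd_eq]
  simp

lemma Adm.Zop {ρ T : ℝ} {v : Fn} (h : Adm ρ T v) (i : Fin 7) : Adm ρ T (Zop i v) :=
  ⟨contDiff_Zop h.1 i, by simpa only [Zop_zero] using Zop_eqOn (isOpen_exterior ρ T) h.2 i⟩

lemma Adm.pd {ρ T : ℝ} {v : Fn} (h : Adm ρ T v) (α : Fin 4) : Adm ρ T (pd α v) :=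
  ⟨contDiff_pd h.1 α, by simpa only [pd_zero] using pd_eqOn (isOpen_exterior ρ T) h.2 α⟩

lemma Adm.Zw {ρ T : ℝ} {v : Fn} (h : Adm ρ T v) (l : List (Fin 7)) : Adm ρ T (Zw l v) := by
  induction l with
  | nil => exact h
  | cons i l ih => exact ih.Zop i

lemma boxOp_eq (c : ℝ) (v : Fn) (p : Pt) :
    boxOp c v p = pd 0 (pd 0 v) p - c ^ 2 * ∑ j : Fin 3, pd j.succ (pd j.succ v) p := rfl

lemma Adm.boxOp {ρ T : ℝ} {v : Fn} (h : Adm ρ T v) (c : ℝ) : Adm ρ T (boxOp c v) := by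
  refine ⟨contDiff_boxOp h.1 c, fun p hp => ?_⟩
  have h2 (α : Fin 4) : MultiSpeedWave.pd α (MultiSpeedWave.pd α v) p = 0 :=
    ((h.pd α).pd α).2 hp
  simp [boxOp_eq, h2]

lemma contDiff_slice {v : Fn} (hv : ContDiff ℝ (⊤ : ℕ∞) v) (t : ℝ) :
    ContDiff ℝ (⊤ : ℕ∞) fun x => v (t, x) :=
  hv.comp (contDiff_const.prodMk contDiff_id)

lemma Adm.cc {ρ T : ℝ} {v : Fn} (h : Adm ρ T v) {t : ℝ} (ht : t ∈ Ioo 0 T) :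
    CC fun x => v (t, x) := by
  refine ⟨(contDiff_slice h.1 t).continuous,
    HasCompactSupport.intro (isCompact_closedBall (0 : Sp) ρ) fun x hx => ?_⟩
  exact h.2 ⟨ht, by simpa using hx⟩

lemma fderiv_slice {v : Fn} (hv : ContDiff ℝ (⊤ : ℕ∞) v) (t : ℝ) (x h : Sp) :
    fderiv ℝ (fun x => v (t, x)) x h = fderiv ℝ v (t, x) (0, h) := by
  have h1 : HasFDerivAt (fun x : Sp => (t, x)) (ContinuousLinearMap.inr ℝ ℝ Sp) x := by
    exact (hasFDerivAt_const t x).prodMk (hasFDerivAt_id x)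
  have h2 := (hv.differentiable (by simp) (t, x)).hasFDerivAt.comp x h1
  rw [show (fun x => v (t, x)) = v ∘ fun x => (t, x) from rfl, h2.fderiv]
  simp

lemma dxj_slice {v : Fn} (hv : ContDiff ℝ (⊤ : ℕ∞) v) (t : ℝ) (j : Fin 3) :
    dxj j (fun x => v (t, x)) = fun x => pd j.succ v (t, x) := by
  ext x
  rw [dxj, fderiv_slice hv]
  rfl

lemma fderiv_apply_eq_sum (f : Sp → ℝ) (x h : Sp) :
    fderiv ℝ f x h = ∑ j, h j * dxj j f x := by
  have : h = ∑ j, h j • EuclideanSpace.single j (1 : ℝ) := by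
    ext i
    simp [Finset.sum_apply, Pi.single_apply]
  conv_lhs => rw [this]
  simp [dxj]

lemma norm_fderiv_sq_le (f : Sp → ℝ) (x : Sp) : ‖fderiv ℝ f x‖ ^ 2 ≤ ∑ j, dxj j f x ^ 2 := by
  have h0 : (0 : ℝ) ≤ ∑ j, dxj j f x ^ 2 := by positivity
  have : ‖fderiv ℝ f x‖ ≤ Real.sqrt (∑ j, dxj j f x ^ 2) := by
    refine ContinuousLinearMap.opNorm_le_bound _ (Real.sqrt_nonneg _) fun h => ?_
    rw [fderiv_apply_eq_sum, Real.norm_eq_abs]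
    refine Real.abs_le_sqrt ?_ |>.trans_eq (Real.sqrt_mul h0 _ |>.trans (by
      rw [Real.sqrt_sq (norm_nonneg h)]))
    rw [norm_sq_eq_sum3]
    have := Finset.sum_mul_sq_le_sq_mul_sq Finset.univ (fun j => h j) fun j => dxj j f x
    simp only [Fin.sum_univ_three] at this ⊢
    linarith
  calc _ ≤ Real.sqrt (∑ j, dxj j f x ^ 2) ^ 2 := by gcongr
    _ = _ := Real.sq_sqrt h0

lemma CC_dxj {f : Sp → ℝ} (hf : ContDiff ℝ 1 f) (hs : HasCompactSupport f) (j : Fin 3) :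
    CC (dxj j f) := by
  refine ⟨(hf.continuous_fderiv (by norm_num)).clm_apply continuous_const, ?_⟩
  refine (hs.fderiv ℝ).mono fun x hx => ?_
  contrapose! hx
  simp only [Function.mem_support, not_not] at hx
  simp [dxj, hx]

lemma sum_sq_le_sq_sum3 (a b c : ℝ) (ha : 0 ≤ a) (hb : 0 ≤ b) (hc : 0 ≤ c) :
    a ^ 2 + b ^ 2 + c ^ 2 ≤ (a + b + c) ^ 2 := by nlinarith [mul_nonneg ha hb, mul_nonneg ha hc, mul_nonneg hb hc]

lemma integral_norm_fderiv_sq_le {f : Sp → ℝ} (hf : ContDiff ℝ 1 f) (hs : HasCompactSupport f) :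
    ∫ x, ‖fderiv ℝ f x‖ ^ 2 ≤ (∑ j, L2 (dxj j f)) ^ 2 := by
  have hd : CC fun x => ‖fderiv ℝ f x‖ :=
    ⟨(hf.continuous_fderiv (by norm_num)).norm, (hs.fderiv ℝ).norm⟩
  have hj (j : Fin 3) : CC fun x => dxj j f x ^ 2 := (CC_dxj hf hs j).pow two_ne_zero
  calc ∫ x, ‖fderiv ℝ f x‖ ^ 2 ≤ ∫ x, ∑ j, dxj j f x ^ 2 :=
        integral_mono (hd.pow two_ne_zero).integrable (CC.sum _ fun j _ => hj j).integrable
          fun x => norm_fderiv_sq_le f x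
    _ = ∑ j, L2 (dxj j f) ^ 2 := by
        rw [integral_finsetSum _ fun j _ => (hj j).integrable]
        simp only [L2_sq]
    _ ≤ _ := by
        simp only [Fin.sum_univ_three]
        exact sum_sq_le_sq_sum3 _ _ _ (L2_nonneg _) (L2_nonneg _) (L2_nonneg _)

/-- The rotational derivative `x_i ∂_j - x_j ∂_i` of a function of `x` only. -/
def rotD (i j : Fin 3) (f : Sp → ℝ) : Sp → ℝ := fun x => x i * dxj j f x - x j * dxj i f x

lemma CC_rotD {f : Sp → ℝ} (hf : ContDiff ℝ 1 f) (hs : HasCompactSupport f) (i j : Fin 3) :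
    CC (rotD i j f) := by
  have h (i j : Fin 3) : CC fun x => x i * dxj j f x :=
    (CC_dxj hf hs j).mul_left (by fun_prop)
  have e : rotD i j f = fun x => x i * dxj j f x + -(x j * dxj i f x) := by
    ext x
    rw [rotD, sub_eq_add_neg]
  rw [e]
  exact (h i j).add (h j i).neg

lemma sum_sq_le_sq_sum {ι : Type*} (s : Finset ι) {f : ι → ℝ} (h : ∀ i ∈ s, 0 ≤ f i) :
    ∑ i ∈ s, f i ^ 2 ≤ (∑ i ∈ s, f i) ^ 2 := by
  rw [sq, Finset.sum_mul]
  refine Finset.sum_le_sum fun i hi => ?_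
  rw [sq]
  exact mul_le_mul_of_nonneg_left (Finset.single_le_sum h hi) (h i hi)

lemma integral_rotSq_le {f : Sp → ℝ} (hf : ContDiff ℝ 1 f) (hs : HasCompactSupport f) :
    ∫ x, rotSq f x ≤ (L2 f + ∑ j, L2 (dxj j f) + ∑ i, ∑ j, L2 (rotD i j f)) ^ 2 := by
  have hd : CC fun x => ‖fderiv ℝ f x‖ :=
    ⟨(hf.continuous_fderiv (by norm_num)).norm, (hs.fderiv ℝ).norm⟩
  have hf0 : CC f := ⟨hf.continuous, hs⟩
  have hr (i j : Fin 3) : CC fun x => rotD i j f x ^ 2 := (CC_rotD hf hs i j).pow two_ne_zero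
  have hrot (i j : Fin 3) (x : Sp) : fderiv ℝ f x (rotVec i j x) = rotD i j f x := by
    simp only [rotVec, map_sub, map_smul, rotD, dxj, smul_eq_mul]
  have e : ∫ x, rotSq f x = (L2 f ^ 2 + ∫ x, ‖fderiv ℝ f x‖ ^ 2) +
      ∑ i, ∑ j, L2 (rotD i j f) ^ 2 := by
    simp only [rotSq, hrot, L2_sq]
    rw [CC.integral_add ((hf0.pow two_ne_zero).add (hd.pow two_ne_zero))
      (CC.sum _ fun i _ => CC.sum _ fun j _ => hr i j),
      CC.integral_add (hf0.pow two_ne_zero) (hd.pow two_ne_zero),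
      integral_finsetSum _ fun i _ => (CC.sum _ fun j _ => hr i j).integrable]
    congr 1
    exact Finset.sum_congr rfl fun i _ => integral_finsetSum _ fun j _ => (hr i j).integrable
  have h1 := integral_norm_fderiv_sq_le hf hs
  have h3 : ∑ i, ∑ j, L2 (rotD i j f) ^ 2 ≤ (∑ i, ∑ j, L2 (rotD i j f)) ^ 2 := by
    refine (Finset.sum_le_sum fun i _ => sum_sq_le_sq_sum _ fun j _ => L2_nonneg _).trans ?_
    exact sum_sq_le_sq_sum _ fun i _ => Finset.sum_nonneg fun j _ => L2_nonneg _
  have h4 := sum_sq_le_sq_sum3 (L2 f) (∑ j, L2 (dxj j f)) (∑ i, ∑ j, L2 (rotD i j f))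
    (L2_nonneg _) (Finset.sum_nonneg fun j _ => L2_nonneg _)
    (Finset.sum_nonneg fun i _ => Finset.sum_nonneg fun j _ => L2_nonneg _)
  linarith

lemma exists_Bd6_gradient : ∃ C : ℝ, 0 ≤ C ∧ ∀ f : Sp → ℝ, ContDiff ℝ 1 f →
    HasCompactSupport f → Bd6 (C * ∑ j, L2 (dxj j f)) f := by
  obtain ⟨C, hC, h⟩ := exists_integral_pow_six_le
  refine ⟨C + 1, by positivity, fun f hf hs => ⟨⟨hf.continuous, hs⟩, (h f hf hs).trans ?_⟩⟩
  have h1 := integral_norm_fderiv_sq_le hf hs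
  have h0 : 0 ≤ ∫ x, ‖fderiv ℝ f x‖ ^ 2 := integral_nonneg fun x => by positivity
  have h2 : C ≤ (C + 1) ^ 6 := by nlinarith [le_self_pow₀ (show 1 ≤ C + 1 by linarith) (show 6 ≠ 0 by norm_num)]
  calc C * (∫ x, ‖fderiv ℝ f x‖ ^ 2) ^ 3 ≤ (C + 1) ^ 6 * ((∑ j, L2 (dxj j f)) ^ 2) ^ 3 := by gcongr
    _ = _ := by ring

lemma exists_integral_weight_pow_six_le' : ∃ C : ℝ, 0 ≤ C ∧ ∀ f : Sp → ℝ, ContDiff ℝ 1 f →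
    HasCompactSupport f → ∫ x, (1 + ‖x‖ ^ 2) ^ 2 * f x ^ 6 ≤
      (C * (L2 f + ∑ j, L2 (dxj j f) + ∑ i, ∑ j, L2 (rotD i j f))) ^ 6 := by
  obtain ⟨C, hC, h⟩ := exists_integral_weight_pow_six_le
  refine ⟨C + 1, by positivity, fun f hf hs => (h f hf hs).trans ?_⟩
  have h1 := integral_rotSq_le hf hs
  have h0 : 0 ≤ ∫ x, rotSq f x := integral_nonneg fun x => rotSq_nonneg f x
  have h2 : C ≤ (C + 1) ^ 6 := by nlinarith [le_self_pow₀ (show 1 ≤ C + 1 by linarith) (show 6 ≠ 0 by norm_num)]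
  set S := L2 f + ∑ j, L2 (dxj j f) + ∑ i, ∑ j, L2 (rotD i j f)
  calc C * (∫ x, rotSq f x) ^ 3 ≤ (C + 1) ^ 6 * (S ^ 2) ^ 3 := by gcongr
    _ = _ := by ring

lemma L2_le_sum_add {ι : Type*} (s : Finset ι) {f h : Sp → ℝ} {c : ι → ℝ} {d : ℝ}
    {g : ι → Sp → ℝ} (hf : CC f) (hg : ∀ i ∈ s, CC (g i)) (hh : CC h) (hc : ∀ i ∈ s, 0 ≤ c i)
    (hd : 0 ≤ d) (H : ∀ x, |f x| ≤ ∑ i ∈ s, c i * |g i x| + d * |h x|) :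
    L2 f ≤ ∑ i ∈ s, c i * L2 (g i) + d * L2 h := by
  have := L2_le_sum (Finset.insertNone s) (f := f) (c := fun o => o.elim d c)
    (g := fun o => o.elim h g) hf (Finset.forall_mem_insertNone.2 ⟨hh, hg⟩)
    (Finset.forall_mem_insertNone.2 ⟨hd, hc⟩) fun x => by
      rw [Finset.sum_insertNone]
      simpa only [Option.elim, add_comm] using H x
  rw [Finset.sum_insertNone] at this
  simpa only [Option.elim, add_comm] using this

lemma abs_coord_le (x : Sp) (i : Fin 3) : |x i| ≤ ‖x‖ := by
  refine abs_le_of_sq_le_sq ?_ (norm_nonneg x)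
  rw [norm_sq_eq_sum3]
  fin_cases i <;> simp <;> nlinarith [sq_nonneg (x 0), sq_nonneg (x 1), sq_nonneg (x 2)]

lemma abs_le_of_cone_factor {c t r A E B K : ℝ} (hc : 0 < c) (ht : 0 ≤ t) (hr : 0 ≤ r)
    (hE : (c ^ 2 * t ^ 2 - r ^ 2) * A = E) (hB : 0 ≤ B) (hK : 0 ≤ K)
    (h : |E| ≤ K * ((c * t + r) * B)) : |c * t - r| * |A| ≤ K * B := by
  rcases eq_or_lt_of_le (show 0 ≤ c * t + r by positivity) with h0 | h0
  · have h1 : 0 ≤ c * t := by positivity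
    have : c * t - r = 0 := by linarith
    rw [this]
    simpa using mul_nonneg hK hB
  · have e : |E| = (c * t + r) * (|c * t - r| * |A|) := by
      conv_rhs => rw [← abs_of_pos h0, ← abs_mul, ← abs_mul]
      rw [← hE]
      ring_nf
    rw [e] at h
    refine le_of_mul_le_mul_left ?_ h0
    linarith

lemma abs_cone_mul_le {c : ℝ} (hc : 0 < c) : ∃ K : ℝ, 0 ≤ K ∧
    ∀ (t r a H : ℝ) (x b : Fin 3 → ℝ) (d : Fin 3 → Fin 3 → ℝ), 0 ≤ t → 0 ≤ r →
      (∀ i j, d i j = d j i) → r ^ 2 = x 0 ^ 2 + x 1 ^ 2 + x 2 ^ 2 → (∀ i, |x i| ≤ r) →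
      |t * a + ∑ j, x j * b j| ≤ H → (∀ j, |t * b j + ∑ i, x i * d i j| ≤ H) →
      (∀ i j, |x i * b j - x j * b i| ≤ H) → (∀ i j k, |x i * d j k - x j * d i k| ≤ H) →
      (∀ j, |c * t - r| * |b j| ≤ K * (H + t * |a - c ^ 2 * ∑ i, d i i|)) ∧
      |c * t - r| * |∑ i, d i i| ≤ K * (H + t * |a - c ^ 2 * ∑ i, d i i|) := by
  refine ⟨12 + 1 / c + 4 * c, by positivity, ?_⟩
  intro t r a H x b d ht hr hd hr2 hx h1 h2 h3 h4
  set q := a - c ^ 2 * ∑ i, d i i with hq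
  have hH : 0 ≤ H := (abs_nonneg _).trans h1
  have hB : 0 ≤ H + t * |q| := by positivity
  have hct : 0 ≤ c * t := by positivity
  have hc1 : t = 1 / c * (c * t) := by field_simp
  have hm : ∀ (i : Fin 3) (y B : ℝ), |y| ≤ B → |x i * y| ≤ r * B := fun i y B hy => by
    rw [abs_mul]
    exact mul_le_mul (hx i) hy (abs_nonneg _) hr
  have hsum3 : ∀ (g : Fin 3 → ℝ) (B : ℝ), (∀ i, |g i| ≤ B) → |∑ i, g i| ≤ 3 * B := fun g B hg => by
    refine (Finset.abs_sum_le_sum_abs _ _).trans ((Finset.sum_le_sum fun i _ => hg i).trans ?_)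
    simp
  have hq0 := abs_nonneg q
  constructor
  · intro j
    refine abs_le_of_cone_factor (E := c * ((c * t) * (t * b j + ∑ i, x i * d i j))
      - c * ((c * t) * ∑ i, (x i * d j i - x j * d i i))
      - ∑ i, x i * (x i * b j - x j * b i)
      - x j * (t * a + ∑ j, x j * b j) + t * (x j * q)) hc ht hr ?_ hB (by positivity) ?_
    · rw [hr2, hq]
      simp only [Fin.sum_univ_three, hd j]
      ring
    · have e1 := mul_le_mul_of_nonneg_left (h2 j) (by positivity : 0 ≤ c * (c * t))
      have e2 := mul_le_mul_of_nonneg_left (hsum3 _ _ fun i => h4 i j i)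
        (by positivity : 0 ≤ c * (c * t))
      have e3 := hsum3 _ _ fun i => hm i _ _ (h3 i j)
      have e4 := hm j _ _ h1
      have e5 := mul_le_mul_of_nonneg_left (hm j _ _ le_rfl : |x j * q| ≤ r * |q|) ht
      calc _ ≤ c * (c * t) * |t * b j + ∑ i, x i * d i j|
            + c * (c * t) * |∑ i, (x i * d j i - x j * d i i)|
            + |∑ i, x i * (x i * b j - x j * b i)| + |x j * (t * a + ∑ j, x j * b j)|
            + t * |x j * q| := by
            refine (abs_add_le _ _).trans (add_le_add ((abs_sub _ _).trans (add_le_add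
              ((abs_sub _ _).trans (add_le_add ((abs_sub _ _).trans (add_le_add ?_ ?_)) le_rfl))
              le_rfl)) ?_)
            · refine le_of_eq ?_
              rw [abs_mul, abs_mul, abs_of_pos hc, abs_of_nonneg hct]
              ring
            · refine le_of_eq ?_
              rw [abs_mul, abs_mul, abs_of_pos hc, abs_of_nonneg hct]
              ring
            · rw [abs_mul, abs_of_nonneg ht]
        _ ≤ 4 * c * ((c * t) * H) + 4 * (r * H) + r * (t * |q|) := by linarith
        _ ≤ _ := by
            have p1 : 0 ≤ c * t * H := by positivity
            have p2 : 0 ≤ r * H := by positivity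
            have p3 : 0 ≤ r * (t * |q|) := by positivity
            have p4 : 0 ≤ c * t * (t * |q|) := by positivity
            have p5 : 0 ≤ 1 / c * ((c * t + r) * (H + t * |q|)) := by positivity
            have p6 : 0 ≤ c * (r * H) := by positivity
            have p7 : 0 ≤ c * (r * (t * |q|)) := by positivity
            have p8 : 0 ≤ c * (c * t * (t * |q|)) := by positivity
            linarith
  · refine abs_le_of_cone_factor (E := t * (t * a + ∑ j, x j * b j)
      - ∑ j, x j * (t * b j + ∑ i, x i * d i j) - t * (t * q)
      - ∑ i, ∑ j, x i * (x i * d j j - x j * d i j)) hc ht hr ?_ hB (by positivity) ?_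
    · rw [hr2, hq]
      simp only [Fin.sum_univ_three]
      ring
    · have e1 := mul_le_mul_of_nonneg_left h1 ht
      have e2 := hsum3 _ _ fun j => hm j _ _ (h2 j)
      have e3 := hsum3 _ _ fun i => hsum3 _ _ fun j => hm i _ _ (h4 i j j)
      calc _ ≤ t * |t * a + ∑ j, x j * b j| + |∑ j, x j * (t * b j + ∑ i, x i * d i j)|
            + t * (t * |q|) + |∑ i, ∑ j, x i * (x i * d j j - x j * d i j)| := by
            refine (abs_sub _ _).trans (add_le_add ((abs_sub _ _).trans (add_le_add
              ((abs_sub _ _).trans (add_le_add ?_ le_rfl)) ?_)) le_rfl)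
            · rw [abs_mul, abs_of_nonneg ht]
            · rw [abs_mul, abs_mul, abs_of_nonneg ht]
        _ ≤ t * H + 12 * (r * H) + t * (t * |q|) := by linarith
        _ = 1 / c * (c * t * (H + t * |q|)) + 12 * (r * H) := by field_simp; ring
        _ ≤ _ := by
            have p1 : 0 ≤ c * t * H := by positivity
            have p3 : 0 ≤ r * (t * |q|) := by positivity
            have p4 : 0 ≤ c * t * (t * |q|) := by positivity
            have p5 : 0 ≤ 1 / c * (r * (H + t * |q|)) := by positivity
            have p6 : 0 ≤ c * ((c * t + r) * (H + t * |q|)) := by positivity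
            linarith

/-- The pointwise size of the first order derivatives of `Z^a v`, `|a| ≤ n`. -/
def derivSize (n : ℕ) (v : Fn) (p : Pt) : ℝ :=
  ∑ q ∈ Finset.univ ×ˢ W n, |pd q.1 (Zw q.2 v) p|

lemma derivSize_nonneg (n : ℕ) (v : Fn) (p : Pt) : 0 ≤ derivSize n v p :=
  Finset.sum_nonneg fun _ _ => abs_nonneg _

lemma sOp_eq (v : Fn) (p : Pt) :
    sOp v p = p.1 * pd 0 v p + ∑ j : Fin 3, p.2 j * pd j.succ v p := rfl

lemma om_eq (i j : Fin 3) (v : Fn) (p : Pt) :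
    om i j v p = p.2 i * pd j.succ v p - p.2 j * pd i.succ v p := rfl

lemma abs_om_le {v : Fn} {p : Pt} {B : ℝ} (hB : 0 ≤ B) (h : ∀ i, |Zop i v p| ≤ B) (i j : Fin 3) :
    |om i j v p| ≤ B := by
  have h3 : |om 0 1 v p| ≤ B := h 3
  have h4 : |om 1 2 v p| ≤ B := h 4
  have h5 : |om 0 2 v p| ≤ B := h 5
  have hs (i j : Fin 3) : |om i j v p| = |om j i v p| := by
    rw [om_eq, om_eq, abs_sub_comm]
  have h0 (i : Fin 3) : |om i i v p| ≤ B := by simpa [om_eq] using hB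
  fin_cases i <;> fin_cases j
  · exact h0 _
  · exact h3
  · exact h5
  · exact (hs _ _).trans_le h3
  · exact h0 _
  · exact h4
  · exact (hs _ _).trans_le h5
  · exact (hs _ _).trans_le h4
  · exact h0 _

lemma abs_px_le {v : Fn} {p : Pt} {B : ℝ} (h : ∀ i, |Zop i v p| ≤ B) (j : Fin 3) :
    |pd j.succ v p| ≤ B := by
  fin_cases j
  · exact h 0
  · exact h 1
  · exact h 2

lemma jb_sq (ρ : ℝ) : jb ρ ^ 2 = 1 + ρ ^ 2 := Real.sq_sqrt (by positivity)

lemma one_le_jb (ρ : ℝ) : 1 ≤ jb ρ := Real.one_le_sqrt.2 (by nlinarith [sq_nonneg ρ])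

lemma jb_pos (ρ : ℝ) : 0 < jb ρ := one_pos.trans_le (one_le_jb ρ)

lemma jb_le (ρ : ℝ) : jb ρ ≤ 1 + |ρ| := by
  refine abs_le_of_sq_le_sq' ?_ (by positivity) |>.2
  rw [jb_sq]
  nlinarith [abs_nonneg ρ, sq_abs ρ]

lemma abs_le_jb (ρ : ℝ) : |ρ| ≤ jb ρ := by
  refine abs_le_of_sq_le_sq' ?_ (jb_pos ρ).le |>.2
  rw [jb_sq, sq_abs]
  linarith

lemma continuous_jb : Continuous jb := by unfold jb; fun_prop

/-- Weighted pointwise bounds for the second derivatives by generators and the d'Alembertian. -/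
lemma exists_jb_mul_abs_le {c : ℝ} (hc : 0 < c) : ∃ K : ℝ, 0 ≤ K ∧
    ∀ v : Fn, ContDiff ℝ (⊤ : ℕ∞) v → ∀ t : ℝ, 0 ≤ t → ∀ x : Sp,
      (∀ j : Fin 3, |jb (c * t - ‖x‖) * pd 0 (pd j.succ v) (t, x)| ≤
        K * (derivSize 1 v (t, x) + t * |boxOp c v (t, x)|)) ∧
      |jb (c * t - ‖x‖) * ∑ j : Fin 3, pd j.succ (pd j.succ v) (t, x)| ≤
        K * (derivSize 1 v (t, x) + t * |boxOp c v (t, x)|) := by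
  obtain ⟨K, hK, h⟩ := abs_cone_mul_le hc
  obtain ⟨C, hC, hC'⟩ := exists_abs_Zw_pd_le 1
  refine ⟨3 * C + K * (C + 1), by positivity, fun v hv t ht x => ?_⟩
  set p : Pt := (t, x) with hp
  set G := derivSize 1 v p with hG
  have hG0 : 0 ≤ G := derivSize_nonneg 1 v p
  have hz (i : Fin 7) (α : Fin 4) : |Zop i (pd α v) p| ≤ C * G :=
    hC' [i] (mem_W.2 (by simp)) v hv α p
  have hCG : 0 ≤ C * G := by positivity
  have hd (i j : Fin 3) : pd i.succ (pd j.succ v) p = pd j.succ (pd i.succ v) p := by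
    rw [pd_comm hv]
  have hb (j : Fin 3) : |pd 0 (pd j.succ v) p| ≤ C * G := by
    rw [pd_comm hv]
    exact abs_px_le (fun i => hz i 0) j
  obtain ⟨k1, k2⟩ := h t ‖x‖ (pd 0 (pd 0 v) p) (C * G) (fun i => x i)
    (fun j => pd 0 (pd j.succ v) p) (fun i j => pd i.succ (pd j.succ v) p) ht (norm_nonneg x)
    hd (norm_sq_eq_sum3 x) (abs_coord_le x)
    (by
      have := hz 6 0
      change |sOp (pd 0 v) p| ≤ _ at this
      rw [sOp_eq] at this
      simpa only [pd_comm hv _ 0] using this)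
    (fun j => by
      have := hz 6 j.succ
      change |sOp (pd j.succ v) p| ≤ _ at this
      rw [sOp_eq] at this
      exact this)
    (fun i j => by
      have := abs_om_le hCG (fun k => hz k 0) i j
      rw [om_eq] at this
      simpa only [pd_comm hv _ 0] using this)
    (fun i j k => by
      have := abs_om_le hCG (fun l => hz l k.succ) i j
      rw [om_eq] at this
      exact this)
  have hbox : boxOp c v p = pd 0 (pd 0 v) p - c ^ 2 * ∑ i : Fin 3, pd i.succ (pd i.succ v) p :=
    boxOp_eq c v p
  rw [← hbox] at k1 k2
  have hjb : jb (c * t - ‖x‖) ≤ 1 + |c * t - ‖x‖| := jb_le _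
  have hq : 0 ≤ t * |boxOp c v p| := by positivity
  have fin : ∀ y, |y| ≤ 3 * (C * G) → |c * t - ‖x‖| * |y| ≤ K * (C * G + t * |boxOp c v p|) →
      |jb (c * t - ‖x‖) * y| ≤ (3 * C + K * (C + 1)) * (G + t * |boxOp c v p|) := by
    intro y h1 h2
    rw [abs_mul, abs_of_pos (jb_pos _)]
    have := mul_le_mul_of_nonneg_right hjb (abs_nonneg y)
    have p1 : 0 ≤ C * (t * |boxOp c v p|) := by positivity
    have p2 : 0 ≤ K * G := by positivity
    have p3 : 0 ≤ K * (C * (t * |boxOp c v p|)) := by positivity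
    linarith
  refine ⟨fun j => fin _ ((hb j).trans (by linarith)) (k1 j), fin _ ?_ k2⟩
  refine (Finset.abs_sum_le_sum_abs _ _).trans
    ((Finset.sum_le_sum fun j _ => abs_px_le (fun i => hz i j.succ) j).trans ?_)
  simp

/-- A smooth replacement for the weight `⟨ct - |x|⟩²`. -/
def wt (c t : ℝ) (x : Sp) : ℝ := 1 + (c * t - jb ‖x‖) ^ 2

lemma one_le_wt (c t : ℝ) (x : Sp) : 1 ≤ wt c t x := by
  unfold wt; nlinarith [sq_nonneg (c * t - jb ‖x‖)]

lemma hasFDerivAt_jb_norm (x : Sp) :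
    HasFDerivAt (fun x : Sp => jb ‖x‖) ((jb ‖x‖)⁻¹ • innerSL ℝ x) x := by
  have h1 : HasFDerivAt (fun x : Sp => 1 + ‖x‖ ^ 2) (2 • innerSL ℝ x) x :=
    (hasStrictFDerivAt_norm_sq x).hasFDerivAt.const_add 1
  have h2 := h1.sqrt (by positivity)
  refine h2.congr_fderiv ?_
  ext y
  simp [jb]
  ring

lemma contDiff_jb_norm : ContDiff ℝ (⊤ : ℕ∞) fun x : Sp => jb ‖x‖ := by
  unfold jb
  exact (contDiff_const.add (contDiff_norm_sq ℝ)).sqrt fun x => by positivity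

lemma contDiff_wt (c t : ℝ) : ContDiff ℝ (⊤ : ℕ∞) (wt c t) :=
  contDiff_const.add ((contDiff_const.sub contDiff_jb_norm).pow 2)

lemma dxj_wt (c t : ℝ) (i : Fin 3) (x : Sp) :
    dxj i (wt c t) x = -2 * (c * t - jb ‖x‖) * (x i / jb ‖x‖) := by
  have h : HasFDerivAt (wt c t) _ x :=
    (((hasFDerivAt_jb_norm x).const_sub (c * t)).pow 2).const_add 1
  rw [dxj, h.fderiv]
  simp [EuclideanSpace.inner_single_right]
  left
  ring

lemma abs_dxj_wt_le (c t : ℝ) (i : Fin 3) (x : Sp) :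
    |dxj i (wt c t) x| ≤ 2 * Real.sqrt (wt c t x) := by
  rw [dxj_wt, abs_mul, abs_mul, abs_div, abs_of_pos (jb_pos _)]
  have h1 : |x i| / jb ‖x‖ ≤ 1 := by
    rw [div_le_one (jb_pos _)]
    exact (abs_coord_le x i).trans ((le_abs_self _).trans (abs_le_jb _))
  have h2 : |c * t - jb ‖x‖| ≤ Real.sqrt (wt c t x) := Real.abs_le_sqrt (by unfold wt; linarith)
  have h3 : 0 ≤ |x i| / jb ‖x‖ := div_nonneg (abs_nonneg _) (jb_pos _).le
  have h4 : 0 ≤ |c * t - jb ‖x‖| := abs_nonneg _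
  norm_num
  nlinarith

lemma jb_norm_sub_le (x : Sp) : |jb ‖x‖ - ‖x‖| ≤ 1 := by
  have h1 := jb_le ‖x‖
  have h2 := (le_abs_self _).trans (abs_le_jb ‖x‖)
  rw [abs_of_nonneg (norm_nonneg x)] at h1
  rw [abs_le]
  constructor <;> linarith

lemma jb_sq_le_wt (c t : ℝ) (x : Sp) : jb (c * t - ‖x‖) ^ 2 ≤ 3 * wt c t x := by
  rw [jb_sq, wt]
  have h := (sq_le_one_iff_abs_le_one _).2 (jb_norm_sub_le x)
  nlinarith [sq_nonneg ((c * t - jb ‖x‖) - (jb ‖x‖ - ‖x‖)), sq_nonneg (c * t - jb ‖x‖)]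

lemma wt_le_jb_sq (c t : ℝ) (x : Sp) : wt c t x ≤ 3 * jb (c * t - ‖x‖) ^ 2 := by
  rw [jb_sq, wt]
  have h := (sq_le_one_iff_abs_le_one _).2 (jb_norm_sub_le x)
  nlinarith [sq_nonneg ((c * t - ‖x‖) + (jb ‖x‖ - ‖x‖)), sq_nonneg (c * t - ‖x‖)]

lemma dxj_mul {f g : Sp → ℝ} (hf : Differentiable ℝ f) (hg : Differentiable ℝ g) (j : Fin 3)
    (x : Sp) : dxj j (fun x => f x * g x) x = dxj j f x * g x + f x * dxj j g x := by
  rw [dxj, ((hf x).hasFDerivAt.fun_mul (hg x).hasFDerivAt).fderiv]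
  simp [dxj]
  ring

lemma integral_dxj_eq_zero {f : Sp → ℝ} (hf : ContDiff ℝ 1 f) (hs : HasCompactSupport f)
    (j : Fin 3) : ∫ x, dxj j f x = 0 :=
  integral_fderiv_apply_eq_zero hf hs _

lemma dxj_mul_mul {w f g : Sp → ℝ} (hw : ContDiff ℝ 1 w) (hf : ContDiff ℝ 1 f)
    (hg : ContDiff ℝ 1 g) (j : Fin 3) (x : Sp) :
    dxj j (fun x => w x * (f x * g x)) x =
      dxj j w x * (f x * g x) + w x * (dxj j f x * g x + f x * dxj j g x) := by
  have d {f : Sp → ℝ} (h : ContDiff ℝ 1 f) : Differentiable ℝ f := h.differentiable (by norm_num)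
  rw [dxj_mul (d hw) (d (hf.mul hg)), dxj_mul (d hf) (d hg)]

/-- The weighted norm of a Hessian is controlled by its trace and the gradient. -/
lemma integral_wt_mul_hessian_le {c t : ℝ} {a : Fin 3 → Sp → ℝ} {h : Fin 3 → Fin 3 → Sp → ℝ}
    (ha : ∀ j, ContDiff ℝ 1 (a j)) (hac : ∀ j, CC (a j)) (hh : ∀ i j, ContDiff ℝ 1 (h i j))
    (hhc : ∀ i j, CC (h i j)) (hd : ∀ i j x, dxj i (a j) x = h i j x)
    (h3 : ∀ i j x, dxj i (h i j) x = dxj j (h i i) x) :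
    ∫ x, wt c t x * ∑ i, ∑ j, h i j x ^ 2 ≤
      8 * (∫ x, wt c t x * (∑ j, h j j x) ^ 2) + 14 * ∑ j, ∫ x, a j x ^ 2 := by
  have hw : ContDiff ℝ 1 (wt c t) := (contDiff_wt c t).of_le (by norm_cast)
  have hwc := hw.continuous
  set P : Fin 3 → Fin 3 → Sp → ℝ := fun i j x => wt c t x * (a j x * h i j x) with hP
  set Q : Fin 3 → Fin 3 → Sp → ℝ := fun i j x => wt c t x * (a j x * h i i x) with hQ
  have hPs (i j) : ContDiff ℝ 1 (P i j) := hw.mul ((ha j).mul (hh i j))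
  have hQs (i j) : ContDiff ℝ 1 (Q i j) := hw.mul ((ha j).mul (hh i i))
  have hPc (i j) : HasCompactSupport (P i j) :=
    (((hac j).mul_right (hh i j).continuous).mul_left hwc).2
  have hQc (i j) : HasCompactSupport (Q i j) :=
    (((hac j).mul_right (hh i i).continuous).mul_left hwc).2
  have hPd (i j) (x : Sp) : dxj i (P i j) x = dxj i (wt c t) x * (a j x * h i j x) +
      wt c t x * (h i j x * h i j x + a j x * dxj i (h i j) x) := by
    rw [hP, dxj_mul_mul hw (ha j) (hh i j), hd]
  have hQd (i j) (x : Sp) : dxj j (Q i j) x = dxj j (wt c t) x * (a j x * h i i x) +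
      wt c t x * (h j j x * h i i x + a j x * dxj i (h i j) x) := by
    rw [hQ, dxj_mul_mul hw (ha j) (hh i i), hd, h3]
  clear_value P Q
  set H : Sp → ℝ := fun x => wt c t x * ∑ i, ∑ j, h i j x ^ 2 with hH
  set L : Sp → ℝ := fun x => wt c t x * (∑ j, h j j x) ^ 2 with hL
  set D : Sp → ℝ := fun x => ∑ i, ∑ j, (dxj i (P i j) x + -dxj j (Q i j) x) with hD
  have key (x : Sp) : H x ≤ 8 * L x + (14 * ∑ j, a j x ^ 2 + 2 * D x) := by
    have e : D x = wt c t x * ∑ i, ∑ j, h i j x ^ 2 - L x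
        + ∑ i, ∑ j, dxj i (wt c t) x * (a j x * h i j x)
        - ∑ j, dxj j (wt c t) x * (a j x * ∑ i, h i i x) := by
      simp only [hD, hL, hPd, hQd, Fin.sum_univ_three]
      ring
    set φ := Real.sqrt (wt c t x) with hφ
    have hφ2 : φ ^ 2 = wt c t x := Real.sq_sqrt (zero_le_one.trans (one_le_wt c t x))
    have hφ0 : 0 ≤ φ := Real.sqrt_nonneg _
    have b1 (i j) : -(dxj i (wt c t) x * (a j x * h i j x)) ≤
        1 / 2 * (wt c t x * h i j x ^ 2) + 2 * a j x ^ 2 := by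
      have q1 := abs_dxj_wt_le c t i x
      refine (neg_le_abs _).trans ?_
      rw [abs_mul, abs_mul, ← hφ2, ← sq_abs (a j x), ← sq_abs (h i j x)]
      have q2 := mul_le_mul_of_nonneg_right q1 (by positivity : 0 ≤ |a j x| * |h i j x|)
      nlinarith [sq_nonneg (φ * |h i j x| - 2 * |a j x|)]
    have b2 (j) : dxj j (wt c t) x * (a j x * ∑ i, h i i x) ≤
        a j x ^ 2 + wt c t x * (∑ i, h i i x) ^ 2 := by
      have q1 := abs_dxj_wt_le c t j x
      refine (le_abs_self _).trans ?_
      rw [abs_mul, abs_mul, ← hφ2, ← sq_abs (a j x), ← sq_abs (∑ i, h i i x)]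
      have q2 := mul_le_mul_of_nonneg_right q1 (by positivity : 0 ≤ |a j x| * |∑ i, h i i x|)
      nlinarith [sq_nonneg (φ * |∑ i, h i i x| - |a j x|)]
    have s1 := Finset.sum_le_sum fun i (_ : i ∈ Finset.univ) =>
      Finset.sum_le_sum fun j (_ : j ∈ Finset.univ) => b1 i j
    have s2 := Finset.sum_le_sum fun j (_ : j ∈ Finset.univ) => b2 j
    simp only [hH, e, hL]
    simp only [Fin.sum_univ_three] at s1 s2 ⊢
    linarith
  have iP (i j) : CC (dxj i (P i j)) := CC_dxj (hPs i j) (hPc i j) i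
  have iQ (i j) : CC (dxj j (Q i j)) := CC_dxj (hQs i j) (hQc i j) j
  have iPQ (i j) : CC fun x => dxj i (P i j) x + -dxj j (Q i j) x := (iP i j).add (iQ i j).neg
  have iD : CC D := CC.sum _ fun i _ => CC.sum _ fun j _ => iPQ i j
  have D0 : ∫ x, D x = 0 := by
    rw [hD, integral_finsetSum _ fun i _ => (CC.sum _ fun j _ => iPQ i j).integrable]
    refine Finset.sum_eq_zero fun i _ => ?_
    rw [integral_finsetSum _ fun j _ => (iPQ i j).integrable]
    refine Finset.sum_eq_zero fun j _ => ?_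
    rw [CC.integral_add (iP i j) (iQ i j).neg, integral_neg,
      integral_dxj_eq_zero (hPs i j) (hPc i j), integral_dxj_eq_zero (hQs i j) (hQc i j)]
    simp
  have iH : CC H := (CC.sum _ fun i _ => CC.sum _ fun j _ =>
    (hhc i j).pow two_ne_zero).mul_left hwc
  have iL : CC L := ((CC.sum _ fun j _ => hhc j j).pow two_ne_zero).mul_left hwc
  have iF (j : Fin 3) : CC fun x => a j x ^ 2 := (hac j).pow two_ne_zero
  have iF' : CC fun x => ∑ j, a j x ^ 2 := CC.sum _ fun j _ => iF j
  calc ∫ x, H x ≤ ∫ x, (8 * L x + (14 * ∑ j, a j x ^ 2 + 2 * D x)) :=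
        integral_mono iH.integrable ((iL.const_mul 8).add
          ((iF'.const_mul 14).add (iD.const_mul 2))).integrable key
    _ = _ := by
        rw [CC.integral_add (iL.const_mul 8) ((iF'.const_mul 14).add (iD.const_mul 2)),
          CC.integral_add (iF'.const_mul 14) (iD.const_mul 2), integral_const_mul,
          integral_const_mul, integral_const_mul, D0,
          integral_finsetSum _ fun j _ => (iF j).integrable]
        ring

lemma Adm.contDiff_slice_one {v : Fn} {ρ T : ℝ} (hv : Adm ρ T v) (t : ℝ) :
    ContDiff ℝ 1 fun x => v (t, x) :=
  (contDiff_slice hv.1 t).of_le (by norm_cast)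

lemma integral_wt_hessian_le {v : Fn} {ρ T t : ℝ} (c : ℝ) (hv : Adm ρ T v) (ht : t ∈ Ioo 0 T) :
    ∫ x, wt c t x * ∑ i : Fin 3, ∑ j : Fin 3, pd i.succ (pd j.succ v) (t, x) ^ 2 ≤
      8 * (∫ x, wt c t x * (∑ j : Fin 3, pd j.succ (pd j.succ v) (t, x)) ^ 2) +
        14 * ∑ j : Fin 3, ∫ x, pd j.succ v (t, x) ^ 2 := by
  refine integral_wt_mul_hessian_le (a := fun j x => pd j.succ v (t, x))
    (h := fun i j x => pd i.succ (pd j.succ v) (t, x))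
    (fun j => (hv.pd _).contDiff_slice_one t) (fun j => (hv.pd _).cc ht)
    (fun i j => ((hv.pd _).pd _).contDiff_slice_one t) (fun i j => ((hv.pd _).pd _).cc ht)
    (fun i j x => by rw [dxj_slice (hv.pd _).1])
    (fun i j x => ?_)
  rw [dxj_slice ((hv.pd _).pd _).1, dxj_slice ((hv.pd _).pd _).1,
    pd_comm (hv.pd _).1 j.succ i.succ, pd_comm hv.1 j.succ i.succ]

/-- The Klainerman–Sideris inequality. -/
lemma exists_M2_le {c : ℝ} (hc : 0 < c) : ∃ K : ℝ, 0 ≤ K ∧ ∀ (ρ T : ℝ) (v : Fn), Adm ρ T v →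
    ∀ t ∈ Ioo 0 T, M2 c v t ≤ K * (∑ q ∈ Finset.univ ×ˢ W 1, L2 (fun x => pd q.1 (Zw q.2 v) (t, x))
      + t * L2 fun x => boxOp c v (t, x)) := by
  obtain ⟨K, hK, h⟩ := exists_jb_mul_abs_le hc
  refine ⟨12 * (9 * K + 8 * 7) , by positivity, fun ρ T v hv t ht => ?_⟩
  set N := ∑ q ∈ Finset.univ ×ˢ W 1, L2 (fun x => pd q.1 (Zw q.2 v) (t, x)) with hN
  set B := L2 fun x => boxOp c v (t, x) with hB
  have ht0 : 0 ≤ t := ht.1.le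
  have hN0 : 0 ≤ N := Finset.sum_nonneg fun _ _ => L2_nonneg _
  have hB0 : 0 ≤ t * B := mul_nonneg ht0 (L2_nonneg _)
  have hj : Continuous fun x : Sp => jb (c * t - ‖x‖) := continuous_jb.comp (by fun_prop)
  have step {f : Sp → ℝ} (hf : CC f)
      (H : ∀ x, |f x| ≤ K * (derivSize 1 v (t, x) + t * |boxOp c v (t, x)|)) :
      L2 f ≤ K * (N + t * B) := by
    have := L2_le_sum_add (Finset.univ ×ˢ W 1) (f := f) (c := fun _ => K) (d := K * t)
      (g := fun q x => pd q.1 (Zw q.2 v) (t, x)) (h := fun x => boxOp c v (t, x)) hf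
      (fun q _ => ((hv.Zw _).pd _).cc ht) ((hv.boxOp c).cc ht) (fun _ _ => hK)
      (by positivity) fun x => (H x).trans_eq (by
        rw [← Finset.mul_sum, derivSize]
        ring)
    rw [← Finset.mul_sum] at this
    linarith
  have h1 (j : Fin 3) : L2 (fun x => jb (c * t - ‖x‖) * pd 0 (pd j.succ v) (t, x)) ≤
      K * (N + t * B) :=
    step ((((hv.pd _).pd _).cc ht).mul_left hj) fun x => (h v hv.1 t ht0 x).1 j
  have iΔ : CC fun x => jb (c * t - ‖x‖) * ∑ j : Fin 3, pd j.succ (pd j.succ v) (t, x) :=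
    (CC.sum _ fun j _ => ((hv.pd _).pd _).cc ht).mul_left hj
  have h2 : L2 (fun x => jb (c * t - ‖x‖) * ∑ j : Fin 3, pd j.succ (pd j.succ v) (t, x)) ≤
      K * (N + t * B) := step iΔ fun x => (h v hv.1 t ht0 x).2
  have h3 (j : Fin 3) : L2 (fun x => pd j.succ v (t, x)) ≤ N :=
    Finset.single_le_sum (f := fun q : Fin 4 × List (Fin 7) =>
      L2 (fun x => pd q.1 (Zw q.2 v) (t, x))) (fun _ _ => L2_nonneg _)
      (a := (j.succ, [])) (Finset.mk_mem_product (Finset.mem_univ _) (mem_W.2 (by simp)))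
  have hw : Continuous (wt c t) := (contDiff_wt c t).continuous
  have h4 (i j : Fin 3) :
      L2 (fun x => jb (c * t - ‖x‖) * pd i.succ (pd j.succ v) (t, x)) ≤
      (9 * K + 8 * 7) * (N + t * B) := by
    have iH : CC fun x => wt c t x * ∑ i : Fin 3, ∑ j : Fin 3,
        pd i.succ (pd j.succ v) (t, x) ^ 2 := (CC.sum _ fun i _ => CC.sum _ fun j _ =>
      (((hv.pd _).pd _).cc ht).pow two_ne_zero).mul_left hw
    have iL : CC fun x => wt c t x * (∑ j : Fin 3, pd j.succ (pd j.succ v) (t, x)) ^ 2 :=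
      ((CC.sum _ fun j _ => ((hv.pd _).pd _).cc ht).pow two_ne_zero).mul_left hw
    refine abs_le_of_sq_le_sq' ?_ (by positivity) |>.2
    have e1 : L2 (fun x => jb (c * t - ‖x‖) * pd i.succ (pd j.succ v) (t, x)) ^ 2 ≤
        3 * ∫ x, wt c t x * ∑ i : Fin 3, ∑ j : Fin 3, pd i.succ (pd j.succ v) (t, x) ^ 2 := by
      rw [L2_sq, ← integral_const_mul]
      refine integral_mono ((((hv.pd _).pd _).cc ht).mul_left hj |>.pow two_ne_zero).integrable
        (iH.const_mul 3).integrable fun x => ?_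
      have q1 := jb_sq_le_wt c t x
      have q2 : pd i.succ (pd j.succ v) (t, x) ^ 2 ≤
          ∑ i : Fin 3, ∑ j : Fin 3, pd i.succ (pd j.succ v) (t, x) ^ 2 :=
        (Finset.single_le_sum (f := fun j : Fin 3 => pd i.succ (pd j.succ v) (t, x) ^ 2)
          (fun _ _ => sq_nonneg _) (Finset.mem_univ j)).trans
        (Finset.single_le_sum (f := fun i : Fin 3 => ∑ j : Fin 3,
          pd i.succ (pd j.succ v) (t, x) ^ 2)
          (fun _ _ => Finset.sum_nonneg fun _ _ => sq_nonneg _) (Finset.mem_univ i))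
      simp only [mul_pow]
      rw [← mul_assoc]
      exact mul_le_mul q1 q2 (sq_nonneg _) (by linarith [one_le_wt c t x])
    have e2 := integral_wt_hessian_le c hv ht
    have e3 : ∫ x, wt c t x * (∑ j : Fin 3, pd j.succ (pd j.succ v) (t, x)) ^ 2 ≤
        3 * (K * (N + t * B)) ^ 2 := by
      have := pow_le_pow_left₀ (L2_nonneg _) h2 2
      rw [L2_sq] at this
      refine le_trans ?_ (mul_le_mul_of_nonneg_left this (by norm_num))
      rw [← integral_const_mul]
      refine integral_mono iL.integrable ((iΔ.pow two_ne_zero).const_mul 3).integrable fun x => ?_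
      simp only [mul_pow]
      rw [← mul_assoc]
      exact mul_le_mul_of_nonneg_right (wt_le_jb_sq c t x) (sq_nonneg _)
    have e4 : ∑ j : Fin 3, ∫ x, pd j.succ v (t, x) ^ 2 ≤ 3 * N ^ 2 := by
      refine (Finset.sum_le_sum fun j _ => ?_ : _ ≤ ∑ _j : Fin 3, N ^ 2).trans (by simp)
      rw [← L2_sq]
      exact pow_le_pow_left₀ (L2_nonneg _) (h3 j) 2
    have e5 : N ^ 2 ≤ (N + t * B) ^ 2 := pow_le_pow_left₀ hN0 (by linarith) 2
    have e6 : 0 ≤ K * (N + t * B) ^ 2 := by positivity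
    nlinarith
  have h5 (α : Fin 4) (j : Fin 3) :
      L2 (fun x => jb (c * t - ‖x‖) * pd α (px j v) (t, x)) ≤ (9 * K + 8 * 7) * (N + t * B) := by
    refine Fin.cases ?_ (fun i => h4 i j) α
    refine (h1 j).trans ?_
    gcongr
    linarith
  rw [M2]
  calc _ ≤ ∑ _α : Fin 4, ∑ _j : Fin 3, (9 * K + 8 * 7) * (N + t * B) :=
        Finset.sum_le_sum fun α _ => Finset.sum_le_sum fun j _ => h5 α j
    _ = _ := by
        simp
        ring

/-- The `L²` size of the first order derivatives of `Z^a v`, `|a| ≤ n`. -/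
def XN (n : ℕ) (v : Fn) (t : ℝ) : ℝ :=
  ∑ q ∈ Finset.univ ×ˢ W n, L2 (fun x => pd q.1 (Zw q.2 v) (t, x))

/-- The sum of the weighted norms `M₂` of `Z^a v`, `|a| ≤ m`. -/
def XM (m : ℕ) (c : ℝ) (v : Fn) (t : ℝ) : ℝ := ∑ l ∈ W m, M2 c (Zw l v) t

/-- The energy-type and weighted norms of `Z^a v`, `|a| ≤ m`, combined. -/
def XX (m : ℕ) (c : ℝ) (v : Fn) (t : ℝ) : ℝ := XN (m + 1) v t + XM m c v t

/-- The norm controlling a single function. -/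
def YY (c : ℝ) (v : Fn) (t : ℝ) : ℝ := XN 1 v t + M2 c v t

lemma XN_nonneg (n : ℕ) (v : Fn) (t : ℝ) : 0 ≤ XN n v t :=
  Finset.sum_nonneg fun _ _ => L2_nonneg _

lemma M2_nonneg (c : ℝ) (v : Fn) (t : ℝ) : 0 ≤ M2 c v t :=
  Finset.sum_nonneg fun _ _ => Finset.sum_nonneg fun _ _ => L2_nonneg _

lemma XM_nonneg (m : ℕ) (c : ℝ) (v : Fn) (t : ℝ) : 0 ≤ XM m c v t :=
  Finset.sum_nonneg fun _ _ => M2_nonneg _ _ _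

lemma XX_nonneg (m : ℕ) (c : ℝ) (v : Fn) (t : ℝ) : 0 ≤ XX m c v t :=
  add_nonneg (XN_nonneg _ _ _) (XM_nonneg _ _ _ _)

lemma YY_nonneg (c : ℝ) (v : Fn) (t : ℝ) : 0 ≤ YY c v t :=
  add_nonneg (XN_nonneg _ _ _) (M2_nonneg _ _ _)

lemma W_mono {n m : ℕ} (h : n ≤ m) : W n ⊆ W m := fun _ hl =>
  mem_W.2 ((mem_W.1 hl).trans h)

lemma L2_le_XN {n : ℕ} {l : List (Fin 7)} (hl : l.length ≤ n) (α : Fin 4) (v : Fn) (t : ℝ) :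
    L2 (fun x => pd α (Zw l v) (t, x)) ≤ XN n v t :=
  Finset.single_le_sum (f := fun q : Fin 4 × List (Fin 7) =>
    L2 (fun x => pd q.1 (Zw q.2 v) (t, x))) (fun _ _ => L2_nonneg _)
    (a := (α, l)) (Finset.mk_mem_product (Finset.mem_univ _) (mem_W.2 hl))

lemma XN_mono {n m : ℕ} (h : n ≤ m) (v : Fn) (t : ℝ) : XN n v t ≤ XN m v t :=
  Finset.sum_le_sum_of_subset_of_nonneg (Finset.product_subset_product_right (W_mono h))
    fun _ _ _ => L2_nonneg _

lemma XN_Zw_le {n : ℕ} {l : List (Fin 7)} (v : Fn) (t : ℝ) :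
    XN n (Zw l v) t ≤ (Finset.univ (α := Fin 4) ×ˢ W n).card * XN (n + l.length) v t := by
  rw [← nsmul_eq_mul]
  refine Finset.sum_le_card_nsmul _ _ _ fun q hq => ?_
  rw [← Zw_append]
  refine L2_le_XN ?_ _ _ _
  have := mem_W.1 (Finset.mem_product.1 hq).2
  rw [List.length_append]
  omega

lemma exists_YY_Zw_le (m : ℕ) : ∃ K : ℝ, 0 ≤ K ∧ ∀ (c : ℝ) (v : Fn) (t : ℝ) (l : List (Fin 7)),
    l.length ≤ m → YY c (Zw l v) t ≤ K * XX m c v t := by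
  refine ⟨(Finset.univ (α := Fin 4) ×ˢ W 1).card + 1, by positivity, fun c v t l hl => ?_⟩
  have h1 := XN_Zw_le (n := 1) (l := l) v t
  have h2 := XN_mono (show 1 + l.length ≤ m + 1 by omega) v t
  have h3 : M2 c (Zw l v) t ≤ XM m c v t :=
    Finset.single_le_sum (f := fun l => M2 c (Zw l v) t) (fun _ _ => M2_nonneg _ _ _) (mem_W.2 hl)
  have h4 := XM_nonneg m c v t
  have h5 := XN_nonneg (m + 1) v t
  rw [YY, XX]
  have h6 := mul_le_mul_of_nonneg_left h2
    (Nat.cast_nonneg (α := ℝ) (Finset.univ (α := Fin 4) ×ˢ W 1).card)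
  have h7 := mul_nonneg (Nat.cast_nonneg (α := ℝ) (Finset.univ (α := Fin 4) ×ˢ W 1).card) h4
  linarith

lemma exists_XM_le {c : ℝ} (hc : 0 < c) (m : ℕ) : ∃ K : ℝ, 0 ≤ K ∧ ∀ (ρ T : ℝ) (v : Fn),
    Adm ρ T v → ∀ t ∈ Ioo 0 T, XM m c v t ≤
      K * (XN (m + 1) v t + t * ∑ l ∈ W m, L2 fun x => Zw l (boxOp c v) (t, x)) := by
  obtain ⟨K, hK, h⟩ := exists_M2_le hc
  obtain ⟨C, hC, h'⟩ := exists_abs_boxOp_Zw_le c m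
  obtain ⟨N, hN⟩ : ∃ N : ℝ, N = ((Finset.univ (α := Fin 4) ×ˢ W 1).card : ℝ) := ⟨_, rfl⟩
  have hN0 : 0 ≤ N := hN ▸ Nat.cast_nonneg _
  refine ⟨(W m).card * (K * (N + C)), by positivity, fun ρ T v hv t ht => ?_⟩
  set S := ∑ l ∈ W m, L2 fun x => Zw l (boxOp c v) (t, x) with hS
  have hS0 : 0 ≤ S := Finset.sum_nonneg fun _ _ => L2_nonneg _
  have ht0 : 0 ≤ t := ht.1.le
  have hX := XN_nonneg (m + 1) v t
  rw [XM, mul_assoc, ← nsmul_eq_mul]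
  refine Finset.sum_le_card_nsmul _ _ _ fun l hl => (h ρ T _ (hv.Zw l) t ht).trans ?_
  have h1 : XN 1 (Zw l v) t ≤ N * XN (m + 1) v t := (XN_Zw_le v t).trans (by
    rw [← hN]
    have := XN_mono (show 1 + l.length ≤ m + 1 by have := mem_W.1 hl; omega) v t
    gcongr)
  have h2 : L2 (fun x => boxOp c (Zw l v) (t, x)) ≤ C * S := by
    rw [hS, Finset.mul_sum]
    refine L2_le_sum _ (((hv.Zw l).boxOp c).cc ht) (fun l _ => ((hv.boxOp c).Zw l).cc ht)
      (fun _ _ => hC) fun x => ?_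
    rw [← Finset.mul_sum]
    exact h' l hl v hv.1 _
  have h3 := mul_le_mul_of_nonneg_left h2 ht0
  rw [mul_assoc]
  refine mul_le_mul_of_nonneg_left ?_ hK
  have h4 : 0 ≤ N * (t * S) := by positivity
  have h5 : 0 ≤ C * XN (m + 1) v t := by positivity
  rw [XN] at h1
  linarith

/-- The smooth weight `⟨ct - ⟨x⟩⟩`. -/
def wq (c t : ℝ) (x : Sp) : ℝ := Real.sqrt (wt c t x)

lemma contDiff_wq (c t : ℝ) : ContDiff ℝ (⊤ : ℕ∞) (wq c t) :=
  (contDiff_wt c t).sqrt fun x => (zero_lt_one.trans_le (one_le_wt c t x)).ne'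

lemma wq_sq (c t : ℝ) (x : Sp) : wq c t x ^ 2 = wt c t x :=
  Real.sq_sqrt (zero_le_one.trans (one_le_wt c t x))

lemma one_le_wq (c t : ℝ) (x : Sp) : 1 ≤ wq c t x := Real.one_le_sqrt.2 (one_le_wt c t x)

lemma wq_le (c t : ℝ) (x : Sp) : wq c t x ≤ 2 * jb (c * t - ‖x‖) := by
  refine abs_le_of_sq_le_sq' ?_ (by have := jb_pos (c * t - ‖x‖); positivity) |>.2
  rw [wq_sq]
  nlinarith [wt_le_jb_sq c t x, sq_nonneg (jb (c * t - ‖x‖))]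

lemma abs_sub_le_wq (c t : ℝ) (x : Sp) : |c * t - ‖x‖| ≤ 2 * wq c t x := by
  have h0 := one_le_wq c t x
  refine abs_le_of_sq_le_sq' ?_ (by positivity) |>.2
  have h := jb_sq_le_wt c t x
  rw [jb_sq] at h
  rw [sq_abs, mul_pow, wq_sq]
  nlinarith [one_le_wt c t x]

lemma abs_dxj_wq_le (c t : ℝ) (i : Fin 3) (x : Sp) : |dxj i (wq c t) x| ≤ 1 := by
  have h0 := one_le_wq c t x
  have hd : HasFDerivAt (wt c t) (fderiv ℝ (wt c t) x) x :=
    ((contDiff_wt c t).differentiable (by simp) x).hasFDerivAt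
  have h1 : HasFDerivAt (wq c t) _ x :=
    hd.sqrt (zero_lt_one.trans_le (one_le_wt c t x)).ne'
  have h2 := abs_dxj_wt_le c t i x
  have e : dxj i (wq c t) x = 1 / (2 * wq c t x) * dxj i (wt c t) x := by
    rw [dxj, h1.fderiv]
    rfl
  rw [e, abs_mul, abs_of_pos (by positivity), div_mul_eq_mul_div, one_mul,
    div_le_one (by positivity)]
  exact h2

lemma exists_jb_sq_le {c : ℝ} (hc : 0 < c) : ∃ K : ℝ, 0 ≤ K ∧ ∀ (t : ℝ) (x : Sp),
    jb t ^ 2 ≤ K * (wt c t x + (1 + ‖x‖ ^ 2)) := by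
  refine ⟨1 + 2 / c ^ 2, by positivity, fun t x => ?_⟩
  have h1 : (c * t) ^ 2 ≤ 2 * (wt c t x + (1 + ‖x‖ ^ 2)) := by
    rw [← jb_sq, wt]
    nlinarith [sq_nonneg ((c * t - jb ‖x‖) - jb ‖x‖)]
  have h2 : t ^ 2 = 1 / c ^ 2 * (c * t) ^ 2 := by field_simp
  rw [jb_sq, h2]
  have h3 := mul_le_mul_of_nonneg_left h1 (show 0 ≤ 1 / c ^ 2 by positivity)
  have h4 := one_le_wt c t x
  have h5 : 1 / c ^ 2 * (2 * (wt c t x + (1 + ‖x‖ ^ 2))) =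
    2 / c ^ 2 * (wt c t x + (1 + ‖x‖ ^ 2)) := by ring
  nlinarith [sq_nonneg ‖x‖]

lemma Bd6.mono {A B : ℝ} {f : Sp → ℝ} (h : Bd6 A f) (hA : 0 ≤ A) (hAB : A ≤ B) : Bd6 B f :=
  ⟨h.1, h.2.trans (pow_le_pow_left₀ hA hAB 6)⟩

lemma exists_Bd6_Zop : ∃ K : ℝ, 0 ≤ K ∧ ∀ (ρ T : ℝ) (v : Fn), Adm ρ T v → ∀ t ∈ Ioo 0 T,
    ∀ (c : ℝ) (i : Fin 7), Bd6 (K * YY c v t) fun x => Zop i v (t, x) := by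
  obtain ⟨K, hK, h⟩ := exists_Bd6_gradient
  refine ⟨K * 3, by positivity, fun ρ T v hv t ht c i => ?_⟩
  refine (h _ ((hv.Zop i).contDiff_slice_one t) ((hv.Zop i).cc ht).2).mono
    (mul_nonneg hK (Finset.sum_nonneg fun _ _ => L2_nonneg _)) ?_
  rw [mul_assoc]
  refine mul_le_mul_of_nonneg_left ?_ hK
  have e : ∀ j : Fin 3, L2 (dxj j fun x => Zop i v (t, x)) ≤ YY c v t := fun j => by
    rw [dxj_slice (hv.Zop i).1]
    exact (L2_le_XN (l := [i]) (by simp) j.succ v t).trans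
      (le_add_of_nonneg_right (M2_nonneg _ _ _))
  exact (Finset.sum_le_sum fun j _ => e j).trans_eq (by simp)

lemma L2_pd_le_YY (c : ℝ) (v : Fn) (t : ℝ) (α : Fin 4) :
    L2 (fun x => pd α v (t, x)) ≤ YY c v t :=
  (L2_le_XN (l := []) (by simp) α v t).trans (le_add_of_nonneg_right (M2_nonneg _ _ _))

lemma L2_jb_pd_le_YY (c : ℝ) {v : Fn} (hv : ContDiff ℝ (⊤ : ℕ∞) v) (t : ℝ) (α : Fin 4)
    (j : Fin 3) : L2 (fun x => jb (c * t - ‖x‖) * pd j.succ (pd α v) (t, x)) ≤ YY c v t := by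
  rw [pd_comm hv]
  refine le_add_of_nonneg_of_le (XN_nonneg _ _ _) ?_
  refine (Finset.single_le_sum (f := fun j : Fin 3 =>
    L2 (fun x => jb (c * t - ‖x‖) * pd α (px j v) (t, x))) (fun _ _ => L2_nonneg _)
    (Finset.mem_univ j)).trans ?_
  exact Finset.single_le_sum (f := fun α : Fin 4 => ∑ j : Fin 3,
    L2 (fun x => jb (c * t - ‖x‖) * pd α (px j v) (t, x)))
    (fun _ _ => Finset.sum_nonneg fun _ _ => L2_nonneg _) (Finset.mem_univ α)

lemma continuous_jb_sub (c t : ℝ) : Continuous fun x : Sp => jb (c * t - ‖x‖) :=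
  continuous_jb.comp (by fun_prop)

lemma L2_pd_pd_le_YY (c : ℝ) {v : Fn} {ρ T t : ℝ} (hv : Adm ρ T v) (ht : t ∈ Ioo 0 T)
    (α : Fin 4) (j : Fin 3) : L2 (fun x => pd j.succ (pd α v) (t, x)) ≤ YY c v t := by
  refine (L2_mono (((hv.pd _).pd _).cc ht) ((((hv.pd _).pd _).cc ht).mul_left
    (continuous_jb_sub c t)) fun x => ?_).trans (L2_jb_pd_le_YY c hv.1 t α j)
  rw [abs_mul, abs_of_pos (jb_pos _)]
  exact le_mul_of_one_le_left (abs_nonneg _) (one_le_jb _)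

lemma exists_Bd6_wq_pd : ∃ K : ℝ, 0 ≤ K ∧ ∀ (ρ T : ℝ) (v : Fn), Adm ρ T v → ∀ t ∈ Ioo 0 T,
    ∀ (c : ℝ) (α : Fin 4), Bd6 (K * YY c v t) fun x => wq c t x * pd α v (t, x) := by
  obtain ⟨K, hK, h⟩ := exists_Bd6_gradient
  refine ⟨K * 9, by positivity, fun ρ T v hv t ht c α => ?_⟩
  have hq : ContDiff ℝ 1 (wq c t) := (contDiff_wq c t).of_le (by norm_cast)
  have hs := ((hv.pd α).cc ht).mul_left hq.continuous
  refine (h _ (hq.mul ((hv.pd α).contDiff_slice_one t)) hs.2).mono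
    (mul_nonneg hK (Finset.sum_nonneg fun _ _ => L2_nonneg _)) ?_
  rw [mul_assoc]
  refine mul_le_mul_of_nonneg_left ?_ hK
  have e (j : Fin 3) : L2 (dxj j fun x => wq c t x * pd α v (t, x)) ≤ 3 * YY c v t := by
    have := L2_le_sum_add (Finset.univ : Finset Unit)
      (f := dxj j fun x => wq c t x * pd α v (t, x)) (c := fun _ => 1) (d := 2)
      (g := fun _ x => pd α v (t, x))
      (h := fun x => jb (c * t - ‖x‖) * pd j.succ (pd α v) (t, x))
      (CC_dxj (hq.mul ((hv.pd α).contDiff_slice_one t)) hs.2 j) (fun _ _ => (hv.pd α).cc ht)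
      ((((hv.pd _).pd _).cc ht).mul_left (continuous_jb_sub c t)) (fun _ _ => zero_le_one)
      zero_le_two fun x => by
        rw [dxj_mul (hq.differentiable (by norm_num))
          (((hv.pd α).contDiff_slice_one t).differentiable (by norm_num)),
          dxj_slice (hv.pd α).1]
        refine (abs_add_le _ _).trans ?_
        simp only [abs_mul, abs_of_pos (jb_pos _), Finset.univ_unique, Finset.sum_singleton]
        rw [abs_of_nonneg (zero_le_one.trans (one_le_wq c t x)), ← mul_assoc]
        exact add_le_add (mul_le_mul_of_nonneg_right (abs_dxj_wq_le c t j x) (abs_nonneg _))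
          (mul_le_mul_of_nonneg_right (wq_le c t x) (abs_nonneg _))
    simp only [Finset.univ_unique, Finset.sum_singleton] at this
    have h1 := L2_pd_le_YY c v t α
    have h2 := L2_jb_pd_le_YY c hv.1 t α j
    linarith
  refine (Finset.sum_le_sum fun j _ => e j).trans_eq ?_
  simp
  ring

lemma rpow_third_pow {τ : ℝ} (hτ : 0 ≤ τ) (n : ℕ) : (τ ^ (1 / 3 : ℝ)) ^ (3 * n) = τ ^ n := by
  rw [pow_mul, ← Real.rpow_natCast (τ ^ (1 / 3 : ℝ)) 3, ← Real.rpow_mul hτ]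
  norm_num

lemma exists_Bd_pd {c : ℝ} (hc : 0 < c) : ∃ K : ℝ, 0 ≤ K ∧ ∀ (ρ T : ℝ) (v : Fn),
    Adm ρ T v → ∀ t ∈ Ioo 0 T, ∀ α : Fin 4,
      Bd (jb t ^ (1 / 3 : ℝ)) (K * YY c v t) fun x => pd α v (t, x) := by
  obtain ⟨K1, hK1, h1⟩ := exists_Bd6_wq_pd
  obtain ⟨K2, hK2, h2⟩ := exists_integral_weight_pow_six_le'
  obtain ⟨K3, hK3, h3⟩ := exists_jb_sq_le hc
  obtain ⟨K4, hK4, h4⟩ := exists_abs_Zw_pd_le 1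
  refine ⟨1 + 2 * (K3 + 1) * (K1 + K2 * (1 + 3 + 9 * K4)), by positivity,
    fun ρ T v hv t ht α => ?_⟩
  set Y := YY c v t with hY
  have hY0 : 0 ≤ Y := YY_nonneg c v t
  have hf := (hv.pd α).cc ht
  have hf1 := (hv.pd α).contDiff_slice_one t
  set f : Sp → ℝ := fun x => pd α v (t, x) with hfd
  have hP0 : 0 ≤ 2 * (K3 + 1) * (K1 + K2 * (1 + 3 + 9 * K4)) := by positivity
  refine ⟨hf, ?_, ?_⟩
  · rw [← L2_sq]
    refine pow_le_pow_left₀ (L2_nonneg _) ((L2_pd_le_YY c v t α).trans ?_) 2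
    nlinarith
  · have r1 (i j : Fin 3) : L2 (rotD i j f) ≤ K4 * Y := by
      refine (L2_le_sum (Finset.univ ×ˢ W 1) (c := fun _ => K4)
        (g := fun q x => pd q.1 (Zw q.2 v) (t, x)) (CC_rotD hf1 hf.2 i j)
        (fun q _ => ((hv.Zw _).pd _).cc ht) (fun _ _ => hK4) fun x => ?_).trans ?_
      · rw [← Finset.mul_sum, rotD, hfd, dxj_slice (hv.pd α).1, dxj_slice (hv.pd α).1]
        exact abs_om_le (mul_nonneg hK4 (derivSize_nonneg 1 v (t, x)))
          (fun k => h4 [k] (mem_W.2 (by simp)) v hv.1 α (t, x)) i j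
      · rw [← Finset.mul_sum]
        exact mul_le_mul_of_nonneg_left (le_add_of_nonneg_right (M2_nonneg _ _ _)) hK4
    have r2 (j : Fin 3) : L2 (dxj j f) ≤ Y := by
      rw [hfd, dxj_slice (hv.pd α).1]
      exact L2_pd_pd_le_YY c hv ht α j
    have r3 : ∫ x, (1 + ‖x‖ ^ 2) ^ 2 * f x ^ 6 ≤ (K2 * (1 + 3 + 9 * K4) * Y) ^ 6 := by
      refine (h2 f hf1 hf.2).trans ?_
      have q1 := L2_pd_le_YY c v t α
      have q2 := Finset.sum_le_sum fun j (_ : j ∈ Finset.univ) => r2 j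
      have q3 := Finset.sum_le_sum fun i (_ : i ∈ Finset.univ) =>
        Finset.sum_le_sum fun j (_ : j ∈ Finset.univ) => r1 i j
      simp only [Finset.sum_const, Finset.card_univ, Fintype.card_fin, nsmul_eq_mul] at q2 q3
      push_cast at q2 q3
      have q0 : 0 ≤ L2 f + ∑ j, L2 (dxj j f) + ∑ i, ∑ j, L2 (rotD i j f) :=
        add_nonneg (add_nonneg (L2_nonneg _) (Finset.sum_nonneg fun _ _ => L2_nonneg _))
          (Finset.sum_nonneg fun _ _ => Finset.sum_nonneg fun _ _ => L2_nonneg _)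
      refine pow_le_pow_left₀ (mul_nonneg hK2 q0) ?_ 6
      rw [mul_assoc]
      exact mul_le_mul_of_nonneg_left (by linarith) hK2
    have r4 : ∫ x, (wq c t x * f x) ^ 6 ≤ (K1 * Y) ^ 6 := (h1 ρ T v hv t ht c α).2
    have c1 : CC fun x => (wq c t x * f x) ^ 6 :=
      (hf.mul_left (contDiff_wq c t).continuous).pow (by norm_num)
    have c2 : CC fun x => (1 + ‖x‖ ^ 2) ^ 2 * f x ^ 6 :=
      (hf.pow (by norm_num)).mul_left (by fun_prop)
    have hτ : (jb t ^ (1 / 3 : ℝ)) ^ 12 = jb t ^ 4 := rpow_third_pow (jb_pos t).le 4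
    rw [hτ, ← integral_const_mul]
    set P := K1 + K2 * (1 + 3 + 9 * K4) with hP
    have hPn : 0 ≤ P := by positivity
    calc ∫ x, jb t ^ 4 * f x ^ 6
        ≤ ∫ x, 2 * K3 ^ 2 * ((wq c t x * f x) ^ 6 + (1 + ‖x‖ ^ 2) ^ 2 * f x ^ 6) := by
          refine integral_mono ((hf.pow (by norm_num)).const_mul _).integrable
            ((c1.add c2).const_mul _).integrable fun x => ?_
          have g1 := h3 t x
          have g2 := one_le_wt c t x
          have g4 := pow_le_pow_left₀ (sq_nonneg (jb t)) g1 2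
          have g5 : 0 ≤ f x ^ 6 := by positivity
          have g6 := mul_le_mul_of_nonneg_right g4 g5
          have g7 : (wt c t x + (1 + ‖x‖ ^ 2)) ^ 2 ≤ 2 * (wt c t x ^ 3 + (1 + ‖x‖ ^ 2) ^ 2) := by
            nlinarith [sq_nonneg (wt c t x - (1 + ‖x‖ ^ 2)),
              mul_nonneg (sub_nonneg.2 g2) (sq_nonneg (wt c t x))]
          have g8 := mul_le_mul_of_nonneg_right
            (mul_le_mul_of_nonneg_left g7 (sq_nonneg K3)) g5
          have g9 : (wq c t x * f x) ^ 6 = wt c t x ^ 3 * f x ^ 6 := by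
            rw [← wq_sq]
            ring
          simp only [g9]
          calc jb t ^ 4 * f x ^ 6 = (jb t ^ 2) ^ 2 * f x ^ 6 := by ring
            _ ≤ _ := g6
            _ = K3 ^ 2 * (wt c t x + (1 + ‖x‖ ^ 2)) ^ 2 * f x ^ 6 := by ring
            _ ≤ _ := g8
            _ = _ := by ring
      _ = 2 * K3 ^ 2 * ((∫ x, (wq c t x * f x) ^ 6) + ∫ x, (1 + ‖x‖ ^ 2) ^ 2 * f x ^ 6) := by
          rw [integral_const_mul, CC.integral_add c1 c2]
      _ ≤ 2 * K3 ^ 2 * ((K1 * Y) ^ 6 + (K2 * (1 + 3 + 9 * K4) * Y) ^ 6) := by gcongr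
      _ ≤ 2 * K3 ^ 2 * ((P * Y) ^ 6 + (P * Y) ^ 6) := by
          have : 0 ≤ K2 * (1 + 3 + 9 * K4) := by positivity
          gcongr <;> linarith
      _ = (4 * K3 ^ 2) * (P * Y) ^ 6 := by ring
      _ ≤ (2 * (K3 + 1)) ^ 6 * (P * Y) ^ 6 := by
          refine mul_le_mul_of_nonneg_right ?_ (by positivity)
          have : (2 * (K3 + 1)) ^ 2 ≤ (2 * (K3 + 1)) ^ 6 :=
            pow_le_pow_right₀ (by linarith) (by norm_num)
          nlinarith
      _ = (2 * (K3 + 1) * P * Y) ^ 6 := by ring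
      _ ≤ _ := by
          have : 0 ≤ 2 * (K3 + 1) * P * Y := by positivity
          gcongr
          linarith

lemma abs_form_le {ι κ : Type*} [Fintype ι] [Fintype κ] (H : ι → κ → ℝ) {a : ι → ℝ} {b : κ → ℝ}
    {A B : ℝ} (hA : 0 ≤ A) (ha : ∀ i, |a i| ≤ A) (hb : ∀ k, |b k| ≤ B) :
    |∑ i, ∑ k, H i k * a i * b k| ≤ (∑ i, ∑ k, |H i k|) * (A * B) := by
  refine (Finset.abs_sum_le_sum_abs _ _).trans ?_
  rw [Finset.sum_mul]
  refine Finset.sum_le_sum fun i _ => (Finset.abs_sum_le_sum_abs _ _).trans ?_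
  rw [Finset.sum_mul]
  refine Finset.sum_le_sum fun k _ => ?_
  rw [mul_assoc, abs_mul, abs_mul]
  gcongr
  · exact ha i
  · exact hb k

lemma abs_le_one_of_sum_sq {n : Fin 3 → ℝ} (hn : n 0 ^ 2 + n 1 ^ 2 + n 2 ^ 2 = 1) (j : Fin 3) :
    |n j| ≤ 1 := by
  rw [← sq_le_one_iff_abs_le_one, ← hn, ← Fin.sum_univ_three fun j => n j ^ 2]
  exact Finset.single_le_sum (f := fun j => n j ^ 2) (fun _ _ => sq_nonneg _) (Finset.mem_univ j)

lemma abs_nullForm_le {H : Fin 4 → Fin 4 → ℝ} (hH : nullCond 1 H) {n : Fin 3 → ℝ}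
    (hn : n 0 ^ 2 + n 1 ^ 2 + n 2 ^ 2 = 1) {a b : Fin 4 → ℝ} {A B A' B' : ℝ}
    (ha : ∀ α, |a α| ≤ A) (hb : ∀ α, |b α| ≤ B) (ha' : ∀ j, |a j.succ + n j * a 0| ≤ A')
    (hb' : ∀ j, |b j.succ + n j * b 0| ≤ B') :
    |∑ α, ∑ β, H α β * a α * b β| ≤ (∑ α, ∑ β, |H α β|) * (A * B' + A' * B) := by
  have hA := (abs_nonneg _).trans (ha 0)
  have hA' := (abs_nonneg _).trans (ha' 0)
  have hB' := (abs_nonneg _).trans (hb' 0)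
  have hn1 := abs_le_one_of_sum_sq hn
  set X : Fin 4 → ℝ := Fin.cons 1 fun j => -n j with hX
  have hX1 : ∀ α, |a 0 * X α| ≤ A := fun α => by
    rw [abs_mul]
    refine (mul_le_of_le_one_right (abs_nonneg _) ?_).trans (ha 0)
    refine Fin.cases ?_ (fun j => ?_) α
    · simp [hX]
    · simpa [hX] using hn1 j
  set a₁ : Fin 4 → ℝ := Fin.cons 0 fun j => a j.succ + n j * a 0 with ha1
  set b₁ : Fin 4 → ℝ := Fin.cons 0 fun j => b j.succ + n j * b 0 with hb1
  have ha1' : ∀ α, |a₁ α| ≤ A' := fun α => by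
    refine Fin.cases ?_ (fun j => ?_) α
    · simpa [ha1] using hA'
    · simpa [ha1] using ha' j
  have hb1' : ∀ α, |b₁ α| ≤ B' := fun α => by
    refine Fin.cases ?_ (fun j => ?_) α
    · simpa [hb1] using hB'
    · simpa [hb1] using hb' j
  have hXX : ∑ α, ∑ β, H α β * X α * X β = 0 := by
    refine hH X ?_
    have e0 : X 0 = 1 := rfl
    have e1 : X 1 = -n 0 := rfl
    have e2 : X 2 = -n 1 := rfl
    have e3 : X 3 = -n 2 := rfl
    rw [e0, e1, e2, e3]
    linarith
  have key : ∑ α, ∑ β, H α β * a α * b β =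
      (∑ α, ∑ β, H α β * (a 0 * X α) * b₁ β) + ∑ α, ∑ β, H α β * a₁ α * b β := by
    have e : a 0 * b 0 * (∑ α, ∑ β, H α β * X α * X β) = 0 := by rw [hXX, mul_zero]
    rw [← add_zero ((∑ α, ∑ β, H α β * (a 0 * X α) * b₁ β) + _), ← e, Finset.mul_sum,
      ← Finset.sum_add_distrib, ← Finset.sum_add_distrib]
    refine Finset.sum_congr rfl fun α _ => ?_
    rw [Finset.mul_sum, ← Finset.sum_add_distrib, ← Finset.sum_add_distrib]
    refine Finset.sum_congr rfl fun β _ => ?_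
    have eA : a α = a 0 * X α + a₁ α := by
      refine Fin.cases ?_ (fun j => ?_) α
      · simp [hX, ha1]
      · simp [hX, ha1]
        ring
    have eB : b β = b 0 * X β + b₁ β := by
      refine Fin.cases ?_ (fun j => ?_) β
      · simp [hX, hb1]
      · simp [hX, hb1]
        ring
    rw [eA, eB]
    ring
  rw [key, mul_add]
  exact (abs_add_le _ _).trans (add_le_add (abs_form_le H hA hX1 hb1')
    (abs_form_le H hA' ha1' hb))

/-- The functions controlling `⟨t⟩` times the good derivatives of `v` for speed one. -/
def good (t : ℝ) (v : Fn) : Fin 7 ⊕ Fin 4 → Sp → ℝ :=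
  Sum.elim (fun i x => Zop i v (t, x)) fun α x => wq 1 t x * pd α v (t, x)

lemma abs_good_le (t : ℝ) (v : Fn) (k : Fin 7 ⊕ Fin 4) (x : Sp) :
    |good t v k x| ≤ ∑ k, |good t v k x| :=
  Finset.single_le_sum (f := fun k => |good t v k x|) (fun _ _ => abs_nonneg _)
    (Finset.mem_univ k)

lemma exists_unit_vector (x : Sp) : ∃ n : Fin 3 → ℝ, n 0 ^ 2 + n 1 ^ 2 + n 2 ^ 2 = 1 ∧
    ∀ j, x j = ‖x‖ * n j := by
  rcases eq_or_ne x 0 with rfl | hx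
  · exact ⟨![1, 0, 0], by simp, by simp⟩
  · have h0 := norm_ne_zero_iff.2 hx
    refine ⟨fun j => x j / ‖x‖, ?_, fun j => by field_simp⟩
    have := norm_sq_eq_sum3 x
    field_simp
    linarith

lemma abs_mul_nullQ_le {H : Fin 4 → Fin 4 → ℝ} (hH : nullCond 1 H) (v w : Fn) {t : ℝ}
    (ht : 0 ≤ t) (x : Sp) :
    |jb t * nullQ H v w (t, x)| ≤ 8 * (∑ α, ∑ β, |H α β|) *
      ((∑ α, |pd α v (t, x)|) * (∑ k, |good t w k x|) +
        (∑ k, |good t v k x|) * ∑ α, |pd α w (t, x)|) := by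
  obtain ⟨n, hn, hx⟩ := exists_unit_vector x
  have hp (v : Fn) (α : Fin 4) : |pd α v (t, x)| ≤ ∑ α, |pd α v (t, x)| :=
    Finset.single_le_sum (f := fun α => |pd α v (t, x)|) (fun _ _ => abs_nonneg _)
      (Finset.mem_univ α)
  have hg (v : Fn) : 0 ≤ ∑ k, |good t v k x| := Finset.sum_nonneg fun _ _ => abs_nonneg _
  have hn1 := abs_le_one_of_sum_sq hn
  have hw (v : Fn) (α : Fin 4) : wq 1 t x * |pd α v (t, x)| ≤ ∑ k, |good t v k x| := by
    have := abs_good_le t v (Sum.inr α) x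
    rwa [good, Sum.elim_inr, abs_mul,
      abs_of_nonneg (zero_le_one.trans (one_le_wq 1 t x))] at this
  have hq := one_le_wq 1 t x
  have hT (v : Fn) (j : Fin 3) :
      |jb t * (pd j.succ v (t, x) + n j * pd 0 v (t, x))| ≤ 8 * ∑ k, |good t v k x| := by
    set G := ∑ k, |good t v k x| with hG
    have hZ (i : Fin 7) : |Zop i v (t, x)| ≤ G := abs_good_le t v (Sum.inl i) x
    have hO := abs_om_le (hg v) hZ
    have hS : |sOp v (t, x)| ≤ G := hZ 6
    have e1 (α : Fin 4) : |pd α v (t, x)| ≤ G := le_trans (by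
      nlinarith [abs_nonneg (pd α v (t, x))]) (hw v α)
    have e2 : |(t - ‖x‖) * pd j.succ v (t, x)| ≤ 2 * G := by
      have := abs_sub_le_wq 1 t x
      rw [one_mul] at this
      rw [abs_mul]
      nlinarith [hw v j.succ, mul_le_mul_of_nonneg_right this (abs_nonneg (pd j.succ v (t, x)))]
    have key : t * (pd j.succ v (t, x) + n j * pd 0 v (t, x)) =
        n j * sOp v (t, x) + (t - ‖x‖) * pd j.succ v (t, x) + ∑ k, n k * om k j v (t, x) := by
      simp only [sOp_eq, om_eq, hx, Fin.sum_univ_three]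
      linear_combination (-‖x‖ * pd j.succ v (t, x)) * hn
    have e3 : |∑ k, n k * om k j v (t, x)| ≤ 3 * G := by
      refine (Finset.abs_sum_le_sum_abs _ _).trans ?_
      refine (Finset.sum_le_card_nsmul _ _ G fun k _ => ?_).trans_eq (by simp)
      rw [abs_mul]
      exact (mul_le_of_le_one_left (abs_nonneg _) (hn1 k)).trans (hO k j)
    have e4 : |n j * sOp v (t, x)| ≤ G := by
      rw [abs_mul]
      exact (mul_le_of_le_one_left (abs_nonneg _) (hn1 j)).trans hS
    have e5 : |t * (pd j.succ v (t, x) + n j * pd 0 v (t, x))| ≤ 6 * G := by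
      rw [key]
      refine (abs_add_le _ _).trans ?_
      have := abs_add_le (n j * sOp v (t, x)) ((t - ‖x‖) * pd j.succ v (t, x))
      linarith
    have e6 : |pd j.succ v (t, x) + n j * pd 0 v (t, x)| ≤ 2 * G := by
      refine (abs_add_le _ _).trans ?_
      have := mul_le_mul (hn1 j) (e1 0) (abs_nonneg _) zero_le_one
      rw [← abs_mul] at this
      linarith [e1 j.succ]
    rw [abs_mul, abs_of_nonneg ht] at e5
    rw [abs_mul, abs_of_pos (jb_pos t)]
    have e7 := jb_le t
    rw [abs_of_nonneg ht] at e7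
    nlinarith [mul_le_mul_of_nonneg_right e7
      (abs_nonneg (pd j.succ v (t, x) + n j * pd 0 v (t, x)))]
  have hT' (v : Fn) (j : Fin 3) : |pd j.succ v (t, x) + n j * pd 0 v (t, x)| ≤
      8 * (∑ k, |good t v k x|) / jb t := by
    have := hT v j
    rw [abs_mul, abs_of_pos (jb_pos t)] at this
    rwa [le_div_iff₀ (jb_pos t), mul_comm]
  have hf := abs_nullForm_le hH hn (hp v) (hp w) (hT' v) (hT' w)
  rw [abs_mul, abs_of_pos (jb_pos t)]
  refine (mul_le_mul_of_nonneg_left hf (jb_pos t).le).trans_eq ?_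
  have := (jb_pos t).ne'
  field_simp

lemma exists_Bd6_good : ∃ K : ℝ, 0 ≤ K ∧ ∀ (ρ T : ℝ) (v : Fn), Adm ρ T v → ∀ t ∈ Ioo 0 T,
    ∀ k, Bd6 (K * YY 1 v t) (good t v k) := by
  obtain ⟨K1, hK1, h1⟩ := exists_Bd6_Zop
  obtain ⟨K2, hK2, h2⟩ := exists_Bd6_wq_pd
  refine ⟨K1 + K2, by positivity, fun ρ T v hv t ht k => ?_⟩
  have hY := YY_nonneg 1 v t
  rcases k with i | α
  · exact (h1 ρ T v hv t ht 1 i).mono (by positivity) (by nlinarith)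
  · exact (h2 ρ T v hv t ht 1 α).mono (by positivity) (by nlinarith)

/-- Bilinear estimate for null forms: the extra decay `⟨t⟩^{-1/3}` is gained. -/
lemma exists_L2_nullQ_le {H : Fin 4 → Fin 4 → ℝ} (hH : nullCond 1 H) :
    ∃ K : ℝ, 0 ≤ K ∧ ∀ (ρ T : ℝ) (v w : Fn), Adm ρ T v → Adm ρ T w → ∀ t ∈ Ioo 0 T,
      jb t ^ (1 / 3 : ℝ) * (jb t * L2 fun x => nullQ H v w (t, x)) ≤
        K * (YY 1 v t * YY 1 w t) := by
  obtain ⟨K1, hK1, h1⟩ := exists_Bd6_good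
  obtain ⟨K2, hK2, h2⟩ := exists_Bd_pd one_pos
  obtain ⟨h, hh⟩ : ∃ h : ℝ, h = ∑ α, ∑ β, |H α β| := ⟨_, rfl⟩
  have hh0 : 0 ≤ h := hh ▸ Finset.sum_nonneg fun _ _ => Finset.sum_nonneg fun _ _ => abs_nonneg _
  refine ⟨8 * h * (44 * (K1 * K2) + 44 * (K1 * K2)), by positivity,
    fun ρ T v w hv hw t ht => ?_⟩
  have cg (v : Fn) (hv : Adm ρ T v) (k) : CC (good t v k) := (h1 ρ T v hv t ht k).1
  have cp (v : Fn) (hv : Adm ρ T v) (α : Fin 4) : CC fun x => pd α v (t, x) := (hv.pd α).cc ht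
  have s0 : 0 ≤ jb t ^ (1 / 3 : ℝ) := Real.rpow_nonneg (jb_pos t).le _
  have est (v w : Fn) (hv : Adm ρ T v) (hw : Adm ρ T w) (q : (Fin 7 ⊕ Fin 4) × Fin 4) :
      jb t ^ (1 / 3 : ℝ) * L2 (fun x => good t v q.1 x * pd q.2 w (t, x)) ≤
        K1 * K2 * (YY 1 v t * YY 1 w t) := by
    have := YY_nonneg 1 v t
    have := YY_nonneg 1 w t
    refine (Bd6.mul_Bd s0 (by positivity) (by positivity) (h1 ρ T v hv t ht q.1)
      (h2 ρ T w hw t ht q.2)).trans_eq ?_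
    ring
  have cQ : CC fun x => nullQ H v w (t, x) := by
    refine CC.sum _ fun α _ => CC.sum _ fun β _ => ?_
    exact ((cp v hv α).const_mul _).mul_right (cp w hw β).1
  rw [← L2_const_mul (jb_pos t).le]
  have key := L2_le_sum (Finset.univ : Finset (Bool × (Fin 7 ⊕ Fin 4) × Fin 4))
    (f := fun x => jb t * nullQ H v w (t, x)) (c := fun _ => 8 * h)
    (g := fun b x => if b.1 then good t v b.2.1 x * pd b.2.2 w (t, x) else
      good t w b.2.1 x * pd b.2.2 v (t, x)) (cQ.const_mul _)
    (fun b _ => by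
      rcases b with ⟨_ | _, q⟩
      · exact (cg w hw q.1).mul_right (cp v hv q.2).1
      · exact (cg v hv q.1).mul_right (cp w hw q.2).1)
    (fun _ _ => by positivity) (fun x => by
      refine (abs_mul_nullQ_le hH v w ht.1.le x).trans_eq ?_
      rw [← hh, ← Finset.mul_sum, Fintype.sum_prod_type, Fintype.sum_bool]
      simp only [Bool.false_eq_true, if_true, if_false, Fintype.sum_prod_type, abs_mul,
        ← Finset.mul_sum, ← Finset.sum_mul]
      ring)
  refine (mul_le_mul_of_nonneg_left key s0).trans ?_
  rw [← Finset.mul_sum, Fintype.sum_prod_type, Fintype.sum_bool]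
  simp only [Bool.false_eq_true, if_true, if_false]
  have f1 := Finset.sum_le_card_nsmul Finset.univ _ _ fun q _ => est v w hv hw q
  have f2 := Finset.sum_le_card_nsmul Finset.univ _ _ fun q _ => est w v hw hv q
  rw [← Finset.mul_sum] at f1 f2
  have hc : (Finset.univ : Finset ((Fin 7 ⊕ Fin 4) × Fin 4)).card = 44 := by simp
  rw [hc, nsmul_eq_mul] at f1 f2
  push_cast at f1 f2
  nlinarith [mul_le_mul_of_nonneg_left (add_le_add f1 f2) (show 0 ≤ 8 * h by positivity)]

/-- Bilinear estimate without structure. -/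
lemma exists_L2_nullQ_le' {c c' : ℝ} (hc : 0 < c) (hc' : 0 < c') (H : Fin 4 → Fin 4 → ℝ) :
    ∃ K : ℝ, 0 ≤ K ∧ ∀ (ρ T : ℝ) (v w : Fn), Adm ρ T v → Adm ρ T w → ∀ t ∈ Ioo 0 T,
      jb t * L2 (fun x => nullQ H v w (t, x)) ≤ K * (YY c v t * YY c' w t) := by
  obtain ⟨K1, hK1, h1⟩ := exists_Bd_pd hc
  obtain ⟨K2, hK2, h2⟩ := exists_Bd_pd hc'
  refine ⟨∑ q : Fin 4 × Fin 4, |H q.1 q.2| * (K1 * K2), by positivity,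
    fun ρ T v w hv hw t ht => ?_⟩
  have cp (v : Fn) (hv : Adm ρ T v) (α : Fin 4) : CC fun x => pd α v (t, x) := (hv.pd α).cc ht
  have s0 : 0 ≤ jb t ^ (1 / 3 : ℝ) := Real.rpow_nonneg (jb_pos t).le _
  have s3 : (jb t ^ (1 / 3 : ℝ)) ^ 3 = jb t := by
    have := rpow_third_pow (jb_pos t).le 1
    simpa using this
  have key := L2_le_sum (Finset.univ : Finset (Fin 4 × Fin 4))
    (f := fun x => nullQ H v w (t, x)) (c := fun q => |H q.1 q.2|)
    (g := fun q x => pd q.1 v (t, x) * pd q.2 w (t, x))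
    (CC.sum _ fun α _ => CC.sum _ fun β _ => ((cp v hv α).const_mul _).mul_right (cp w hw β).1)
    (fun q _ => (cp v hv q.1).mul_right (cp w hw q.2).1)
    (fun _ _ => abs_nonneg _) (fun x => by
      rw [Fintype.sum_prod_type]
      refine (Finset.abs_sum_le_sum_abs _ _).trans (Finset.sum_le_sum fun α _ => ?_)
      refine (Finset.abs_sum_le_sum_abs _ _).trans (Finset.sum_le_sum fun β _ => ?_)
      rw [mul_assoc, abs_mul])
  refine (mul_le_mul_of_nonneg_left key (jb_pos t).le).trans ?_
  rw [Finset.mul_sum, Finset.sum_mul]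
  refine Finset.sum_le_sum fun q _ => ?_
  have y1 := YY_nonneg c v t
  have y2 := YY_nonneg c' w t
  have := Bd.bilinear s0 (by positivity) (by positivity) (h1 ρ T v hv t ht q.1)
    (h2 ρ T w hw t ht q.2)
  rw [s3] at this
  calc _ = |H q.1 q.2| * (jb t * L2 fun x => pd q.1 v (t, x) * pd q.2 w (t, x)) := by ring
    _ ≤ |H q.1 q.2| * (K1 * YY c v t * (K2 * YY c' w t)) := by gcongr
    _ = _ := by ring

lemma Bd.mono {s A B : ℝ} {f : Sp → ℝ} (h : Bd s A f) (hA : 0 ≤ A) (hAB : A ≤ B) : Bd s B f :=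
  ⟨h.1, h.2.1.trans (pow_le_pow_left₀ hA hAB 2), h.2.2.trans (pow_le_pow_left₀ hA hAB 6)⟩

lemma exists_Zop_eq_pd (j : Fin 3) : ∃ i : Fin 7, ∀ v : Fn, Zop i v = pd j.succ v := by
  fin_cases j
  · exact ⟨0, fun _ => rfl⟩
  · exact ⟨1, fun _ => rfl⟩
  · exact ⟨2, fun _ => rfl⟩

lemma exists_Bd_pd_Zw {c : ℝ} (hc : 0 < c) (m : ℕ) : ∃ K : ℝ, 0 ≤ K ∧ ∀ (ρ T : ℝ) (v : Fn),
    Adm ρ T v → ∀ t ∈ Ioo 0 T, ∀ (α : Fin 4) (l : List (Fin 7)), l.length ≤ m →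
      Bd (jb t ^ (1 / 3 : ℝ)) (K * XX m c v t) fun x => pd α (Zw l v) (t, x) := by
  obtain ⟨K1, hK1, h1⟩ := exists_Bd_pd hc
  obtain ⟨K2, hK2, h2⟩ := exists_YY_Zw_le m
  refine ⟨K1 * K2, by positivity, fun ρ T v hv t ht α l hl => ?_⟩
  have hY := YY_nonneg c (Zw l v) t
  refine (h1 ρ T _ (hv.Zw l) t ht α).mono (by positivity) ?_
  rw [mul_assoc]
  exact mul_le_mul_of_nonneg_left (h2 c v t l hl) hK1

lemma exists_abs_pd_le_XX {c : ℝ} (hc : 0 < c) : ∃ K : ℝ, 0 ≤ K ∧ ∀ (ρ T : ℝ) (v : Fn),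
    Adm ρ T v → ∀ t ∈ Ioo 0 T, ∀ (α : Fin 4) (x : Sp),
      (jb t ^ (1 / 3 : ℝ)) ^ 2 * |pd α v (t, x)| ≤ K * XX 1 c v t := by
  obtain ⟨K1, hK1, h1⟩ := exists_Bd_pd_Zw hc 1
  obtain ⟨K2, hK2, h2⟩ := exists_pow_six_le_integral
  refine ⟨(1 + K2 * 28) * K1, by positivity, fun ρ T v hv t ht α x => ?_⟩
  have hf1 := (hv.pd α).contDiff_slice_one t
  have hfc := (hv.pd α).cc ht
  set s := jb t ^ (1 / 3 : ℝ) with hs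
  have s0 : 0 ≤ s := Real.rpow_nonneg (jb_pos t).le _
  set A := K1 * XX 1 c v t with hA
  have hX := XX_nonneg 1 c v t
  have hA0 : 0 ≤ A := by positivity
  have b0 : Bd s A fun x => pd α v (t, x) := by
    have := h1 ρ T v hv t ht α [] (by simp)
    rwa [Zw_nil] at this
  have b1 (j : Fin 3) : Bd s A (dxj j fun x => pd α v (t, x)) := by
    obtain ⟨i, hi⟩ := exists_Zop_eq_pd j
    have := h1 ρ T v hv t ht α [i] (by simp)
    rwa [Zw_cons, Zw_nil, hi, ← pd_comm hv.1, ← dxj_slice (hv.pd α).1] at this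
  set f : Sp → ℝ := fun x => pd α v (t, x) with hfd
  have p0 : (0 : ℝ) < 6 := by norm_num
  have g1 : ∫ x, (f x ^ 6 + ‖fderiv ℝ f x‖ ^ 6) ≤
      ∫ x, (f x ^ 6 + ∑ j, 9 * dxj j f x ^ 6) := by
    have c6 : CC fun x => f x ^ 6 := hfc.pow (by norm_num)
    have cd : CC fun x => ∑ j, 9 * dxj j f x ^ 6 :=
      CC.sum _ fun j _ => ((b1 j).1.pow (by norm_num)).const_mul _
    have cf : CC fun x => ‖fderiv ℝ f x‖ ^ 6 :=
      ⟨(hf1.continuous_fderiv one_ne_zero).norm.pow 6,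
        (hfc.2.fderiv ℝ).comp_left (g := fun L => ‖L‖ ^ 6) (by simp)⟩
    refine integral_mono (c6.add cf).integrable (c6.add cd).integrable fun x => ?_
    have e := pow_le_pow_left₀ (sq_nonneg _) (norm_fderiv_sq_le f x) 3
    simp only [Fin.sum_univ_three] at e ⊢
    have e2 : (dxj 0 f x ^ 2 + dxj 1 f x ^ 2 + dxj 2 f x ^ 2) ^ 3 ≤
        9 * dxj 0 f x ^ 6 + 9 * dxj 1 f x ^ 6 + 9 * dxj 2 f x ^ 6 := by
      have h3 : ∀ a b c : ℝ, 0 ≤ a → 0 ≤ b → 0 ≤ c →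
          (a + b + c) ^ 3 ≤ 9 * a ^ 3 + 9 * b ^ 3 + 9 * c ^ 3 := by
        intro a b c ha hb hc
        nlinarith [mul_nonneg (add_nonneg ha hb) (sq_nonneg (a - b)),
          mul_nonneg (add_nonneg hc hb) (sq_nonneg (c - b)),
          mul_nonneg (add_nonneg ha hc) (sq_nonneg (a - c)),
          mul_nonneg ha (sq_nonneg (a - b)), mul_nonneg ha (sq_nonneg (a - c)),
          mul_nonneg ha (sq_nonneg (b - c)), mul_nonneg hb (sq_nonneg (a - c)),
          mul_nonneg hc (sq_nonneg (a - b))]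
      have := h3 _ _ _ (sq_nonneg (dxj 0 f x)) (sq_nonneg (dxj 1 f x)) (sq_nonneg (dxj 2 f x))
      refine this.trans_eq ?_
      ring
    have e3 : ‖fderiv ℝ f x‖ ^ 6 = (‖fderiv ℝ f x‖ ^ 2) ^ 3 := by ring
    rw [e3]
    linarith
  have g2 : ∫ x, (f x ^ 6 + ∑ j, 9 * dxj j f x ^ 6) =
      (∫ x, f x ^ 6) + ∑ j, 9 * ∫ x, dxj j f x ^ 6 := by
    have cd (j : Fin 3) : CC fun x => 9 * dxj j f x ^ 6 :=
      ((b1 j).1.pow (by norm_num)).const_mul _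
    rw [CC.integral_add (hfc.pow (by norm_num)) (CC.sum _ fun j _ => cd j),
      integral_finsetSum _ fun j _ => (cd j).integrable]
    simp only [integral_const_mul]
  have g3 := h2 f hf1 hfc.2 x
  have g4 : s ^ 12 * f x ^ 6 ≤ K2 * 28 * A ^ 6 := by
    have q0 := b0.2.2
    have q1 (j : Fin 3) := (b1 j).2.2
    have r := Finset.sum_le_sum fun j (_ : j ∈ Finset.univ) =>
      mul_le_mul_of_nonneg_left (q1 j) (show (0 : ℝ) ≤ 9 by norm_num)
    have r2 : s ^ 12 * ∫ x, (f x ^ 6 + ‖fderiv ℝ f x‖ ^ 6) ≤ 28 * A ^ 6 := by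
      refine (mul_le_mul_of_nonneg_left (g1.trans_eq g2) (by positivity)).trans ?_
      simp only [Fin.sum_univ_three] at r ⊢
      linarith
    calc s ^ 12 * f x ^ 6 ≤ s ^ 12 * (K2 * ∫ x, (f x ^ 6 + ‖fderiv ℝ f x‖ ^ 6)) := by gcongr
      _ = K2 * (s ^ 12 * ∫ x, (f x ^ 6 + ‖fderiv ℝ f x‖ ^ 6)) := by ring
      _ ≤ K2 * (28 * A ^ 6) := by gcongr
      _ = _ := by ring
  have g5 : (s ^ 2 * |f x|) ^ 6 ≤ ((1 + K2 * 28) * A) ^ 6 := by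
    have e1 : (s ^ 2 * |f x|) ^ 6 = s ^ 12 * f x ^ 6 := by
      rw [mul_pow, ← pow_mul, Even.pow_abs (by decide)]
    have e2 : 1 + K2 * 28 ≤ (1 + K2 * 28) ^ 6 := le_self_pow₀ (by linarith) (by norm_num)
    rw [e1, mul_pow]
    have e3 : 0 ≤ A ^ 6 := by positivity
    nlinarith
  have := (pow_le_pow_iff_left₀ (by positivity) (by positivity) (by norm_num)).1 g5
  rwa [hA, ← mul_assoc] at this

/-- The sum over the components of the norms `XX`. -/
def SX (m : ℕ) (c0 : ℝ) (u : Fin 3 → Fn) (t : ℝ) : ℝ :=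
  ∑ j, XX m (cspeed c0 j) (u j) t

lemma SX_nonneg (m : ℕ) (c0 : ℝ) (u : Fin 3 → Fn) (t : ℝ) : 0 ≤ SX m c0 u t :=
  Finset.sum_nonneg fun _ _ => XX_nonneg _ _ _ _

lemma XX_le_SX (m : ℕ) (c0 : ℝ) (u : Fin 3 → Fn) (t : ℝ) (j : Fin 3) :
    XX m (cspeed c0 j) (u j) t ≤ SX m c0 u t :=
  Finset.single_le_sum (f := fun j => XX m (cspeed c0 j) (u j) t)
    (fun _ _ => XX_nonneg _ _ _ _) (Finset.mem_univ j)

lemma cspeed_pos {c0 : ℝ} (hc0 : 0 < c0) (j : Fin 3) : 0 < cspeed c0 j := by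
  fin_cases j
  · exact one_pos
  · exact one_pos
  · exact hc0

lemma exists_uniform_fin {P : Fin 3 → ℝ → Prop} (hP : ∀ k c d, c ≤ d → P k c → P k d)
    (h : ∀ k, ∃ C : ℝ, 0 ≤ C ∧ P k C) : ∃ C : ℝ, 0 ≤ C ∧ ∀ k, P k C := by
  obtain ⟨C, hC, H⟩ := exists_uniform_of_finset Finset.univ hP fun k _ => h k
  exact ⟨C, hC, fun k => H k (Finset.mem_univ k)⟩

lemma exists_Bd_pd_Zw_system {c0 : ℝ} (hc0 : 0 < c0) (m : ℕ) : ∃ K : ℝ, 0 ≤ K ∧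
    ∀ (ρ T : ℝ) (u : Fin 3 → Fn), (∀ j, Adm ρ T (u j)) → ∀ t ∈ Ioo 0 T, ∀ (j : Fin 3)
      (α : Fin 4) (l : List (Fin 7)), l.length ≤ m →
      Bd (jb t ^ (1 / 3 : ℝ)) (K * SX m c0 u t) fun x => pd α (Zw l (u j)) (t, x) := by
  choose K hK h using fun j => exists_Bd_pd_Zw (cspeed_pos hc0 j) m
  have hK' (j) : K j ≤ ∑ j, K j :=
    Finset.single_le_sum (f := K) (fun j _ => hK j) (Finset.mem_univ j)
  refine ⟨∑ j, K j, Finset.sum_nonneg fun j _ => hK j, fun ρ T u hu t ht j α l hl => ?_⟩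
  have hX := XX_nonneg m (cspeed c0 j) (u j) t
  refine (h j ρ T _ (hu j) t ht α l hl).mono (mul_nonneg (hK j) hX) ?_
  exact mul_le_mul (hK' j) (XX_le_SX m c0 u t j) hX (Finset.sum_nonneg fun j _ => hK j)

lemma Adm.cubicEval {P : MvPolynomial (Fin 3 × Fin 4) ℝ} (hP : CubicLike P) {ρ T : ℝ}
    {u : Fin 3 → Fn} (hu : ∀ j, Adm ρ T (u j)) : Adm ρ T (cubicEval P u) := by
  refine ⟨contDiff_cubicEval P fun j => (hu j).1, fun p hp => ?_⟩
  obtain ⟨C, -, h⟩ := OrdGE.exists_abs_cubicEval_le (k := 3) hP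
  have h0 : gradSize 0 u p = 0 := Finset.sum_eq_zero fun j _ => Finset.sum_eq_zero fun q _ => by
    rw [abs_eq_zero]
    exact (((hu j).Zw q.2).pd q.1).2 hp
  have := h u p (h0.trans_le zero_le_one)
  rw [h0, zero_pow three_ne_zero, mul_zero] at this
  exact abs_eq_zero.1 (le_antisymm this (abs_nonneg _))

/-- Trilinear estimate for the higher order terms. -/
lemma exists_L2_cubic_le {c0 : ℝ} (hc0 : 0 < c0) {P : MvPolynomial (Fin 3 × Fin 4) ℝ}
    (hP : CubicLike P) {m : ℕ} (hm : m = 1 ∨ m = 2) {l : List (Fin 7)} (hl : l.length ≤ m) :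
    ∃ K : ℝ, 0 ≤ K ∧ ∀ (ρ T : ℝ) (u : Fin 3 → Fn), (∀ j, Adm ρ T (u j)) → ∀ t ∈ Ioo 0 T,
      (∀ x, gradSize 0 u (t, x) ≤ 1) →
      jb t ^ 2 * L2 (fun x => Zw l (cubicEval P u) (t, x)) ≤
        K * (SX m c0 u t * SX 1 c0 u t * SX 1 c0 u t) := by
  obtain ⟨C, hC, h⟩ := hP.exists_abs_Zw_le hm hl
  obtain ⟨K1, hK1, h1⟩ := exists_Bd_pd_Zw_system hc0 m
  obtain ⟨K2, hK2, h2⟩ := exists_Bd_pd_Zw_system hc0 1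
  let G (k : ℕ) : Finset (Fin 3 × Fin 4 × List (Fin 7)) :=
    Finset.univ ×ˢ (Finset.univ ×ˢ W k)
  refine ⟨((G m ×ˢ G 1 ×ˢ G 1).card : ℝ) * (C * (K1 * K2 * K2)), by positivity,
    fun ρ T u hu t ht hsm => ?_⟩
  have S1 := SX_nonneg 1 c0 u t
  have Sm := SX_nonneg m c0 u t
  have s0 : 0 ≤ jb t ^ (1 / 3 : ℝ) := Real.rpow_nonneg (jb_pos t).le _
  have s6 : (jb t ^ (1 / 3 : ℝ)) ^ 6 = jb t ^ 2 := rpow_third_pow (jb_pos t).le 2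
  have hu' (j) := (hu j).1
  let D (b : Fin 3 × Fin 4 × List (Fin 7)) (x : Sp) : ℝ := pd b.2.1 (Zw b.2.2 (u b.1)) (t, x)
  have hD (b) : CC (D b) := (((hu b.1).Zw b.2.2).pd b.2.1).cc ht
  have hDD (b : (Fin 3 × Fin 4 × List (Fin 7)) × (Fin 3 × Fin 4 × List (Fin 7)) ×
      (Fin 3 × Fin 4 × List (Fin 7))) : CC fun x => D b.1 x * D b.2.1 x * D b.2.2 x :=
    ((hD b.1).mul_right (hD b.2.1).1).mul_right (hD b.2.2).1
  have hG (k : ℕ) (x : Sp) : gradSize k u (t, x) = ∑ b ∈ G k, |D b x| := by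
    rw [Finset.sum_product]
    rfl
  have bound (x : Sp) : |Zw l (cubicEval P u) (t, x)| ≤
      ∑ b ∈ G m ×ˢ G 1 ×ˢ G 1, C * |D b.1 x * D b.2.1 x * D b.2.2 x| := by
    refine (h u hu' _ (hsm x)).trans_eq ?_
    rw [hG, hG, ← Finset.mul_sum]
    simp only [Finset.sum_product, abs_mul, ← Finset.mul_sum, ← Finset.sum_mul]
  have cf : CC fun x => Zw l (cubicEval P u) (t, x) := ((Adm.cubicEval hP hu).Zw l).cc ht
  have key := L2_le_sum (G m ×ˢ G 1 ×ˢ G 1) cf (fun b _ => hDD b) (fun _ _ => hC) bound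
  refine (mul_le_mul_of_nonneg_left key (by positivity)).trans ?_
  rw [Finset.mul_sum, mul_assoc, ← nsmul_eq_mul]
  refine Finset.sum_le_card_nsmul _ _ _ fun b hb => ?_
  simp only [Finset.mem_product, Finset.mem_univ, true_and, G, mem_W] at hb
  have := Bd.trilinear s0 (by positivity) (by positivity) (by positivity)
    (h1 ρ T u hu t ht b.1.1 b.1.2.1 b.1.2.2 hb.1)
    (h2 ρ T u hu t ht b.2.1.1 b.2.1.2.1 b.2.1.2.2 hb.2.1)
    (h2 ρ T u hu t ht b.2.2.1 b.2.2.2.1 b.2.2.2.2 hb.2.2)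
  rw [s6] at this
  calc _ = C * (jb t ^ 2 * L2 fun x => D b.1 x * D b.2.1 x * D b.2.2 x) := by ring
    _ ≤ C * (K1 * SX m c0 u t * (K2 * SX 1 c0 u t) * (K2 * SX 1 c0 u t)) := by gcongr
    _ = _ := by ring

lemma exists_gradSize_zero_le {c0 : ℝ} (hc0 : 0 < c0) : ∃ K : ℝ, 0 ≤ K ∧
    ∀ (ρ T : ℝ) (u : Fin 3 → Fn), (∀ j, Adm ρ T (u j)) → ∀ t ∈ Ioo 0 T, ∀ x,
      (jb t ^ (1 / 3 : ℝ)) ^ 2 * gradSize 0 u (t, x) ≤ K * SX 1 c0 u t := by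
  choose K hK h using fun j => exists_abs_pd_le_XX (cspeed_pos hc0 j)
  have hW : W 0 = {[]} := by
    ext l
    simp [mem_W]
  refine ⟨4 * ∑ j, K j, mul_nonneg (by norm_num) (Finset.sum_nonneg fun j _ => hK j),
    fun ρ T u hu t ht x => ?_⟩
  rw [gradSize, SX, Finset.mul_sum, Finset.mul_sum]
  refine Finset.sum_le_sum fun j _ => ?_
  rw [hW, Finset.sum_product, Finset.mul_sum, mul_assoc]
  have hX := XX_nonneg 1 (cspeed c0 j) (u j) t
  have hK' : K j ≤ ∑ j, K j :=
    Finset.single_le_sum (f := K) (fun j _ => hK j) (Finset.mem_univ j)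
  have := Finset.sum_le_card_nsmul (Finset.univ : Finset (Fin 4)) _ _ fun α _ =>
    (h j ρ T _ (hu j) t ht α x).trans (mul_le_mul_of_nonneg_right hK' hX)
  simpa [Zw_nil] using this

lemma Zw_add {f g : Fn} (hf : ContDiff ℝ (⊤ : ℕ∞) f) (hg : ContDiff ℝ (⊤ : ℕ∞) g)
    (l : List (Fin 7)) : Zw l (fun q => f q + g q) = fun p => Zw l f p + Zw l g p := by
  induction l with
  | nil => rfl
  | cons i l ih =>
    rw [Zw_cons, ih, Zw_cons, Zw_cons]
    exact funext fun p => Zop_add (contDiff_Zw hf l) (contDiff_Zw hg l) i p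

lemma Zw_finset_sum {κ : Type*} (s : Finset κ) {f : κ → Fn}
    (hf : ∀ k ∈ s, ContDiff ℝ (⊤ : ℕ∞) (f k)) (l : List (Fin 7)) :
    Zw l (fun q => ∑ k ∈ s, f k q) = fun p => ∑ k ∈ s, Zw l (f k) p := by
  induction l with
  | nil => rfl
  | cons i l ih =>
    rw [Zw_cons, ih]
    simp only [Zw_cons]
    exact funext fun p => Zop_finset_sum s (fun k hk => contDiff_Zw (hf k hk) l) i p

lemma Zw_zero (l : List (Fin 7)) : Zw l 0 = 0 := by
  induction l with
  | nil => rfl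
  | cons i l ih => rw [Zw_cons, ih, Zop_zero]

lemma Adm.nullQ {ρ T : ℝ} {v w : Fn} (H : Fin 4 → Fin 4 → ℝ) (hv : Adm ρ T v)
    (hw : Adm ρ T w) : Adm ρ T (nullQ H v w) := by
  refine ⟨contDiff_nullQ H hv.1 hw.1, fun p hp => ?_⟩
  refine Finset.sum_eq_zero fun α _ => Finset.sum_eq_zero fun β _ => ?_
  rw [(hv.pd α).2 hp]
  simp

lemma exists_Zw_nullQ_fin (H : Fin 4 → Fin 4 → ℝ) (l : List (Fin 7)) :
    ∃ (n : ℕ) (H' : Fin n → Fin 4 → Fin 4 → ℝ) (a b : Fin n → List (Fin 7)),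
      (∀ i, (nullCond 1 H → nullCond 1 (H' i)) ∧ (a i).length + (b i).length ≤ l.length) ∧
      ∀ v w : Fn, ContDiff ℝ (⊤ : ℕ∞) v → ContDiff ℝ (⊤ : ℕ∞) w →
        Zw l (nullQ H v w) =
          fun p => ∑ i, nullQ (H' i) (Zw (a i) v) (Zw (b i) w) p := by
  obtain ⟨L, hL, hsum⟩ := exists_Zw_nullQ H l
  refine ⟨L.length, fun i => (L.get i).1, fun i => (L.get i).2.1, fun i => (L.get i).2.2,
    fun i => hL _ (L.get_mem i), fun v w hv hw => ?_⟩
  funext p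
  rw [hsum v w hv hw]
  exact (Fin.sum_univ_fun_getElem L
    fun T => nullQ T.1 (Zw T.2.1 v) (Zw T.2.2 w) p).symm

lemma exists_L2_Zw_nullQ_le {c c' : ℝ} (H : Fin 4 → Fin 4 → ℝ) {m : ℕ} (hm : m = 1 ∨ m = 2)
    {l : List (Fin 7)} (hl : l.length ≤ m) {a : ℝ → ℝ} (ha : ∀ t, 0 ≤ a t)
    (h : ∀ H', (nullCond 1 H → nullCond 1 H') → ∃ K : ℝ, 0 ≤ K ∧ ∀ (ρ T : ℝ) (v w : Fn),
      Adm ρ T v → Adm ρ T w → ∀ t ∈ Ioo 0 T,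
        a t * L2 (fun x => nullQ H' v w (t, x)) ≤ K * (YY c v t * YY c' w t)) :
    ∃ K : ℝ, 0 ≤ K ∧ ∀ (ρ T : ℝ) (v w : Fn), Adm ρ T v → Adm ρ T w → ∀ t ∈ Ioo 0 T,
      a t * L2 (fun x => Zw l (nullQ H v w) (t, x)) ≤
        K * (XX 1 c v t * XX m c' w t + XX m c v t * XX 1 c' w t) := by
  obtain ⟨n, H', p, q, hL, hsum⟩ := exists_Zw_nullQ_fin H l
  choose K hK hb using fun i => h (H' i) (hL i).1
  obtain ⟨K1, hK1, h1⟩ := exists_YY_Zw_le 1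
  obtain ⟨K2, hK2, h2⟩ := exists_YY_Zw_le m
  refine ⟨∑ i, K i * (K1 * K2), Finset.sum_nonneg fun i _ =>
    mul_nonneg (hK i) (mul_nonneg hK1 hK2), fun ρ T v w hv hw t ht => ?_⟩
  have key := L2_le_sum Finset.univ (c := fun _ => 1)
    (g := fun i x => nullQ (H' i) (Zw (p i) v) (Zw (q i) w) (t, x))
    (((Adm.nullQ H hv hw).Zw l).cc ht)
    (fun i _ => (Adm.nullQ _ (hv.Zw _) (hw.Zw _)).cc ht) (fun _ _ => zero_le_one) (fun x => by
      rw [hsum v w hv.1 hw.1]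
      simp only [one_mul]
      exact Finset.abs_sum_le_sum_abs _ _)
  refine (mul_le_mul_of_nonneg_left key (ha t)).trans ?_
  rw [Finset.mul_sum, Finset.sum_mul]
  refine Finset.sum_le_sum fun i _ => ?_
  rw [one_mul]
  refine (hb i ρ T _ _ (hv.Zw _) (hw.Zw _) t ht).trans ?_
  rw [mul_assoc]
  refine mul_le_mul_of_nonneg_left ?_ (hK i)
  have hlen := (hL i).2
  have n1 := XX_nonneg 1 c v t
  have n2 := XX_nonneg m c v t
  have n3 := XX_nonneg 1 c' w t
  have n4 := XX_nonneg m c' w t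
  rcases le_or_gt (p i).length 1 with hle | hgt
  · refine (mul_le_mul (h1 c v t _ hle) (h2 c' w t (q i) (by omega)) (YY_nonneg _ _ _)
      (by positivity)).trans ?_
    have : 0 ≤ K1 * K2 * (XX m c v t * XX 1 c' w t) := by positivity
    linarith
  · refine (mul_le_mul (h2 c v t (p i) (by omega)) (h1 c' w t (q i) (by omega))
      (YY_nonneg _ _ _) (by positivity)).trans ?_
    have : 0 ≤ K1 * K2 * (XX 1 c v t * XX m c' w t) := by positivity
    linarith

/-- The sum over the components of the norms `XX`, with the weights `⟨t⟩^{-σ_i}`. -/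
def SW (m : ℕ) (c0 δ : ℝ) (u : Fin 3 → Fn) (t : ℝ) : ℝ :=
  ∑ j, jb t ^ (-sig δ j) * XX m (cspeed c0 j) (u j) t

lemma SW_nonneg (m : ℕ) (c0 δ : ℝ) (u : Fin 3 → Fn) (t : ℝ) : 0 ≤ SW m c0 δ u t :=
  Finset.sum_nonneg fun _ _ => mul_nonneg (Real.rpow_nonneg (jb_pos t).le _) (XX_nonneg _ _ _ _)

lemma XX_le_SW (m : ℕ) (c0 δ : ℝ) (u : Fin 3 → Fn) (t : ℝ) (j : Fin 3) :
    XX m (cspeed c0 j) (u j) t ≤ jb t ^ sig δ j * SW m c0 δ u t := by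
  have h := Finset.single_le_sum (f := fun j => jb t ^ (-sig δ j) * XX m (cspeed c0 j) (u j) t)
    (fun _ _ => mul_nonneg (Real.rpow_nonneg (jb_pos t).le _) (XX_nonneg _ _ _ _))
    (Finset.mem_univ j)
  have h2 := mul_le_mul_of_nonneg_left h (Real.rpow_nonneg (jb_pos t).le (sig δ j))
  rwa [← mul_assoc, ← Real.rpow_add (jb_pos t), add_neg_cancel, Real.rpow_zero, one_mul] at h2

lemma sig_le {δ : ℝ} (hδ : 0 ≤ δ) (j : Fin 3) : sig δ j ≤ δ := by
  fin_cases j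
  · exact le_rfl
  · exact hδ
  · exact hδ

lemma sig_nonneg {δ : ℝ} (hδ : 0 ≤ δ) (j : Fin 3) : 0 ≤ sig δ j := by
  fin_cases j
  · exact hδ
  · exact le_rfl
  · exact le_rfl

lemma SX_le_SW {δ : ℝ} (hδ : 0 ≤ δ) (m : ℕ) (c0 : ℝ) (u : Fin 3 → Fn) (t : ℝ) :
    SX m c0 u t ≤ jb t ^ δ * SW m c0 δ u t := by
  rw [SX, SW, Finset.mul_sum]
  refine Finset.sum_le_sum fun j _ => ?_
  rw [← mul_assoc, ← Real.rpow_add (jb_pos t)]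
  refine le_mul_of_one_le_left (XX_nonneg _ _ _ _) (Real.one_le_rpow (one_le_jb t) ?_)
  linarith [sig_le hδ j]

lemma structure_cases {c0 δ : ℝ} (hδ : 0 ≤ δ) {F : Coef} (hTri : LowerTri F) (hC1 : CondC1 F)
    (hC2 : CondC2 F) (hC4 : CondC4 F) (hC5 : CondC5 F) (hC6 : CondC6 F) (i j k : Fin 3) :
    F i j k = 0 ∨ (nullCond 1 (F i j k) ∧ cspeed c0 j = 1 ∧ cspeed c0 k = 1) ∨
      sig δ j + sig δ k ≤ sig δ i := by
  rcases lt_or_ge (k : ℕ) j with h | h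
  · exact Or.inl (funext fun α => funext fun β => hTri i j k h α β)
  · fin_cases i <;> fin_cases j <;> fin_cases k <;> simp at h
    · exact Or.inr (Or.inl ⟨hC1, rfl, rfl⟩)
    · exact Or.inr (Or.inr (by simp [sig]))
    · exact Or.inr (Or.inr (by simp [sig]))
    · exact Or.inr (Or.inr (by simp [sig, hδ]))
    · exact Or.inr (Or.inr (by simp [sig, hδ]))
    · exact Or.inr (Or.inr (by simp [sig, hδ]))
    · exact Or.inr (Or.inl ⟨hC2.1, rfl, rfl⟩)
    · exact Or.inr (Or.inl ⟨hC2.2.1, rfl, rfl⟩)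
    · exact Or.inl (funext fun α => funext fun β => hC4 α β)
    · exact Or.inr (Or.inl ⟨hC2.2.2, rfl, rfl⟩)
    · exact Or.inr (Or.inr (by simp [sig]))
    · exact Or.inr (Or.inr (by simp [sig]))
    · exact Or.inr (Or.inl ⟨hC6.1, rfl, rfl⟩)
    · exact Or.inr (Or.inl ⟨hC6.2, rfl, rfl⟩)
    · exact Or.inl (funext fun α => funext fun β => hC5 α β)
    · exact Or.inr (Or.inr (by simp [sig]))
    · exact Or.inr (Or.inr (by simp [sig]))
    · exact Or.inr (Or.inr (by simp [sig]))

lemma nullQ_zero (v w : Fn) : nullQ 0 v w = 0 := by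
  funext p
  simp [nullQ]

lemma weighted_quadratic_le {c0 δ e K t Q : ℝ} (hK : 0 ≤ K) (hQ : 0 ≤ Q)
    {i j k : Fin 3} (he : sig δ j + sig δ k ≤ sig δ i + e) {m : ℕ} {u : Fin 3 → Fn}
    (h : jb t ^ e * (jb t * Q) ≤ K * (XX 1 (cspeed c0 j) (u j) t * XX m (cspeed c0 k) (u k) t +
      XX m (cspeed c0 j) (u j) t * XX 1 (cspeed c0 k) (u k) t)) :
    jb t ^ (-sig δ i) * (t * Q) ≤ 2 * K * (SW 1 c0 δ u t * SW m c0 δ u t) := by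
  have hj := jb_pos t
  have htj : t ≤ jb t := (le_abs_self t).trans (abs_le_jb t)
  have p1 := Real.rpow_pos_of_pos hj (sig δ j)
  have p2 := Real.rpow_pos_of_pos hj (sig δ k)
  have n1 := SW_nonneg 1 c0 δ u t
  have n2 := SW_nonneg m c0 δ u t
  have a1 := mul_le_mul (XX_le_SW 1 c0 δ u t j) (XX_le_SW m c0 δ u t k) (XX_nonneg _ _ _ _)
    (by positivity)
  have a2 := mul_le_mul (XX_le_SW m c0 δ u t j) (XX_le_SW 1 c0 δ u t k) (XX_nonneg _ _ _ _)
    (by positivity)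
  have h3 : jb t ^ e * (jb t * Q) ≤
      jb t ^ (sig δ i + e) * (2 * K * (SW 1 c0 δ u t * SW m c0 δ u t)) := by
    calc jb t ^ e * (jb t * Q) ≤ K * (2 * ((jb t ^ sig δ j * jb t ^ sig δ k) *
          (SW 1 c0 δ u t * SW m c0 δ u t))) := h.trans (mul_le_mul_of_nonneg_left (by linarith) hK)
      _ = jb t ^ (sig δ j + sig δ k) * (2 * K * (SW 1 c0 δ u t * SW m c0 δ u t)) := by
          rw [Real.rpow_add hj]
          ring
      _ ≤ _ := mul_le_mul_of_nonneg_right (Real.rpow_le_rpow_of_exponent_le (one_le_jb t) he)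
          (by positivity)
  have p3 := Real.rpow_pos_of_pos hj (-sig δ i)
  calc jb t ^ (-sig δ i) * (t * Q) ≤ jb t ^ (-sig δ i) * (jb t * Q) :=
        mul_le_mul_of_nonneg_left (mul_le_mul_of_nonneg_right htj hQ) p3.le
    _ = jb t ^ (-(sig δ i + e)) * (jb t ^ e * (jb t * Q)) := by
        rw [← mul_assoc (jb t ^ (-(sig δ i + e))), ← Real.rpow_add hj]
        congr 2
        ring
    _ ≤ jb t ^ (-(sig δ i + e)) * (jb t ^ (sig δ i + e) *
        (2 * K * (SW 1 c0 δ u t * SW m c0 δ u t))) :=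
        mul_le_mul_of_nonneg_left h3 (Real.rpow_nonneg hj.le _)
    _ = _ := by rw [← mul_assoc, ← Real.rpow_add hj, neg_add_cancel, Real.rpow_zero, one_mul]

lemma exists_weighted_quadratic_le {c0 δ : ℝ} (hc0 : 0 < c0) (hδ : 0 < δ) (hδ' : δ < 1 / 24)
    {H : Fin 4 → Fin 4 → ℝ} {i j k : Fin 3}
    (hcase : H = 0 ∨ (nullCond 1 H ∧ cspeed c0 j = 1 ∧ cspeed c0 k = 1) ∨
      sig δ j + sig δ k ≤ sig δ i) {m : ℕ} (hm : m = 1 ∨ m = 2) {l : List (Fin 7)}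
    (hl : l.length ≤ m) :
    ∃ K : ℝ, 0 ≤ K ∧ ∀ (ρ T : ℝ) (u : Fin 3 → Fn), (∀ j, Adm ρ T (u j)) → ∀ t ∈ Ioo 0 T,
      jb t ^ (-sig δ i) * (t * L2 (fun x => Zw l (nullQ H (u j) (u k)) (t, x))) ≤
        K * (SW 1 c0 δ u t * SW m c0 δ u t) := by
  rcases hcase with rfl | ⟨hH, hj, hk⟩ | hs
  · refine ⟨0, le_rfl, fun ρ T u hu t ht => ?_⟩
    rw [nullQ_zero, Zw_zero]
    simp [L2]
  · obtain ⟨K, hK, h⟩ := exists_L2_Zw_nullQ_le (c := 1) (c' := 1) H hm hl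
      (a := fun t => jb t ^ (1 / 3 : ℝ) * jb t)
      (fun t => mul_nonneg (Real.rpow_nonneg (jb_pos t).le _) (jb_pos t).le) (fun H' hH' => by
        obtain ⟨K, hK, h⟩ := exists_L2_nullQ_le (hH' hH)
        exact ⟨K, hK, fun ρ T v w hv hw t ht => by
          rw [mul_assoc]
          exact h ρ T v w hv hw t ht⟩)
    refine ⟨2 * K, by positivity, fun ρ T u hu t ht =>
      weighted_quadratic_le (j := j) (k := k) (e := 1 / 3) hK (L2_nonneg _) ?_ ?_⟩
    · linarith [sig_le hδ.le j, sig_le hδ.le k, sig_nonneg hδ.le i]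
    · rw [hj, hk, ← mul_assoc]
      exact h ρ T _ _ (hu j) (hu k) t ht
  · obtain ⟨K, hK, h⟩ := exists_L2_Zw_nullQ_le (c := cspeed c0 j) (c' := cspeed c0 k) H hm hl
      (a := jb) (fun t => (jb_pos t).le)
      (fun H' _ => exists_L2_nullQ_le' (cspeed_pos hc0 j) (cspeed_pos hc0 k) H')
    refine ⟨2 * K, by positivity, fun ρ T u hu t ht =>
      weighted_quadratic_le (j := j) (k := k) (e := 0) hK (L2_nonneg _) ?_ ?_⟩
    · linarith
    · rw [Real.rpow_zero, one_mul]
      exact h ρ T _ _ (hu j) (hu k) t ht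

lemma exists_weighted_cubic_le {c0 δ : ℝ} (hc0 : 0 < c0) (hδ : 0 < δ) (hδ' : δ < 1 / 24)
    {P : MvPolynomial (Fin 3 × Fin 4) ℝ} (hP : CubicLike P) {m : ℕ} (hm : m = 1 ∨ m = 2)
    {l : List (Fin 7)} (hl : l.length ≤ m) (i : Fin 3) :
    ∃ K : ℝ, 0 ≤ K ∧ ∀ (ρ T : ℝ) (u : Fin 3 → Fn), (∀ j, Adm ρ T (u j)) → ∀ t ∈ Ioo 0 T,
      K * SW 1 c0 δ u t ≤ 1 → SW 1 c0 δ u t ≤ 1 →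
      jb t ^ (-sig δ i) * (t * L2 (fun x => Zw l (cubicEval P u) (t, x))) ≤
        K * (SW 1 c0 δ u t * SW m c0 δ u t) := by
  obtain ⟨K, hK, h⟩ := exists_L2_cubic_le hc0 hP hm hl
  obtain ⟨K', hK', h'⟩ := exists_gradSize_zero_le hc0
  refine ⟨K + K', by positivity, fun ρ T u hu t ht hsm hsm' => ?_⟩
  have hj := jb_pos t
  have hj1 := one_le_jb t
  have htj : t ≤ jb t := (le_abs_self t).trans (abs_le_jb t)
  have n1 := SW_nonneg 1 c0 δ u t
  have n2 := SW_nonneg m c0 δ u t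
  have s1 := SX_le_SW hδ.le 1 c0 u t
  have s2 := SX_le_SW hδ.le m c0 u t
  have m1 := SX_nonneg 1 c0 u t
  have m2 := SX_nonneg m c0 u t
  have pd := Real.rpow_pos_of_pos hj δ
  have key := h ρ T u hu t ht fun x => by
    have h1 := h' ρ T u hu t ht x
    have p : 0 < (jb t ^ (1 / 3 : ℝ)) ^ 2 := by positivity
    have hp : jb t ^ δ ≤ (jb t ^ (1 / 3 : ℝ)) ^ 2 := by
      rw [← Real.rpow_natCast, ← Real.rpow_mul hj.le]
      exact Real.rpow_le_rpow_of_exponent_le hj1 (by norm_num; linarith)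
    have h2 : K' * SX 1 c0 u t ≤ (jb t ^ (1 / 3 : ℝ)) ^ 2 * 1 := by
      calc K' * SX 1 c0 u t ≤ K' * (jb t ^ δ * SW 1 c0 δ u t) := mul_le_mul_of_nonneg_left s1 hK'
        _ = jb t ^ δ * (K' * SW 1 c0 δ u t) := by ring
        _ ≤ (jb t ^ (1 / 3 : ℝ)) ^ 2 * 1 := mul_le_mul hp (by nlinarith) (by positivity) p.le
    exact le_of_mul_le_mul_left (h1.trans h2) p
  set Q := L2 (fun x => Zw l (cubicEval P u) (t, x)) with hQ
  have hQ0 : 0 ≤ Q := L2_nonneg _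
  have h3 : jb t ^ 2 * Q ≤ jb t * (K * (SW 1 c0 δ u t * SW m c0 δ u t)) := by
    calc jb t ^ 2 * Q ≤ K * (SX m c0 u t * SX 1 c0 u t * SX 1 c0 u t) := key
      _ ≤ K * ((jb t ^ δ * SW m c0 δ u t) * (jb t ^ δ * SW 1 c0 δ u t) *
          (jb t ^ δ * SW 1 c0 δ u t)) := by gcongr
      _ = (jb t ^ δ) ^ 3 * ((K * (SW 1 c0 δ u t * SW m c0 δ u t)) * SW 1 c0 δ u t) := by ring
      _ ≤ jb t * ((K * (SW 1 c0 δ u t * SW m c0 δ u t)) * 1) := by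
          have hp : (jb t ^ δ) ^ 3 ≤ jb t := by
            rw [← Real.rpow_natCast, ← Real.rpow_mul hj.le]
            calc _ ≤ jb t ^ (1 : ℝ) :=
                  Real.rpow_le_rpow_of_exponent_le hj1 (by push_cast; linarith)
              _ = jb t := Real.rpow_one _
          gcongr
      _ = _ := by rw [mul_one]
  have h4 : jb t * Q ≤ K * (SW 1 c0 δ u t * SW m c0 δ u t) :=
    le_of_mul_le_mul_left (by linarith [show jb t * (jb t * Q) = jb t ^ 2 * Q by ring]) hj
  have h5 : jb t ^ (-sig δ i) ≤ 1 :=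
    Real.rpow_le_one_of_one_le_of_nonpos hj1 (by linarith [sig_nonneg hδ.le i])
  have ht0 := ht.1.le
  calc jb t ^ (-sig δ i) * (t * Q) ≤ 1 * (jb t * Q) := by gcongr
    _ ≤ K * (SW 1 c0 δ u t * SW m c0 δ u t) := by rwa [one_mul]
    _ ≤ _ := mul_le_mul_of_nonneg_right (by linarith) (by positivity)

lemma exists_weighted_boxOp_le {c0 δ : ℝ} (hc0 : 0 < c0) (hδ : 0 < δ) (hδ' : δ < 1 / 24)
    {F : Coef} {Cub : Fin 3 → MvPolynomial (Fin 3 × Fin 4) ℝ}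
    (hF : ∀ i j k, F i j k = 0 ∨ (nullCond 1 (F i j k) ∧ cspeed c0 j = 1 ∧ cspeed c0 k = 1) ∨
      sig δ j + sig δ k ≤ sig δ i) (hCub : ∀ i, CubicLike (Cub i)) {m : ℕ} (hm : m = 1 ∨ m = 2)
    {l : List (Fin 7)} (hl : l.length ≤ m) (i : Fin 3) :
    ∃ K : ℝ, 0 ≤ K ∧ ∀ (ρ T : ℝ) (u : Fin 3 → Fn), (∀ j, Adm ρ T (u j)) →
      IsSolutionOn c0 F Cub u (Ioo 0 T) → ∀ t ∈ Ioo 0 T,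
      K * SW 1 c0 δ u t ≤ 1 → SW 1 c0 δ u t ≤ 1 →
      jb t ^ (-sig δ i) * (t * L2 (fun x => Zw l (boxOp (cspeed c0 i) (u i)) (t, x))) ≤
        K * (SW 1 c0 δ u t * SW m c0 δ u t) := by
  choose K hK h using fun q : Fin 3 × Fin 3 =>
    exists_weighted_quadratic_le hc0 hδ hδ' (hF i q.1 q.2) hm hl
  obtain ⟨K', hK', h'⟩ := exists_weighted_cubic_le hc0 hδ hδ' (hCub i) hm hl i
  have hs0 : 0 ≤ ∑ q, K q := Finset.sum_nonneg fun q _ => hK q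
  refine ⟨∑ q, K q + K', by positivity, fun ρ T u hu hsol t ht hsm hsm' => ?_⟩
  have n1 := SW_nonneg 1 c0 δ u t
  have e : EqOn (boxOp (cspeed c0 i) (u i)) (fun p => (∑ q : Fin 3 × Fin 3,
      nullQ (F i q.1 q.2) (u q.1) (u q.2) p) + cubicEval (Cub i) u p) (Ioo 0 T ×ˢ univ) := by
    rintro ⟨s, x⟩ ⟨hs, -⟩
    rw [hsol i s hs x]
    simp only [Fintype.sum_prod_type]
    rfl
  have e2 := Zw_eqOn (isOpen_Ioo.prod isOpen_univ) e l
  have sm (q : Fin 3 × Fin 3) : ContDiff ℝ (⊤ : ℕ∞) (nullQ (F i q.1 q.2) (u q.1) (u q.2)) :=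
    contDiff_nullQ _ (hu _).1 (hu _).1
  rw [Zw_add (ContDiff.sum fun q _ => sm q) (contDiff_cubicEval _ fun j => (hu j).1),
    Zw_finset_sum _ fun q _ => sm q] at e2
  have key := L2_le_sum_add (Finset.univ : Finset (Fin 3 × Fin 3)) (c := fun _ => 1) (d := 1)
    (g := fun q x => Zw l (nullQ (F i q.1 q.2) (u q.1) (u q.2)) (t, x))
    (h := fun x => Zw l (cubicEval (Cub i) u) (t, x))
    ((((hu i).boxOp (cspeed c0 i)).Zw l).cc ht)
    (fun q _ => ((Adm.nullQ _ (hu _) (hu _)).Zw l).cc ht)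
    (((Adm.cubicEval (hCub i) hu).Zw l).cc ht) (fun _ _ => zero_le_one) zero_le_one (fun x => by
      rw [e2 ⟨ht, mem_univ x⟩]
      simp only [one_mul]
      exact (abs_add_le _ _).trans (add_le_add_left (Finset.abs_sum_le_sum_abs _ _) _))
  have hw : 0 ≤ jb t ^ (-sig δ i) := Real.rpow_nonneg (jb_pos t).le _
  refine (mul_le_mul_of_nonneg_left (mul_le_mul_of_nonneg_left key ht.1.le) hw).trans ?_
  simp only [one_mul]
  rw [mul_add, mul_add, Finset.mul_sum, Finset.mul_sum, add_mul, Finset.sum_mul]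
  refine add_le_add (Finset.sum_le_sum fun q _ => h q ρ T u hu t ht) (h' ρ T u hu t ht ?_ hsm')
  nlinarith

lemma exists_uniform_weighted_boxOp_le {c0 δ : ℝ} (hc0 : 0 < c0) (hδ : 0 < δ)
    (hδ' : δ < 1 / 24) {F : Coef} {Cub : Fin 3 → MvPolynomial (Fin 3 × Fin 4) ℝ}
    (hF : ∀ i j k, F i j k = 0 ∨ (nullCond 1 (F i j k) ∧ cspeed c0 j = 1 ∧ cspeed c0 k = 1) ∨
      sig δ j + sig δ k ≤ sig δ i) (hCub : ∀ i, CubicLike (Cub i)) {m : ℕ}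
    (hm : m = 1 ∨ m = 2) :
    ∃ K : ℝ, 0 ≤ K ∧ ∀ i, ∀ l ∈ W m, ∀ (ρ T : ℝ) (u : Fin 3 → Fn), (∀ j, Adm ρ T (u j)) →
      IsSolutionOn c0 F Cub u (Ioo 0 T) → ∀ t ∈ Ioo 0 T,
      K * SW 1 c0 δ u t ≤ 1 → SW 1 c0 δ u t ≤ 1 →
      jb t ^ (-sig δ i) * (t * L2 (fun x => Zw l (boxOp (cspeed c0 i) (u i)) (t, x))) ≤
        K * (SW 1 c0 δ u t * SW m c0 δ u t) := by
  have mono (i : Fin 3) (l : List (Fin 7)) {c d : ℝ} (hcd : c ≤ d)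
      (h : ∀ (ρ T : ℝ) (u : Fin 3 → Fn), (∀ j, Adm ρ T (u j)) →
        IsSolutionOn c0 F Cub u (Ioo 0 T) → ∀ t ∈ Ioo 0 T,
        c * SW 1 c0 δ u t ≤ 1 → SW 1 c0 δ u t ≤ 1 →
        jb t ^ (-sig δ i) * (t * L2 (fun x => Zw l (boxOp (cspeed c0 i) (u i)) (t, x))) ≤
          c * (SW 1 c0 δ u t * SW m c0 δ u t)) (ρ T : ℝ) (u : Fin 3 → Fn)
      (hu : ∀ j, Adm ρ T (u j)) (hs : IsSolutionOn c0 F Cub u (Ioo 0 T)) (t : ℝ)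
      (ht : t ∈ Ioo 0 T) (h1 : d * SW 1 c0 δ u t ≤ 1) (h2 : SW 1 c0 δ u t ≤ 1) :
      jb t ^ (-sig δ i) * (t * L2 (fun x => Zw l (boxOp (cspeed c0 i) (u i)) (t, x))) ≤
        d * (SW 1 c0 δ u t * SW m c0 δ u t) := by
    have n1 := SW_nonneg 1 c0 δ u t
    have n2 := SW_nonneg m c0 δ u t
    exact (h ρ T u hu hs t ht ((mul_le_mul_of_nonneg_right hcd n1).trans h1) h2).trans
      (mul_le_mul_of_nonneg_right hcd (by positivity))
  refine exists_uniform_fin (fun i c d hcd h l hl => mono i l hcd (h l hl)) fun i => ?_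
  exact exists_uniform_of_finset (W m) (fun l c d hcd h => mono i l hcd h)
    fun l hl => exists_weighted_boxOp_le hc0 hδ hδ' hF hCub hm (mem_W.1 hl) i

lemma calN_eq (c0 δ : ℝ) (κ : ℕ) (u : Fin 3 → Fn) (t : ℝ) :
    calN c0 δ κ u t = ∑ i, jb t ^ (-sig δ i) * Nnorm κ (cspeed c0 i) (u i) t := by
  simp [calN, Fin.sum_univ_three, sig, cspeed]

lemma calM_eq (c0 δ : ℝ) (κ : ℕ) (u : Fin 3 → Fn) (t : ℝ) :
    calM c0 δ κ u t = ∑ i, jb t ^ (-sig δ i) * Mmu κ (cspeed c0 i) (u i) t := by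
  simp [calM, Fin.sum_univ_three, sig, cspeed]

lemma energy_nonneg (c : ℝ) (v : Fn) (t : ℝ) : 0 ≤ energy c v t :=
  mul_nonneg (by norm_num) (integral_nonneg fun x => by positivity)

lemma L2_pd_sq_le_energy {c : ℝ} (hc : 0 < c) {ρ T : ℝ} {v : Fn} (hv : Adm ρ T v) {t : ℝ}
    (ht : t ∈ Ioo 0 T) (α : Fin 4) :
    L2 (fun x => pd α v (t, x)) ^ 2 ≤ 2 * (1 + 1 / c ^ 2) * energy c v t := by
  have hcc (β : Fin 4) : CC fun x => pd β v (t, x) ^ 2 := ((hv.pd β).cc ht).pow two_ne_zero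
  rw [L2_sq, energy, show 2 * (1 + 1 / c ^ 2) * (1 / 2 * ∫ x : Sp, ((pt v (t, x)) ^ 2 +
    c ^ 2 * ∑ j : Fin 3, (px j v (t, x)) ^ 2)) = (1 + 1 / c ^ 2) * ∫ x : Sp, ((pt v (t, x)) ^ 2 +
    c ^ 2 * ∑ j : Fin 3, (px j v (t, x)) ^ 2) by ring, ← integral_const_mul]
  have hI : CC fun x => (pt v (t, x)) ^ 2 + c ^ 2 * ∑ j : Fin 3, (px j v (t, x)) ^ 2 :=
    (hcc 0).add ((CC.sum _ fun j _ => hcc j.succ).const_mul _)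
  refine integral_mono (hcc α).integrable (hI.const_mul _).integrable fun x => ?_
  have hS : 0 ≤ ∑ j : Fin 3, (px j v (t, x)) ^ 2 := Finset.sum_nonneg fun j _ => sq_nonneg _
  have e : (1 + 1 / c ^ 2) * ((pt v (t, x)) ^ 2 + c ^ 2 * ∑ j : Fin 3, (px j v (t, x)) ^ 2) =
      (1 + 1 / c ^ 2) * (pt v (t, x)) ^ 2 + (1 + c ^ 2) * ∑ j : Fin 3, (px j v (t, x)) ^ 2 := by
    field_simp
    ring
  simp only [e]
  refine Fin.cases ?_ (fun j => ?_) α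
  · have h1 : 0 ≤ 1 / c ^ 2 * pt v (t, x) ^ 2 := by positivity
    have h2 : 0 ≤ (1 + c ^ 2) * ∑ j : Fin 3, (px j v (t, x)) ^ 2 := by positivity
    change pt v (t, x) ^ 2 ≤ _
    linarith
  · have h1 : px j v (t, x) ^ 2 ≤ ∑ j : Fin 3, (px j v (t, x)) ^ 2 :=
      Finset.single_le_sum (f := fun j => px j v (t, x) ^ 2) (fun _ _ => sq_nonneg _)
        (Finset.mem_univ j)
    have h2 : 0 ≤ (1 + 1 / c ^ 2) * pt v (t, x) ^ 2 := by positivity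
    have h3 : 0 ≤ c ^ 2 * ∑ j : Fin 3, (px j v (t, x)) ^ 2 := by positivity
    change px j v (t, x) ^ 2 ≤ _
    linarith

lemma exists_XN_le_Nnorm {c : ℝ} (hc : 0 < c) (n : ℕ) : ∃ K : ℝ, 0 ≤ K ∧
    ∀ (ρ T : ℝ) (v : Fn), Adm ρ T v → ∀ t ∈ Ioo 0 T, XN n v t ≤ K * Nnorm (n + 1) c v t := by
  obtain ⟨C, hC, h⟩ := exists_abs_pd_Zw_le n
  set D := Real.sqrt (2 * (1 + 1 / c ^ 2)) with hD
  refine ⟨∑ _q ∈ (Finset.univ : Finset (Fin 4)) ×ˢ W n, ∑ _a ∈ idxSet 7 n, C * D,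
    by positivity, fun ρ T v hv t ht => ?_⟩
  have hZ (a : Fin 7 → ℕ) : Adm ρ T (Zmulti a v) := Zmulti_eq_Zw a v ▸ hv.Zw _
  rw [XN, Finset.sum_mul]
  refine Finset.sum_le_sum fun q hq => ?_
  refine (L2_le_sum (idxSet 7 n) (c := fun _ => C)
    (g := fun a x => pd q.1 (Zmulti a v) (t, x)) (((hv.Zw _).pd _).cc ht)
    (fun a _ => ((hZ a).pd _).cc ht) (fun _ _ => hC) fun x => ?_).trans ?_
  · rw [← Finset.mul_sum]
    exact h _ (Finset.mem_product.1 hq).2 v hv.1 _ _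
  · rw [Finset.sum_mul]
    refine Finset.sum_le_sum fun a ha => ?_
    rw [mul_assoc]
    refine mul_le_mul_of_nonneg_left ?_ hC
    rw [Nnorm, hD, ← Real.sqrt_mul (by positivity)]
    refine Real.le_sqrt_of_sq_le ((L2_pd_sq_le_energy hc (hZ a) ht q.1).trans ?_)
    exact mul_le_mul_of_nonneg_left (Finset.single_le_sum (f := fun a => energy c (Zmulti a v) t)
      (fun _ _ => energy_nonneg _ _ _) ha) (by positivity)

lemma calN_nonneg (c0 δ : ℝ) (κ : ℕ) (u : Fin 3 → Fn) (t : ℝ) : 0 ≤ calN c0 δ κ u t :=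
  calN_eq c0 δ κ u t ▸ Finset.sum_nonneg fun _ _ =>
    mul_nonneg (Real.rpow_nonneg (jb_pos t).le _) (Real.sqrt_nonneg _)

lemma exists_SW_le_calN_add {c0 : ℝ} (hc0 : 0 < c0) (δ : ℝ) (m : ℕ) :
    ∃ A : ℝ, 0 ≤ A ∧ ∀ (ρ T : ℝ) (u : Fin 3 → Fn), (∀ j, Adm ρ T (u j)) → ∀ t ∈ Ioo 0 T,
      SW m c0 δ u t ≤ A * (calN c0 δ (m + 2) u t + ∑ i, ∑ l ∈ W m,
        jb t ^ (-sig δ i) * (t * L2 fun x => Zw l (boxOp (cspeed c0 i) (u i)) (t, x))) := by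
  choose K2 hK2 h2 using fun i => exists_XM_le (cspeed_pos hc0 i) m
  choose K3 hK3 h3 using fun i => exists_XN_le_Nnorm (cspeed_pos hc0 i) (m + 1)
  obtain ⟨A, hA, hAi⟩ : ∃ A : ℝ, 0 ≤ A ∧ ∀ i, (1 + K2 i) * (1 + K3 i) ≤ A := by
    have h (i : Fin 3) : 0 ≤ (1 + K2 i) * (1 + K3 i) := mul_nonneg
      (add_nonneg zero_le_one (hK2 i)) (add_nonneg zero_le_one (hK3 i))
    exact ⟨∑ i, (1 + K2 i) * (1 + K3 i), Finset.sum_nonneg fun i _ => h i,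
      fun i => Finset.single_le_sum (f := fun i => (1 + K2 i) * (1 + K3 i)) (fun i _ => h i)
        (Finset.mem_univ i)⟩
  refine ⟨A, hA, fun ρ T u hu t ht => ?_⟩
  rw [SW, calN_eq, ← Finset.sum_add_distrib, Finset.mul_sum]
  refine Finset.sum_le_sum fun i _ => ?_
  have hw : 0 ≤ jb t ^ (-sig δ i) := Real.rpow_nonneg (jb_pos t).le _
  have a1 := h2 i ρ T (u i) (hu i) t ht
  have a2 := h3 i ρ T (u i) (hu i) t ht
  have ht0 := ht.1.le
  have hk2 := hK2 i
  have hk3 := hK3 i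
  rw [XX, ← Finset.mul_sum, ← Finset.mul_sum]
  set S := ∑ l ∈ W m, L2 fun x => Zw l (boxOp (cspeed c0 i) (u i)) (t, x)
  set N := Nnorm (m + 2) (cspeed c0 i) (u i) t
  have hS : 0 ≤ S := Finset.sum_nonneg fun _ _ => L2_nonneg _
  have hN : 0 ≤ N := Real.sqrt_nonneg _
  have a3 : XN (m + 1) (u i) t ≤ K3 i * N := a2
  calc jb t ^ (-sig δ i) * (XN (m + 1) (u i) t + XM m (cspeed c0 i) (u i) t)
      ≤ jb t ^ (-sig δ i) * ((1 + K2 i) * (K3 i * N) + K2 i * (t * S)) := by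
        refine mul_le_mul_of_nonneg_left ?_ hw
        have := mul_le_mul_of_nonneg_left a3 hk2
        linarith
    _ ≤ jb t ^ (-sig δ i) * (((1 + K2 i) * (1 + K3 i)) * (N + t * S)) := by
        refine mul_le_mul_of_nonneg_left ?_ hw
        have h1 : 0 ≤ t * S := by positivity
        have h2 : 0 ≤ (1 + K3 i + K2 i * K3 i) * (t * S) := by positivity
        have h3 : 0 ≤ (1 + K2 i) * N := by positivity
        linarith
    _ ≤ jb t ^ (-sig δ i) * (A * (N + t * S)) := by
        refine mul_le_mul_of_nonneg_left (mul_le_mul_of_nonneg_right (hAi i) ?_) hw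
        positivity
    _ = _ := by ring

lemma exists_SW_le {c0 δ : ℝ} (hc0 : 0 < c0) (hδ : 0 < δ)
    (hδ' : δ < 1 / 24) {F : Coef} {Cub : Fin 3 → MvPolynomial (Fin 3 × Fin 4) ℝ}
    (hF : ∀ i j k, F i j k = 0 ∨ (nullCond 1 (F i j k) ∧ cspeed c0 j = 1 ∧ cspeed c0 k = 1) ∨
      sig δ j + sig δ k ≤ sig δ i) (hCub : ∀ i, CubicLike (Cub i)) {m : ℕ}
    (hm : m = 1 ∨ m = 2) :
    ∃ K : ℝ, 1 ≤ K ∧ ∀ (ρ T : ℝ) (u : Fin 3 → Fn), (∀ j, Adm ρ T (u j)) →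
      IsSolutionOn c0 F Cub u (Ioo 0 T) → ∀ t ∈ Ioo 0 T, K * SW 1 c0 δ u t ≤ 1 →
      SW m c0 δ u t ≤ K * calN c0 δ (m + 2) u t + K * (SW 1 c0 δ u t * SW m c0 δ u t) := by
  obtain ⟨K1, hK1, h1⟩ := exists_uniform_weighted_boxOp_le hc0 hδ hδ' hF hCub hm
  obtain ⟨A, hA, h2⟩ := exists_SW_le_calN_add hc0 δ m
  refine ⟨1 + K1 + A + A * (3 * ((W m).card * K1)), ?_, fun ρ T u hu hsol t ht hsm => ?_⟩
  · have : 0 ≤ A * (3 * ((W m).card * K1)) := by positivity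
    linarith
  have n1 := SW_nonneg 1 c0 δ u t
  have n2 := SW_nonneg m c0 δ u t
  have nC := calN_nonneg c0 δ (m + 2) u t
  have hP : 0 ≤ A * (3 * ((W m).card * K1)) := by positivity
  have key : ∑ i, ∑ l ∈ W m,
      jb t ^ (-sig δ i) * (t * L2 fun x => Zw l (boxOp (cspeed c0 i) (u i)) (t, x)) ≤
      3 * ((W m).card * (K1 * (SW 1 c0 δ u t * SW m c0 δ u t))) := by
    refine (Finset.sum_le_card_nsmul Finset.univ _
      ((W m).card * (K1 * (SW 1 c0 δ u t * SW m c0 δ u t))) fun i _ => ?_).trans ?_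
    · rw [← nsmul_eq_mul]
      refine Finset.sum_le_card_nsmul _ _ _ fun l hl => h1 i l hl ρ T u hu hsol t ht ?_ ?_
      · nlinarith
      · nlinarith
    · simp
  have h3 := (h2 ρ T u hu t ht).trans (mul_le_mul_of_nonneg_left (add_le_add_right key _) hA)
  have h4 : 0 ≤ (1 + K1 + A * (3 * ((W m).card * K1))) * calN c0 δ (m + 2) u t := by positivity
  have h5 : 0 ≤ (1 + K1 + A) * (SW 1 c0 δ u t * SW m c0 δ u t) := by positivity
  linarith

lemma calM_le_SW {c0 δ : ℝ} (m : ℕ) (u : Fin 3 → Fn) (t : ℝ) :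
    calM c0 δ (m + 2) u t ≤ (idxSet 7 m).card * SW m c0 δ u t := by
  rw [calM_eq, SW, Finset.mul_sum]
  refine Finset.sum_le_sum fun i _ => ?_
  rw [← mul_assoc, mul_comm ((idxSet 7 m).card : ℝ), mul_assoc]
  refine mul_le_mul_of_nonneg_left ?_ (Real.rpow_nonneg (jb_pos t).le _)
  rw [Mmu, Nat.add_sub_cancel, ← nsmul_eq_mul]
  refine Finset.sum_le_card_nsmul _ _ _ fun a ha => ?_
  rw [Zmulti_eq_Zw]
  refine le_add_of_nonneg_of_le (XN_nonneg _ _ _) ?_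
  refine Finset.single_le_sum (f := fun l => M2 (cspeed c0 i) (Zw l (u i)) t)
    (fun _ _ => M2_nonneg _ _ _) (mem_W.2 ?_)
  rw [length_idxWord]
  exact (Finset.mem_filter.1 ha).2

lemma L2_eq_sqrt_setIntegral {ρ T : ℝ} {f : Fn}
    (hz : ∀ t ∈ Ioo 0 T, ∀ x, ρ < ‖x‖ → f (t, x) = 0) {t : ℝ} (ht : t ∈ Ioo 0 T) :
    L2 (fun x => f (t, x)) = √(∫ x in Metric.closedBall (0 : Sp) ρ, f (t, x) ^ 2) := by
  rw [L2, setIntegral_eq_integral_of_forall_compl_eq_zero]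
  intro x hx
  rw [hz t ht x (by simpa using hx)]
  norm_num

lemma continuous_sqrt_setIntegral (ρ : ℝ) {f : Fn} (hf : Continuous f) :
    Continuous fun t => √(∫ x in Metric.closedBall (0 : Sp) ρ, f (t, x) ^ 2) := by
  refine Real.continuous_sqrt.comp ?_
  exact continuous_parametric_integral_of_continuous (hf.pow 2) (isCompact_closedBall _ _)

lemma continuousOn_L2 {ρ T : ℝ} {f : Fn} (hf : Continuous f)
    (hz : ∀ t ∈ Ioo 0 T, ∀ x, ρ < ‖x‖ → f (t, x) = 0) :
    ContinuousOn (fun t => L2 fun x => f (t, x)) (Ioo 0 T) :=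
  (continuous_sqrt_setIntegral ρ hf).continuousOn.congr fun _ ht => L2_eq_sqrt_setIntegral hz ht

lemma Adm.continuousOn_L2 {ρ T : ℝ} {v : Fn} (h : Adm ρ T v) :
    ContinuousOn (fun t => L2 fun x => v (t, x)) (Ioo 0 T) :=
  MultiSpeedWave.continuousOn_L2 h.1.continuous fun _ ht _ hx => h.2 ⟨ht, hx⟩

lemma Adm.tendsto_mul_L2 {ρ T : ℝ} {v : Fn} (hT : 0 < T) (h : Adm ρ T v) :
    Filter.Tendsto (fun t => t * L2 fun x => v (t, x)) (nhdsWithin 0 (Ioi 0)) (nhds 0) := by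
  have hc : Continuous fun t : ℝ => t *
      √(∫ x in Metric.closedBall (0 : Sp) ρ, v (t, x) ^ 2) :=
    continuous_id.mul (continuous_sqrt_setIntegral ρ h.1.continuous)
  have h0 := (hc.tendsto 0).mono_left (nhdsWithin_le_nhds (s := Ioi 0))
  rw [zero_mul] at h0
  refine h0.congr' ?_
  filter_upwards [Ioo_mem_nhdsGT hT] with t ht
  rw [L2_eq_sqrt_setIntegral (fun _ ht _ hx => h.2 ⟨ht, hx⟩) ht]

lemma continuousOn_XX {ρ T : ℝ} (m : ℕ) (c : ℝ) {v : Fn} (hv : Adm ρ T v) :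
    ContinuousOn (XX m c v) (Ioo 0 T) := by
  refine ContinuousOn.add ?_ ?_
  · exact continuousOn_finsetSum _ fun q _ => ((hv.Zw _).pd _).continuousOn_L2
  · refine continuousOn_finsetSum _ fun l _ => continuousOn_finsetSum _ fun α _ =>
      continuousOn_finsetSum _ fun j _ => ?_
    have h : Adm ρ T (pd α (px j (Zw l v))) := ((hv.Zw l).pd j.succ).pd α
    refine continuousOn_L2 (ρ := ρ) (f := fun p => jb (c * p.1 - ‖p.2‖) *
      pd α (px j (Zw l v)) p) ?_ fun t ht x hx => ?_
    · exact (continuous_jb.comp (by fun_prop)).mul h.1.continuous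
    · rw [h.2 (x := (t, x)) ⟨ht, hx⟩]
      simp

lemma continuousOn_SW {ρ T : ℝ} (m : ℕ) (c0 δ : ℝ) {u : Fin 3 → Fn} (hu : ∀ j, Adm ρ T (u j)) :
    ContinuousOn (SW m c0 δ u) (Ioo 0 T) := by
  refine continuousOn_finsetSum _ fun j _ => ContinuousOn.mul ?_ (continuousOn_XX _ _ (hu j))
  exact (continuous_jb.rpow_const fun t => Or.inl (jb_pos t).ne').continuousOn

lemma exists_SW_le_near_zero {c0 δ : ℝ} (hc0 : 0 < c0) (hδ : 0 ≤ δ) (m : ℕ) :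
    ∃ A : ℝ, 0 ≤ A ∧ ∀ (ρ T : ℝ) (u : Fin 3 → Fn), 0 < T → (∀ j, Adm ρ T (u j)) →
      ∀ ε > 0, ∃ t ∈ Ioo 0 T, SW m c0 δ u t ≤ A * (calN c0 δ (m + 2) u t + ε) := by
  obtain ⟨A, hA, h⟩ := exists_SW_le_calN_add hc0 δ m
  refine ⟨A, hA, fun ρ T u hT hu ε hε => ?_⟩
  have lim : Filter.Tendsto (fun t => ∑ i, ∑ l ∈ W m,
      t * L2 fun x => Zw l (boxOp (cspeed c0 i) (u i)) (t, x))
      (nhdsWithin 0 (Ioi 0)) (nhds (∑ _i : Fin 3, ∑ _l ∈ W m, 0)) :=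
    tendsto_finsetSum _ fun i _ => tendsto_finsetSum _ fun l _ =>
      (((hu i).boxOp _).Zw l).tendsto_mul_L2 hT
  simp only [Finset.sum_const_zero] at lim
  obtain ⟨t, ht, hlt⟩ :=
    ((Filter.eventually_mem_set.2 (Ioo_mem_nhdsGT hT)).and
      (lim.eventually (gt_mem_nhds hε))).exists
  refine ⟨t, ht, (h ρ T u hu t ht).trans (mul_le_mul_of_nonneg_left
    (add_le_add_right (le_trans ?_ hlt.le) _) hA)⟩
  refine Finset.sum_le_sum fun i _ => Finset.sum_le_sum fun l _ =>
    mul_le_of_le_one_left (mul_nonneg ht.1.le (L2_nonneg _)) ?_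
  exact Real.rpow_le_one_of_one_le_of_nonpos (one_le_jb t) (by linarith [sig_nonneg hδ i])

/-- Continuity argument: a continuous function that is small somewhere, and small wherever it is
at most `η`, never exceeds `η`. -/
lemma le_of_bootstrap {f : ℝ → ℝ} {a b η : ℝ} (hf : ContinuousOn f (Ioo a b))
    {t0 : ℝ} (ht0 : t0 ∈ Ioo a b) (h0 : f t0 ≤ η)
    (h : ∀ t ∈ Ioo a b, f t ≤ η → f t < η) : ∀ t ∈ Ioo a b, f t ≤ η := by
  intro t ht
  by_contra! hlt
  obtain ⟨s, hs, he⟩ := isPreconnected_Ioo.intermediate_value ht0 ht hf ⟨h0, hlt.le⟩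
  exact (h s hs he.le).ne he

end MultiSpeedWave

namespace MultiSpeedWave

/-- Proposition 6.1: `ℳ_μ ≲ 𝒩_μ` along solutions obeying the a priori bound. -/
theorem M_controlled_by_N (c0 δ : ℝ) (hc0 : 0 < c0) (hne : c0 ≠ 1)
    (hδ : 0 < δ) (hδ' : δ < 1/24)
    (F : Coef) (Cub : Fin 3 → MvPolynomial (Fin 3 × Fin 4) ℝ)
    (hTri : LowerTri F) (hCub : ∀ i, CubicLike (Cub i))
    (hC1 : CondC1 F) (hC2 : CondC2 F) (hC3 : CondC3 c0 F)
    (hC4 : CondC4 F) (hC5 : CondC5 F) (hC6 : CondC6 F)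
    (Cstar : ℝ) (hCstar : 0 < Cstar) :
    ∃ ε0 : ℝ, 0 < ε0 ∧ ∃ C : ℝ, 0 < C ∧
      ∀ (R Tstar : ℝ) (f g : Fin 3 → Sp → ℝ) (u : Fin 3 → Fn),
        0 < R → 0 < Tstar →
        (∀ i, ContDiff ℝ (⊤ : ℕ∞) (f i) ∧ ContDiff ℝ (⊤ : ℕ∞) (g i) ∧
              tsupport (f i) ⊆ Metric.ball (0 : Sp) R ∧
              tsupport (g i) ⊆ Metric.ball (0 : Sp) R) →
        (∀ i, ContDiff ℝ (⊤ : ℕ∞) (u i)) →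
        IsSolutionOn c0 F Cub u (Set.Ioo 0 Tstar) →
        (∀ i x, u i (0, x) = f i x ∧ pt (u i) (0, x) = g i x) →
        (∀ t ∈ Set.Ioo (0:ℝ) Tstar,
            jb t ^ (-δ) * calN c0 δ 4 u t + calN c0 δ 3 u t
              ≤ 2 * Cstar * dataNorm f g) →
        (∀ i, ∀ t ∈ Set.Ioo (0:ℝ) Tstar, ∀ x : Sp,
            R + max 1 c0 * t ≤ ‖x‖ → u i (t, x) = 0) →
        dataNorm f g < ε0 →
        ∀ μ ∈ ({3, 4} : Set ℕ), ∀ t ∈ Set.Ioo (0:ℝ) Tstar,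
          calM c0 δ μ u t ≤ C * calN c0 δ μ u t := by
  have hF := structure_cases (c0 := c0) hδ.le hTri hC1 hC2 hC4 hC5 hC6
  obtain ⟨K1, hK1, h1⟩ := exists_SW_le hc0 hδ hδ' hF hCub (Or.inl rfl)
  obtain ⟨K2, hK2, h2⟩ := exists_SW_le hc0 hδ hδ' hF hCub (Or.inr rfl)
  obtain ⟨A, hA, h3⟩ := exists_SW_le_near_zero hc0 hδ.le 1
  obtain ⟨K, hK, hK1', hK2', hA'⟩ : ∃ K : ℝ, 1 ≤ K ∧ K1 ≤ K ∧ K2 ≤ K ∧ A ≤ K :=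
    ⟨K1 + K2 + A, by linarith, by linarith, by linarith, by linarith⟩
  have hK0 : 0 < K := by linarith
  have improve {m : ℕ} {k N : ℝ} {u : Fin 3 → Fn} {t : ℝ} (hk : 1 ≤ k) (hkK : k ≤ K)
      (hN : 0 ≤ N) (hb : K * SW 1 c0 δ u t ≤ 1 / 2)
      (h : k * SW 1 c0 δ u t ≤ 1 →
        SW m c0 δ u t ≤ k * N + k * (SW 1 c0 δ u t * SW m c0 δ u t)) :
      SW m c0 δ u t ≤ 2 * K * N := by
    have n1 := SW_nonneg 1 c0 δ u t
    have n2 := SW_nonneg m c0 δ u t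
    have e1 : k * SW 1 c0 δ u t ≤ 1 / 2 := (mul_le_mul_of_nonneg_right hkK n1).trans hb
    have e2 := h (by linarith)
    have e3 := mul_le_mul_of_nonneg_right e1 n2
    have e4 := mul_le_mul_of_nonneg_right hkK hN
    linarith
  refine ⟨1 / (16 * K ^ 2 * Cstar), by positivity,
    (1 + (idxSet 7 1).card + (idxSet 7 2).card) * (2 * K), by positivity, ?_⟩
  intro R Tstar f g u hR hT hfg hu hsol hdata hap hsupp hsmall μ hμ t ht
  have hadm (j : Fin 3) : Adm (R + max 1 c0 * Tstar) Tstar (u j) := by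
    refine ⟨hu j, fun p hp => hsupp j p.1 hp.1 p.2 ?_⟩
    have h5 : max 1 c0 * p.1 ≤ max 1 c0 * Tstar :=
      mul_le_mul_of_nonneg_left hp.1.2.le (le_max_of_le_left zero_le_one)
    have h6 : R + max 1 c0 * Tstar < ‖p.2‖ := hp.2
    linarith
  have hN (s : ℝ) (hs : s ∈ Ioo 0 Tstar) : K ^ 2 * calN c0 δ 3 u s < 1 / 8 := by
    have e1 := hap s hs
    have e2 : 0 ≤ jb s ^ (-δ) * calN c0 δ 4 u s :=
      mul_nonneg (Real.rpow_nonneg (jb_pos s).le _) (calN_nonneg _ _ _ _ _)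
    rw [lt_div_iff₀ (by positivity)] at hsmall
    have e3 : K ^ 2 * calN c0 δ 3 u s ≤ K ^ 2 * (2 * Cstar * dataNorm f g) :=
      mul_le_mul_of_nonneg_left (by linarith) (by positivity)
    linarith
  have hb (s : ℝ) (hs : s ∈ Ioo 0 Tstar) : K * SW 1 c0 δ u s ≤ 1 / 2 := by
    obtain ⟨t0, ht0, hle⟩ := h3 _ Tstar u hT hadm (1 / (8 * K ^ 2)) (by positivity)
    refine le_of_bootstrap ((continuousOn_SW 1 c0 δ hadm).const_smul K) ht0 ?_ ?_ s hs
    · have e1 := hN t0 ht0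
      have e2 := calN_nonneg c0 δ 3 u t0
      have e3 : K * SW 1 c0 δ u t0 ≤ K * (K * (calN c0 δ 3 u t0 + 1 / (8 * K ^ 2))) :=
        mul_le_mul_of_nonneg_left
          (hle.trans (mul_le_mul_of_nonneg_right hA' (by positivity))) hK0.le
      have e4 : K * (K * (calN c0 δ 3 u t0 + 1 / (8 * K ^ 2))) =
          K ^ 2 * calN c0 δ 3 u t0 + 1 / 8 := by
        field_simp
      change K * SW 1 c0 δ u t0 ≤ 1 / 2
      linarith
    · intro r hr hle
      change K * SW 1 c0 δ u r < 1 / 2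
      have e1 := mul_le_mul_of_nonneg_left (improve hK1 hK1' (calN_nonneg c0 δ 3 u r) hle
        (h1 _ Tstar u hadm hsol r hr)) hK0.le
      have e2 := hN r hr
      linarith
  have final {m : ℕ} (hcard : ((idxSet 7 m).card : ℝ) ≤
      1 + (idxSet 7 1).card + (idxSet 7 2).card) {k : ℝ} (hk : 1 ≤ k) (hkK : k ≤ K)
      (h : k * SW 1 c0 δ u t ≤ 1 → SW m c0 δ u t ≤
        k * calN c0 δ (m + 2) u t + k * (SW 1 c0 δ u t * SW m c0 δ u t)) :
      calM c0 δ (m + 2) u t ≤ (1 + (idxSet 7 1).card + (idxSet 7 2).card) * (2 * K) *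
        calN c0 δ (m + 2) u t := by
    have nC := calN_nonneg c0 δ (m + 2) u t
    rw [mul_assoc]
    exact (calM_le_SW m u t).trans (mul_le_mul hcard (improve hk hkK nC (hb t ht) h)
      (SW_nonneg _ _ _ _ _) (by positivity))
  have c1 : (0 : ℝ) ≤ (idxSet 7 1).card := Nat.cast_nonneg _
  have c2 : (0 : ℝ) ≤ (idxSet 7 2).card := Nat.cast_nonneg _
  rcases hμ with rfl | rfl
  · exact final (m := 1) (by linarith) hK1 hK1' (h1 _ Tstar u hadm hsol t ht)
  · exact final (m := 2) (by linarith) hK2 hK2' (h2 _ Tstar u hadm hsol t ht)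

end MultiSpeedWave
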